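/- There is no 7-tiling of any triangle: for every triangle ABC and every triangle T, there is no family of 7 triangles, each congruent to T, with pairwise disjoint interiors, whose union is the closed triangle ABC. -/

import Mathlib

open EuclideanGeometry Real

noncomputable section

/-- A point of the Euclidean plane. -/
abbrev Pt : Type := EuclideanSpace ℝ (Fin 2)

/-- A triangle, given by its three vertices. -/
abbrev Tri : Type := Fin 3 → Pt

/-- A genuine (nondegenerate) triangle. -/
def IsTriangle (T : Tri) : Prop := AffineIndependent ℝ T

/-- The closed triangle (convex hull of the vertices). -/
def triSet (T : Tri) : Set Pt := convexHull ℝ (Set.range T)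

/-- Two triangles are congruent iff corresponding distances agree
up to a permutation of the vertices. -/
def CongruentTri (T₁ T₂ : Tri) : Prop :=
  ∃ σ : Equiv.Perm (Fin 3), ∀ i j : Fin 3, dist (T₁ i) (T₁ j) = dist (T₂ (σ i)) (T₂ (σ j))

/-- An `N`-tiling of the triangle `ABC` by the tile `T`: a family of `N` triangles,
each congruent to `T`, with pairwise disjoint interiors, whose union is the
closed triangle `ABC`. -/
structure IsTiling (N : ℕ) (ABC T : Tri) (tiles : Fin N → Tri) : Prop where
  congr : ∀ i, CongruentTri (tiles i) T
  disj : ∀ i j, i ≠ j → interior (triSet (tiles i)) ∩ interior (triSet (tiles j)) = ∅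
  cover : (⋃ i, triSet (tiles i)) = triSet ABC

/-- The interior angle of the triangle `T` at its `k`-th vertex. -/
def triAngle (T : Tri) (k : Fin 3) : ℝ := ∠ (T (k + 1)) (T k) (T (k + 2))

/-- The side of `T` opposite to the `k`-th vertex. -/
def sideLen (T : Tri) (k : Fin 3) : ℝ := dist (T (k + 1)) (T (k + 2))

/-- `T` has angles `α`, `β`, `γ` (at vertices `0`, `1`, `2`, which are opposite
the sides of lengths `a`, `b`, `c` respectively). -/
def HasAngles (T : Tri) (α β γ : ℝ) : Prop :=
  triAngle T 0 = α ∧ triAngle T 1 = β ∧ triAngle T 2 = γ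

/-- Two triangles are similar iff corresponding distances agree up to a
permutation of the vertices and a positive scale factor. -/
def SimilarTri (T₁ T₂ : Tri) : Prop :=
  ∃ r : ℝ, 0 < r ∧ ∃ σ : Equiv.Perm (Fin 3),
    ∀ i j : Fin 3, dist (T₁ i) (T₁ j) = r * dist (T₂ (σ i)) (T₂ (σ j))

namespace Seven
open MeasureTheory

def cr (z w : ℂ) : ℝ := z.re * w.im - z.im * w.re

lemma secvol (θ r : ℝ) (h0 : 0 ≤ θ) (h1 : θ ≤ π) (hr : 0 < r) :
    volume {z : ℂ | ‖z‖ < r ∧ 0 < z.arg ∧ z.arg < θ} = ENNReal.ofReal (θ * r ^ 2 / 2) := by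
  have hm : MeasurableSet {z : ℂ | ‖z‖ < r ∧ 0 < z.arg ∧ z.arg < θ} := by
    apply MeasurableSet.inter (measurableSet_lt measurable_norm measurable_const)
    exact MeasurableSet.inter (measurableSet_lt measurable_const Complex.measurable_arg)
      (measurableSet_lt Complex.measurable_arg measurable_const)
  rw [← lintegral_indicator_one hm, ← Complex.lintegral_comp_polarCoord_symm]
  have key : ∀ p ∈ polarCoord.target,
      ENNReal.ofReal p.1 • ({z : ℂ | ‖z‖ < r ∧ 0 < z.arg ∧ z.arg < θ}.indicator 1
        (Complex.polarCoord.symm p) : ENNReal)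
      = (Set.Ioo 0 r ×ˢ Set.Ioo 0 θ).indicator (fun p : ℝ × ℝ => ENNReal.ofReal p.1) p := by
    rintro ⟨ρ, φ⟩ ⟨h1, h2⟩
    simp only [Set.mem_Ioi, Set.mem_Ioo] at h1 h2
    have e1 : ‖Complex.polarCoord.symm (ρ, φ)‖ = ρ := by
      rw [Complex.norm_polarCoord_symm]; exact abs_of_pos h1
    have e2 : (Complex.polarCoord.symm (ρ, φ)).arg = φ := by
      rw [Complex.polarCoord_symm_apply]
      have := Complex.arg_mul_cos_add_sin_mul_I h1 ⟨h2.1, h2.2.le⟩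
      rw [← Complex.ofReal_cos, ← Complex.ofReal_sin] at this
      exact this
    simp only [Set.indicator, Set.mem_ofPred_eq, e1, e2, Set.mem_prod, Set.mem_Ioo]
    by_cases h : ρ < r ∧ 0 < φ ∧ φ < θ
    · rw [if_pos h, if_pos ⟨⟨h1, h.1⟩, h.2⟩]; simp
    · rw [if_neg h, if_neg (fun h' => h ⟨h'.1.2, h'.2⟩)]; simp
  rw [setLIntegral_congr_fun polarCoord.open_target.measurableSet key]
  have hms : MeasurableSet (Set.Ioo (0:ℝ) r ×ˢ Set.Ioo (0:ℝ) θ) :=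
    measurableSet_Ioo.prod measurableSet_Ioo
  rw [lintegral_indicator hms, Measure.restrict_restrict hms]
  have hsub : (Set.Ioo (0:ℝ) r ×ˢ Set.Ioo (0:ℝ) θ) ∩ polarCoord.target
      = Set.Ioo (0:ℝ) r ×ˢ Set.Ioo (0:ℝ) θ := by
    apply Set.inter_eq_left.2
    rintro ⟨ρ, φ⟩ ⟨h2, h3⟩
    exact ⟨h2.1, by have := h3.1; simp at *; linarith [pi_pos], by simp at *; linarith⟩
  rw [hsub, Measure.volume_eq_prod, ← Measure.prod_restrict,
    lintegral_prod _ (by fun_prop)]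
  simp only [lintegral_const, Measure.restrict_apply MeasurableSet.univ, Set.univ_inter,
    Real.volume_Ioo, sub_zero]
  rw [lintegral_mul_const _ (by fun_prop), ← ofReal_integral_eq_lintegral_ofReal,
    ← integral_Ioc_eq_integral_Ioo, ← intervalIntegral.integral_of_le hr.le, integral_id,
    ← ENNReal.ofReal_mul (by nlinarith)]
  · congr 1; ring
  · rw [← IntegrableOn, ← integrableOn_Icc_iff_integrableOn_Ioo]
    exact continuous_id.continuousOn.integrableOn_Icc
  · exact (ae_restrict_iff' measurableSet_Ioo).2 (Filter.Eventually.of_forall fun x hx => hx.1.le)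

lemma linnul (u : ℂ) (hu : u ≠ 0) : volume {z : ℂ | cr u z = 0} = 0 := by
  let f : ℂ →ₗ[ℝ] ℝ :=
    { toFun := fun z => cr u z
      map_add' := by intro x y; simp [cr]; ring
      map_smul' := by intro x y; simp [cr]; ring }
  have h : {z : ℂ | cr u z = 0} = (LinearMap.ker f : Set ℂ) := by
    ext z; simp [f]
  rw [h]
  apply Measure.addHaar_submodule
  intro ht
  have : f (Complex.I * u) = 0 := by
    have : Complex.I * u ∈ LinearMap.ker f := by rw [ht]; trivial
    exact this
  simp [f, cr] at this
  apply hu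
  apply Complex.ext <;> simp <;> nlinarith

lemma convol (u v : ℂ) (h : 0 < cr u v) (r : ℝ) (hr : 0 < r) :
    volume {z : ℂ | ‖z‖ < r ∧ 0 ≤ cr u z ∧ 0 ≤ cr z v}
      = ENNReal.ofReal (InnerProductGeometry.angle u v * r ^ 2 / 2) := by
  have hu : u ≠ 0 := by rintro rfl; simp [cr] at h
  have hv : v ≠ 0 := by rintro rfl; simp [cr] at h
  set θ := (v / u).arg with hθ
  have him : ∀ z : ℂ, (z / u).im = cr u z / Complex.normSq u := by
    intro z; rw [Complex.div_im]; simp [cr]; ring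
  have hn : 0 < Complex.normSq u := Complex.normSq_pos.2 hu
  have hθ0 : 0 < θ := by
    have h1 : 0 ≤ θ := Complex.arg_nonneg_iff.2 (by rw [him]; positivity)
    refine lt_of_le_of_ne h1 fun h2 => ?_
    have := (Complex.arg_eq_zero_iff.1 h2.symm).2
    rw [him] at this; have := div_pos h hn; linarith
  have hθ1 : θ < π := by
    refine lt_of_le_of_ne (Complex.arg_le_pi _) fun h2 => ?_
    have := (Complex.arg_eq_pi_iff.1 h2).2
    rw [him] at this; have := div_pos h hn; linarith
  have hang : InnerProductGeometry.angle u v = θ := by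
    rw [InnerProductGeometry.angle_comm, Complex.angle_eq_abs_arg hv hu, abs_of_pos hθ0]
  rw [hang, ← secvol θ r hθ0.le hθ1.le hr]
  have hnu : ‖u‖ ≠ 0 := norm_ne_zero_iff.2 hu
  let w : Circle := ⟨u / (‖u‖ : ℝ), by
    show _ ∈ Metric.sphere (0:ℂ) 1
    rw [mem_sphere_zero_iff_norm, norm_div]; simp [hnu]⟩
  have hmp := (rotation w).measurePreserving
  have hmeas : MeasurableSet {z : ℂ | ‖z‖ < r ∧ 0 < z.arg ∧ z.arg < θ} := by
    apply MeasurableSet.inter (measurableSet_lt measurable_norm measurable_const)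
    exact MeasurableSet.inter (measurableSet_lt measurable_const Complex.measurable_arg)
      (measurableSet_lt Complex.measurable_arg measurable_const)
  have e0 : volume {z : ℂ | ‖z‖ < r ∧ 0 ≤ cr u z ∧ 0 ≤ cr z v}
      = volume {z : ℂ | ‖z‖ < r ∧ 0 < cr u z ∧ 0 < cr z v} := by
    apply measure_congr
    have a1 : ∀ᵐ z : ℂ, cr u z ≠ 0 := by
      rw [ae_iff]; simpa using linnul u hu
    have a2 : ∀ᵐ z : ℂ, cr z v ≠ 0 := by
      rw [ae_iff]
      have := linnul v hv
      simp only [ne_eq, not_not]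
      convert this using 2
      ext z; simp only [cr, Set.mem_ofPred_eq]; constructor <;> intro h <;> linarith
    filter_upwards [a1, a2] with z h1 h2
    apply propext
    show (‖z‖ < r ∧ 0 ≤ cr u z ∧ 0 ≤ cr z v) ↔ (‖z‖ < r ∧ 0 < cr u z ∧ 0 < cr z v)
    rw [le_iff_lt_or_eq, le_iff_lt_or_eq]
    have := Ne.symm h1
    have := Ne.symm h2
    tauto
  rw [e0]
  have hm2 : MeasurableSet {z : ℂ | ‖z‖ < r ∧ 0 < cr u z ∧ 0 < cr z v} := by
    apply IsOpen.measurableSet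
    exact (isOpen_lt continuous_norm continuous_const).inter
      ((isOpen_lt (f := fun _ => (0:ℝ)) (g := fun z => cr u z) continuous_const (by unfold cr; fun_prop)).inter
      (isOpen_lt (f := fun _ => (0:ℝ)) (g := fun z => cr z v) continuous_const (by unfold cr; fun_prop)))
  rw [← hmp.measure_preimage hm2.nullMeasurableSet]
  congr 1
  ext z
  simp only [Set.mem_preimage, Set.mem_ofPred_eq, rotation_apply]
  rw [norm_mul, Circle.norm_coe, one_mul]
  apply and_congr_right
  intro hz
  have hwz : ((w : ℂ) * z) = u * z / (‖u‖ : ℝ) := by simp [w]; ring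
  rw [hwz]
  have hnp : 0 < ‖u‖ := norm_pos_iff.2 hu
  have c1 : cr u (u * z / (‖u‖ : ℝ)) = ‖u‖ * z.im := by
    have hns : ‖u‖ ^ 2 = u.re * u.re + u.im * u.im := by
      rw [← Complex.normSq_apply, Complex.normSq_eq_norm_sq]
    simp only [cr, Complex.div_ofReal_re, Complex.div_ofReal_im, Complex.mul_re, Complex.mul_im]
    field_simp
    rw [hns]; ring
  have hvp : (v / u) = (‖v/u‖ : ℝ) * (Complex.cos θ + Complex.sin θ * Complex.I) := by
    rw [hθ, Complex.norm_mul_cos_add_sin_mul_I]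
  have hq : 0 < ‖v/u‖ := norm_pos_iff.2 (div_ne_zero hv hu)
  have c2 : cr (u * z / (‖u‖ : ℝ)) v = ‖u‖ * ‖v/u‖ * (z.re * sin θ - z.im * cos θ) := by
    have hv' : v = u * ((‖v/u‖ : ℝ) * (Complex.cos θ + Complex.sin θ * Complex.I)) := by
      rw [← hvp]; field_simp
    have hns : ‖u‖ ^ 2 = u.re * u.re + u.im * u.im := by
      rw [← Complex.normSq_apply, Complex.normSq_eq_norm_sq]
    generalize ‖v/u‖ = q at *
    rw [hv']
    rw [← Complex.ofReal_cos, ← Complex.ofReal_sin]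
    simp only [cr, Complex.div_ofReal_re, Complex.div_ofReal_im, Complex.mul_re, Complex.mul_im,
      Complex.add_re, Complex.add_im, Complex.ofReal_re, Complex.ofReal_im, Complex.I_re,
      Complex.I_im]
    field_simp
    rw [hns]; ring
  rw [c1, c2]
  have hz2 : z = (‖z‖ : ℝ) * (Complex.cos z.arg + Complex.sin z.arg * Complex.I) :=
    (Complex.norm_mul_cos_add_sin_mul_I z).symm
  have hre : z.re = ‖z‖ * cos z.arg := (Complex.norm_mul_cos_arg z).symm
  have him : z.im = ‖z‖ * sin z.arg := (Complex.norm_mul_sin_arg z).symm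
  have hs : z.re * sin θ - z.im * cos θ = ‖z‖ * sin (θ - z.arg) := by
    rw [hre, him, sin_sub]; ring
  rw [hs, him]
  by_cases hz0 : ‖z‖ = 0
  · have : z = 0 := by simpa using hz0
    subst this; simp
  have hzp : 0 < ‖z‖ := lt_of_le_of_ne (norm_nonneg _) (Ne.symm hz0)
  have hiff1 : 0 < ‖u‖ * (‖z‖ * sin z.arg) ↔ 0 < sin z.arg := by
    constructor
    · intro h; by_contra hc; push Not at hc
      have := mul_nonneg hnp.le (mul_nonneg hzp.le (neg_nonneg.2 hc)); linarith
    · intro h; positivity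
  have hiff2 : 0 < ‖u‖ * ‖v/u‖ * (‖z‖ * sin (θ - z.arg)) ↔ 0 < sin (θ - z.arg) := by
    constructor
    · intro h; by_contra hc; push Not at hc
      have := mul_nonneg (mul_pos hnp hq).le (mul_nonneg hzp.le (neg_nonneg.2 hc)); linarith
    · intro h; positivity
  rw [hiff1, hiff2]
  have r1 := Complex.neg_pi_lt_arg z
  have r2 := Complex.arg_le_pi z
  constructor
  · rintro ⟨h1, h2⟩
    have : 0 < z.arg := by
      by_contra hc; push Not at hc
      have := sin_nonpos_of_nonpos_of_neg_pi_le hc r1.le; linarith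
    refine ⟨this, ?_⟩
    by_contra hc; push Not at hc
    have := sin_nonpos_of_nonpos_of_neg_pi_le (x := θ - z.arg) (by linarith) (by linarith)
    linarith
  · rintro ⟨h1, h2⟩
    exact ⟨sin_pos_of_pos_of_lt_pi h1 (by linarith), sin_pos_of_pos_of_lt_pi (by linarith) (by linarith)⟩

lemma halvol (u : ℂ) (hu : u ≠ 0) (r : ℝ) (hr : 0 < r) :
    volume {z : ℂ | ‖z‖ < r ∧ 0 ≤ cr u z} = ENNReal.ofReal (π * r ^ 2 / 2) := by
  have hm : MeasurableSet {z : ℂ | ‖z‖ < r ∧ 0 ≤ cr u z} := by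
    apply MeasurableSet.inter (measurableSet_lt measurable_norm measurable_const)
    exact (isClosed_le (f := fun _ => (0:ℝ)) (g := fun z => cr u z) continuous_const (by unfold cr; fun_prop)).measurableSet
  have e1 : volume {z : ℂ | ‖z‖ < r ∧ 0 ≤ cr u z} = volume {z : ℂ | ‖z‖ < r ∧ cr u z ≤ 0} := by
    rw [← (Measure.measurePreserving_neg (volume : Measure ℂ)).measure_preimage hm.nullMeasurableSet]
    congr 1; ext z; simp [cr]
  have e2 : volume (Metric.ball (0:ℂ) r) = volume {z : ℂ | ‖z‖ < r ∧ 0 ≤ cr u z}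
      + volume {z : ℂ | ‖z‖ < r ∧ cr u z ≤ 0} := by
    rw [← measure_union₀' hm.nullMeasurableSet]
    · congr 1; ext z; simp [← and_or_left]; intro _; exact le_total _ _
    · refine measure_mono_null ?_ (linnul u hu)
      rintro z ⟨⟨_, h1⟩, ⟨_, h2⟩⟩
      exact le_antisymm h2 h1
  rw [← e1, Complex.volume_ball] at e2
  have h3 : ENNReal.ofReal r ^ 2 * (NNReal.pi : ENNReal)
      = ENNReal.ofReal (π * r ^ 2 / 2) + ENNReal.ofReal (π * r ^ 2 / 2) := by
    rw [← ENNReal.ofReal_add (by positivity) (by positivity), ← ENNReal.ofReal_pow hr.le]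
    have : (NNReal.pi : ENNReal) = ENNReal.ofReal π := by
      rw [← NNReal.coe_real_pi, ENNReal.ofReal_coe_nnreal]
    rw [this, ← ENNReal.ofReal_mul (by positivity)]
    congr 1; ring
  rw [h3, ← two_mul, ← two_mul] at e2
  exact ((ENNReal.mul_right_inj (by simp) (by simp)).1 e2).symm
end Seven

namespace Seven
open MeasureTheory

abbrev CTri := Fin 3 → ℂ
def DD (t : CTri) : ℝ := cr (t 1 - t 0) (t 2 - t 0)
def lam (t : CTri) (k : Fin 3) (p : ℂ) : ℝ := cr (t (k+2) - t (k+1)) (p - t (k+1)) / DD t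
def hull (t : CTri) : Set ℂ := convexHull ℝ (Set.range t)
def ang (t : CTri) (k : Fin 3) : ℝ := ∠ (t (k+1)) (t k) (t (k+2))
def onE (t : CTri) (k : Fin 3) (p : ℂ) : Prop :=
  lam t k p = 0 ∧ 0 < lam t (k+1) p ∧ 0 < lam t (k+2) p
def inT (t : CTri) (p : ℂ) : Prop := ∀ k, 0 < lam t k p

lemma lamsel (t : CTri) (h : DD t ≠ 0) (k : Fin 3) : lam t k (t k) = 1 := by
  unfold lam; rw [div_eq_one_iff_eq h]
  fin_cases k <;> simp [DD, cr] <;> ring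
lemma lamo1 (t : CTri) (k : Fin 3) : lam t k (t (k+1)) = 0 := by simp [lam, cr]
lemma lamo2 (t : CTri) (k : Fin 3) : lam t k (t (k+2)) = 0 := by
  unfold lam cr; rw [div_eq_zero_iff]; left; ring
lemma lamne (t : CTri) (k j : Fin 3) (h : k ≠ j) : lam t k (t j) = 0 := by
  have : j = k + 1 ∨ j = k + 2 := by revert k j; decide
  rcases this with rfl | rfl
  · exact lamo1 _ _
  · exact lamo2 _ _
lemma lamsum (t : CTri) (h : DD t ≠ 0) (p : ℂ) : lam t 0 p + lam t 1 p + lam t 2 p = 1 := by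
  unfold lam; rw [← add_div, ← add_div, div_eq_one_iff_eq h]
  simp [DD, cr]; ring
lemma lamsum' (t : CTri) (h : DD t ≠ 0) (k : Fin 3) (p : ℂ) :
    lam t k p + lam t (k+1) p + lam t (k+2) p = 1 := by
  have := lamsum t h p
  fin_cases k <;> simp <;> linarith
lemma lamrep (t : CTri) (h : DD t ≠ 0) (p : ℂ) :
    p = (lam t 0 p : ℂ) * t 0 + lam t 1 p * t 1 + lam t 2 p * t 2 := by
  have e : ∀ k, lam t k p = cr (t (k+2) - t (k+1)) (p - t (k+1)) / DD t := fun _ => rfl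
  rw [e, e, e]
  apply Complex.ext
  · simp [-Complex.ofReal_div]; field_simp; simp [DD, cr]; ring
  · simp [-Complex.ofReal_div]; field_simp; simp [DD, cr]; ring
lemma lamcom (t : CTri) (k : Fin 3) (p q : ℂ) (x y : ℝ) (h : x + y = 1) :
    lam t k (x * p + y * q) = x * lam t k p + y * lam t k q := by
  have : y = 1 - x := by linarith
  subst this
  unfold lam; rw [mul_div, mul_div, ← add_div]; congr 1
  simp [cr]; ring
lemma lamcomb (t : CTri) (k : Fin 3) (p q r : ℂ) (x y z : ℝ) (h : x + y + z = 1) :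
    lam t k (x * p + y * q + z * r) = x * lam t k p + y * lam t k q + z * lam t k r := by
  have : z = 1 - x - y := by linarith
  subst this
  unfold lam; rw [mul_div, mul_div, mul_div, ← add_div, ← add_div]; congr 1
  simp [cr]; ring
lemma lamcon (t : CTri) (k : Fin 3) : Continuous (lam t k) := by
  unfold lam cr; fun_prop

lemma memhul (t : CTri) (h : DD t ≠ 0) (p : ℂ) : p ∈ hull t ↔ ∀ k, 0 ≤ lam t k p := by
  constructor
  · intro hp k
    have hc : Convex ℝ {q | 0 ≤ lam t k q} := by
      intro x hx y hy a b ha hb hab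
      simp only [Set.mem_ofPred_eq, Complex.real_smul] at *
      rw [lamcom _ _ _ _ _ _ hab]; positivity
    have hs : Set.range t ⊆ {q | 0 ≤ lam t k q} := by
      rintro _ ⟨j, rfl⟩
      by_cases hk : k = j
      · subst hk; simp [lamsel t h]
      · simp [lamne t k j hk]
    exact convexHull_min hs hc hp
  · intro hp
    have hc := convex_convexHull ℝ (Set.range t)
    have hm : ∀ k, t k ∈ hull t := fun k => subset_convexHull ℝ _ ⟨k, rfl⟩
    have := hc.sum_mem (t := Finset.univ) (w := fun k => lam t k p) (z := t)
      (fun k _ => hp k) (by rw [Fin.sum_univ_three]; exact lamsum t h p) (fun k _ => hm k)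
    rw [Fin.sum_univ_three] at this
    simp only [Complex.real_smul] at this
    rw [← lamrep t h p] at this
    exact this

lemma memint (t : CTri) (h : DD t ≠ 0) (p : ℂ) : p ∈ interior (hull t) ↔ inT t p := by
  constructor
  · intro hp k
    by_contra hc
    have h0 : lam t k p = 0 := le_antisymm (not_lt.1 hc) ((memhul t h p).1 (interior_subset hp) k)
    have hcont : Continuous (fun e : ℝ => (((1 + e : ℝ) : ℂ)) * p + ((-e : ℝ) : ℂ) * t k) := by fun_prop
    have hnear : ∀ᶠ e in nhds (0:ℝ), (((1 + e : ℝ) : ℂ)) * p + ((-e : ℝ) : ℂ) * t k ∈ hull t := by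
      apply hcont.continuousAt.eventually_mem
      simp only [add_zero, Complex.ofReal_one, one_mul, neg_zero, Complex.ofReal_zero, zero_mul]
      exact mem_interior_iff_mem_nhds.1 hp
    obtain ⟨ε, hε, hb⟩ := Metric.eventually_nhds_iff.1 hnear
    have := hb (y := ε / 2) (by rw [dist_zero_right, norm_of_nonneg] <;> linarith)
    have := (memhul t h _).1 this k
    rw [lamcom _ _ _ _ _ _ (by ring), h0, lamsel t h] at this
    linarith
  · intro hp
    have ho : IsOpen {q | inT t q} := by
      have : {q | inT t q} = ⋂ k, {q | 0 < lam t k q} := by ext; simp [inT]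
      rw [this]
      exact isOpen_iInter_of_finite fun k => isOpen_lt continuous_const (lamcon t k)
    exact interior_maximal (fun q hq => (memhul t h q).2 fun k => (hq k).le) ho hp

open Classical in
def th (t : CTri) (p : ℂ) : ℝ :=
  (∑ k, if t k = p then ang t k else 0) + (∑ k, if onE t k p then π else 0) +
    if inT t p then 2 * π else 0

lemma eqver (t : CTri) (h : DD t ≠ 0) (k : Fin 3) (p : ℂ) (h1 : lam t (k+1) p = 0)
    (h2 : lam t (k+2) p = 0) : t k = p := by
  have hs := lamsum' t h k p
  have hr := lamrep t h p
  rw [h1, h2] at hs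
  have h3 : lam t k p = 1 := by linarith
  rw [hr]
  fin_cases k <;> simp at * <;> simp [h1, h2, h3]

lemma injver (t : CTri) (h : DD t ≠ 0) (k j : Fin 3) (hkj : t k = t j) : k = j := by
  by_contra hc
  have := lamsel t h k
  rw [hkj, lamne t k j hc] at this
  norm_num at this

lemma thver (t : CTri) (h : DD t ≠ 0) (k : Fin 3) : th t (t k) = ang t k := by
  unfold th
  have h1 : ¬ inT t (t k) := fun hh => by
    have := hh (k+1); rw [lamne t (k+1) k (by clear * -; decide +revert)] at this; exact lt_irrefl _ this
  have h2 : ∀ j, ¬ onE t j (t k) := by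
    rintro j ⟨a1, a2, a3⟩
    have : (k = j ∨ k = j + 1) ∨ k = j + 2 := by clear * -; decide +revert
    rcases this with (rfl | rfl) | rfl
    · rw [lamsel t h] at a1; norm_num at a1
    · rw [lamne t (j+2) (j+1) (by clear * -; decide +revert)] at a3; exact lt_irrefl _ a3
    · rw [lamne t (j+1) (j+2) (by clear * -; decide +revert)] at a2; exact lt_irrefl _ a2
  rw [if_neg h1]
  simp only [h2, if_false, Finset.sum_const_zero, add_zero]
  rw [Finset.sum_eq_single k]
  · simp
  · intro b _ hb
    rw [if_neg (fun hh => hb (injver t h b k hh))]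
  · simp

lemma thedg (t : CTri) (h : DD t ≠ 0) (k : Fin 3) (p : ℂ) (hk : onE t k p) : th t p = π := by
  unfold th
  obtain ⟨a1, a2, a3⟩ := hk
  have h1 : ¬ inT t p := fun hh => by have := hh k; linarith
  have h0 : ∀ j, ¬ t j = p := by
    rintro j rfl
    have : (j = k ∨ j = k + 1) ∨ j = k + 2 := by clear * -; decide +revert
    rcases this with (rfl | rfl) | rfl
    · rw [lamsel t h] at a1; norm_num at a1
    · rw [lamne t (k+2) (k+1) (by clear * -; decide +revert)] at a3; exact lt_irrefl _ a3
    · rw [lamne t (k+1) (k+2) (by clear * -; decide +revert)] at a2; exact lt_irrefl _ a2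
  rw [if_neg h1]
  simp only [h0, if_false, Finset.sum_const_zero, add_zero, zero_add]
  rw [Finset.sum_eq_single k]
  · rw [if_pos ⟨a1, a2, a3⟩]
  · intro b _ hb
    rw [if_neg]
    rintro ⟨b1, b2, b3⟩
    have : b = k + 1 ∨ b = k + 2 := by clear * - hb; decide +revert
    rcases this with rfl | rfl <;> linarith
  · simp

lemma thint (t : CTri) (h : DD t ≠ 0) (p : ℂ) (hk : inT t p) : th t p = 2 * π := by
  unfold th
  have h0 : ∀ j, ¬ t j = p := by
    rintro j rfl
    have := hk (j+1); rw [lamne t (j+1) j (by clear * -; decide +revert)] at this; exact lt_irrefl _ this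
  have h2 : ∀ j, ¬ onE t j p := fun j hj => by have := hk j; rw [hj.1] at this; exact lt_irrefl _ this
  simp [h0, h2, hk]

lemma thout (t : CTri) (h : DD t ≠ 0) (p : ℂ) (hk : p ∉ hull t) : th t p = 0 := by
  have h0 : ∀ j, ¬ t j = p := by
    rintro j rfl
    exact hk (subset_convexHull ℝ _ ⟨j, rfl⟩)
  have h1 : ¬ inT t p := fun hh => hk ((memhul t h p).2 fun k => (hh k).le)
  have h2 : ∀ j, ¬ onE t j p := by
    rintro j ⟨a1, a2, a3⟩
    apply hk; rw [memhul t h]; intro k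
    have : (k = j ∨ k = j + 1) ∨ k = j + 2 := by clear * -; decide +revert
    rcases this with (rfl | rfl) | rfl <;> linarith
  simp [th, h0, h1, h2]

lemma caspt (t : CTri) (h : DD t ≠ 0) (p : ℂ) :
    p ∉ hull t ∨ inT t p ∨ (∃ k, onE t k p) ∨ ∃ k, t k = p := by
  by_cases hp : p ∈ hull t
  swap
  · exact Or.inl hp
  right
  rw [memhul t h] at hp
  by_cases hi : inT t p
  · exact Or.inl hi
  right
  unfold inT at hi; push Not at hi
  obtain ⟨k, hk⟩ := hi
  have hk0 : lam t k p = 0 := le_antisymm hk (hp k)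
  rcases (hp (k+1)).lt_or_eq with h1 | h1
  · rcases (hp (k+2)).lt_or_eq with h2 | h2
    · exact Or.inl ⟨k, hk0, h1, h2⟩
    · right
      refine ⟨k+1, eqver t h _ p ?_ ?_⟩
      · rw [add_assoc]; exact h2.symm
      · have : k + 1 + 2 = k := by clear * -; decide +revert
        rw [this]; exact hk0
  · right
    refine ⟨k+2, eqver t h _ p ?_ ?_⟩
    · have : k + 2 + 1 = k := by clear * -; decide +revert
      rw [this]; exact hk0
    · have : k + 2 + 2 = k + 1 := by clear * -; decide +revert
      rw [this]; exact h1.symm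

lemma angeq (t : CTri) (k : Fin 3) :
    ang t k = InnerProductGeometry.angle (t (k+1) - t k) (t (k+2) - t k) := rfl

lemma ddcyc (t : CTri) (k : Fin 3) : DD t = cr (t (k+1) - t k) (t (k+2) - t k) := by
  fin_cases k <;> simp [DD, cr] <;> ring

lemma voltr (p : ℂ) (S : Set ℂ) : volume S = volume ((fun z => p + z) ⁻¹' S) :=
  (measure_preimage_add volume p S).symm

lemma neapos (t : CTri) (k : Fin 3) (p : ℂ) (h : 0 < lam t k p) :
    ∀ᶠ r in nhdsWithin (0:ℝ) (Set.Ioi 0), ∀ z, ‖z‖ < r → 0 ≤ lam t k (p + z) := by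
  have hc : Continuous fun z => lam t k (p + z) := (lamcon t k).comp (by fun_prop)
  have : ∀ᶠ z in nhds (0:ℂ), 0 < lam t k (p + z) :=
    hc.continuousAt.eventually (lt_mem_nhds (by simpa using h))
  obtain ⟨ε, hε, hb⟩ := Metric.eventually_nhds_iff.1 this
  have hI : Set.Ioo (0:ℝ) ε ∈ nhdsWithin (0:ℝ) (Set.Ioi 0) := Ioo_mem_nhdsGT hε
  filter_upwards [hI] with r hr z hz
  exact (hb (by rw [dist_zero_right]; linarith [hr.2])).le

lemma locvol (t : CTri) (h : DD t ≠ 0) (p : ℂ) :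
    ∀ᶠ r in nhdsWithin (0:ℝ) (Set.Ioi 0),
      volume (hull t ∩ Metric.ball p r) = ENNReal.ofReal (th t p * r ^ 2 / 2) := by
  have hpos : ∀ᶠ r in nhdsWithin (0:ℝ) (Set.Ioi 0), 0 < r := eventually_mem_nhdsWithin
  have hmem : ∀ r z, z ∈ (fun z => p + z) ⁻¹' (hull t ∩ Metric.ball p r) ↔
      (‖z‖ < r ∧ ∀ k, 0 ≤ lam t k (p + z)) := by
    intro r z
    simp [memhul t h, and_comm]
  rcases caspt t h p with hc | hc | ⟨k, hk⟩ | ⟨k, hk⟩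
  · have hcl : IsClosed (hull t) := (Set.finite_range t).isClosed_convexHull ℝ
    have : (hull t)ᶜ ∈ nhds p := hcl.isOpen_compl.mem_nhds hc
    obtain ⟨ε, hε, hb⟩ := Metric.mem_nhds_iff.1 this
    have hI : Set.Ioo (0:ℝ) ε ∈ nhdsWithin (0:ℝ) (Set.Ioi 0) := Ioo_mem_nhdsGT hε
    filter_upwards [hI] with r hr
    rw [thout t h p hc]
    have : hull t ∩ Metric.ball p r = ∅ := by
      ext z; simp only [Set.mem_inter_iff, Set.mem_empty_iff_false, iff_false, not_and]
      intro hz hz2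
      exact hb (Metric.ball_subset_ball hr.2.le hz2) hz
    simp [this]
  · have hall := (Filter.eventually_all.2 fun k => neapos t k p (hc k))
    filter_upwards [hall, hpos] with r hr hr0
    rw [thint t h p hc]
    have : hull t ∩ Metric.ball p r = Metric.ball p r := by
      apply Set.inter_eq_right.2
      intro z hz
      rw [memhul t h]
      intro k
      have := hr k (z - p) (by simpa [dist_eq_norm] using hz)
      simpa using this
    rw [this, Complex.volume_ball, ← ENNReal.ofReal_pow hr0.le]
    have : (NNReal.pi : ENNReal) = ENNReal.ofReal π := by
      rw [← NNReal.coe_real_pi, ENNReal.ofReal_coe_nnreal]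
    rw [this, ← ENNReal.ofReal_mul (by positivity)]
    congr 1; ring
  · filter_upwards [neapos t (k+1) p hk.2.1, neapos t (k+2) p hk.2.2, hpos] with r h1 h2 hr0
    rw [thedg t h k p hk, voltr p]
    set e := ((DD t : ℝ) : ℂ) * (t (k+2) - t (k+1)) with he
    have he0 : e ≠ 0 := by
      refine mul_ne_zero (by exact_mod_cast h) (sub_ne_zero.2 fun hh => ?_)
      have := injver t h _ _ hh
      clear * - this; revert this; decide +revert
    rw [← halvol e he0 r hr0]
    congr 1
    ext z
    rw [hmem]
    show _ ↔ (‖z‖ < r ∧ 0 ≤ cr e z)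
    apply and_congr_right
    intro hz
    have hl : lam t k (p + z) = cr e z / (DD t) ^ 2 := by
      have : lam t k (p + z) = lam t k p + cr e z / (DD t) ^ 2 := by
        unfold lam; rw [he]; field_simp; simp [cr]; ring
      rw [this, hk.1, zero_add]
    have hp2 : 0 < DD t ^ 2 := by positivity
    constructor
    · intro hh
      have := hh k
      rw [hl] at this
      by_contra hc; push Not at hc
      have := div_neg_of_neg_of_pos hc hp2; linarith
    · intro hh j
      have : (j = k ∨ j = k + 1) ∨ j = k + 2 := by clear * -; decide +revert
      rcases this with (rfl | rfl) | rfl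
      · rw [hl]; positivity
      · exact h1 z hz
      · exact h2 z hz
  · subst hk
    have hkp : 0 < lam t k (t k) := by rw [lamsel t h]; norm_num
    filter_upwards [neapos t k _ hkp, hpos] with r h1 hr0
    rw [thver t h k, voltr (t k)]
    set u := t (k+1) - t k with hu
    set v := t (k+2) - t k with hv
    have hD : DD t = cr u v := ddcyc t k
    have hl2 : ∀ z, lam t (k+2) (t k + z) = cr u z / DD t := by
      intro z; unfold lam; rw [hu]; clear * -; congr 1
      fin_cases k <;> simp [cr]
    have hl1 : ∀ z, lam t (k+1) (t k + z) = cr z v / DD t := by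
      intro z; unfold lam; rw [hv]; clear * -; congr 1
      fin_cases k <;> simp [cr] <;> ring
    have hset : ∀ z, (∀ j, 0 ≤ lam t j (t k + z)) ∧ ‖z‖ < r ↔
        ‖z‖ < r ∧ 0 ≤ cr u z / DD t ∧ 0 ≤ cr z v / DD t := by
      intro z
      constructor
      · rintro ⟨a, b⟩
        refine ⟨b, ?_, ?_⟩
        · rw [← hl2]; exact a _
        · rw [← hl1]; exact a _
      · rintro ⟨a, b, c⟩
        refine ⟨fun j => ?_, a⟩
        have : (j = k ∨ j = k + 1) ∨ j = k + 2 := by clear * -; decide +revert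
        rcases this with (rfl | rfl) | rfl
        · exact h1 z a
        · rw [hl1]; exact c
        · rw [hl2]; exact b
    rw [angeq]
    rcases lt_or_gt_of_ne h with hD0 | hD0
    · rw [InnerProductGeometry.angle_comm]
      have hvu : 0 < cr v u := by
        have : cr v u = - cr u v := by unfold cr; ring
        rw [this, ← hD]; linarith
      rw [← convol v u hvu r hr0]
      congr 1
      ext z
      rw [hmem, and_comm, hset]
      show _ ↔ (‖z‖ < r ∧ 0 ≤ cr v z ∧ 0 ≤ cr z u)
      have e1 : cr v z = - cr z v := by unfold cr; ring
      have e2 : cr z u = - cr u z := by unfold cr; ring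
      rw [e1, e2, le_div_iff_of_neg hD0, le_div_iff_of_neg hD0, zero_mul, neg_nonneg, neg_nonneg]
      tauto
    · rw [← convol u v (hD ▸ hD0) r hr0]
      congr 1
      ext z
      rw [hmem, and_comm, hset]
      show _ ↔ (‖z‖ < r ∧ 0 ≤ cr u z ∧ 0 ≤ cr z v)
      rw [le_div_iff₀ hD0, le_div_iff₀ hD0, zero_mul]
end Seven

namespace Seven
open MeasureTheory
open scoped Pointwise

lemma dsq (p q : ℂ) : dist p q ^ 2 = (p.re - q.re) ^ 2 + (p.im - q.im) ^ 2 := by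
  rw [dist_eq_norm, ← Complex.normSq_eq_norm_sq, Complex.normSq_apply]; simp; ring

lemma ddsq (t : CTri) (k : Fin 3) : DD t ^ 2 = dist (t k) (t (k+1)) ^ 2 * dist (t k) (t (k+2)) ^ 2 -
    ((dist (t k) (t (k+1)) ^ 2 + dist (t k) (t (k+2)) ^ 2 - dist (t (k+1)) (t (k+2)) ^ 2) / 2) ^ 2 := by
  rw [ddcyc t k, dsq, dsq, dsq]; simp [cr]; ring

def std0 : CTri := ![0, 1, Complex.I]
def lmap (t : CTri) : ℂ →ₗ[ℝ] ℂ :=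
  Matrix.toLin Complex.basisOneI Complex.basisOneI
    !![(t 1 - t 0).re, (t 2 - t 0).re; (t 1 - t 0).im, (t 2 - t 0).im]

lemma lmaapp (t : CTri) (z : ℂ) : lmap t z = z.re * (t 1 - t 0) + z.im * (t 2 - t 0) := by
  unfold lmap
  rw [Matrix.toLin_apply]
  simp [Matrix.mulVec, dotProduct]
  apply Complex.ext <;> simp <;> ring

lemma hulvol (t : CTri) : volume (hull t) = ENNReal.ofReal |DD t| * volume (hull std0) := by
  have h1 : hull t = (fun z => t 0 + z) '' (lmap t '' hull std0) := by
    have h2 : (fun z => t 0 + z) '' (lmap t '' hull std0) = t 0 +ᵥ (lmap t '' hull std0) := rfl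
    rw [h2, hull, hull, LinearMap.image_convexHull, ← convexHull_vadd]
    congr 1
    rw [← Set.range_comp]
    ext z
    simp only [Set.mem_range, Set.mem_vadd_set, Function.comp, Fin.exists_fin_succ_pi, vadd_eq_add]
    constructor
    · rintro ⟨k, rfl⟩
      refine ⟨lmap t (std0 k), ⟨k, rfl⟩, ?_⟩
      rw [lmaapp]
      fin_cases k <;> simp [std0]
    · rintro ⟨_, ⟨k, rfl⟩, rfl⟩
      refine ⟨k, ?_⟩
      rw [lmaapp]
      fin_cases k <;> simp [std0]
  have hdet : LinearMap.det (lmap t) = DD t := by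
    rw [lmap, LinearMap.det_toLin, Matrix.det_fin_two_of]; simp [DD, cr]; ring
  rw [h1, Set.image_add_left, measure_preimage_add, Measure.addHaar_image_linearMap, hdet]

lemma stdpos : 0 < volume (hull std0) := by
  have hD : DD std0 ≠ 0 := by simp [DD, std0, cr]
  apply Measure.measure_pos_of_nonempty_interior
  refine ⟨(1/3 : ℝ) * (1 + Complex.I), ?_⟩
  rw [memint _ hD]
  intro k
  fin_cases k <;> simp [lam, DD, std0, cr] <;> norm_num

lemma stdfin : volume (hull std0) < ⊤ :=
  ((Set.finite_range std0).isCompact_convexHull ℝ).measure_lt_top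

open Finset (mem_filter mem_univ sum_congr sum_mul mem_image card_filter sum_add_distrib card_union_of_disjoint card_eq_one mem_union mem_singleton mem_sdiff filter_eq_empty_iff card_eq_zero sum_nonneg mem_insert)
structure Til (Z T : CTri) (t : Fin 7 → CTri) : Prop where
  hZ : DD Z ≠ 0
  hT : DD T ≠ 0
  cong : ∀ i j k, dist (t i j) (t i k) = dist (T j) (T k)
  disj : ∀ i j, i ≠ j → interior (hull (t i)) ∩ interior (hull (t j)) = ∅
  cover : (⋃ i, hull (t i)) = hull Z

variable {Z T : CTri} {t : Fin 7 → CTri}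

lemma Til.sqD (H : Til Z T t) (i : Fin 7) : DD (t i) ^ 2 = DD T ^ 2 := by
  rw [ddsq _ 0, ddsq _ 0]; simp only [H.cong]

lemma Til.hD (H : Til Z T t) (i : Fin 7) : DD (t i) ≠ 0 := by
  have := H.sqD i
  intro h
  rw [h] at this
  exact H.hT (by simpa using this.symm)

lemma Til.absD (H : Til Z T t) (i : Fin 7) : |DD (t i)| = |DD T| := by
  rw [← sqrt_sq_eq_abs, ← sqrt_sq_eq_abs, H.sqD]

lemma Til.vol (H : Til Z T t) (S : Set ℂ) (hS : MeasurableSet S) :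
    volume (hull Z ∩ S) = ∑ i, volume (hull (t i) ∩ S) := by
  have hc : ∀ i, IsClosed (hull (t i)) := fun i => (Set.finite_range _).isClosed_convexHull ℝ
  rw [← H.cover, Set.iUnion_inter, measure_iUnion₀, tsum_fintype]
  · intro i j hij
    show volume _ = 0
    have h0 : volume (frontier (hull (t i)) ∪ frontier (hull (t j))) = 0 := by
      rw [measure_union_null_iff]
      exact ⟨(convex_convexHull ℝ _).addHaar_frontier volume, (convex_convexHull ℝ _).addHaar_frontier volume⟩
    refine measure_mono_null ?_ h0
    rintro z ⟨⟨h1, _⟩, ⟨h2, _⟩⟩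
    by_contra hcon
    simp only [Set.mem_union, not_or] at hcon
    rw [(hc i).frontier_eq, (hc j).frontier_eq] at hcon
    simp only [Set.mem_sdiff, not_and, not_not] at hcon
    have : z ∈ interior (hull (t i)) ∩ interior (hull (t j)) := ⟨hcon.1 h1, hcon.2 h2⟩
    rw [H.disj i j hij] at this
    exact this
  · intro i
    exact ((hc i).measurableSet.inter hS).nullMeasurableSet

open Classical in
lemma thnon (t : CTri) (p : ℂ) : 0 ≤ th t p := by
  unfold th
  have h1 : 0 ≤ ∑ k, (if t k = p then ang t k else 0) := by
    apply sum_nonneg; intro k _; split_ifs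
    · exact InnerProductGeometry.angle_nonneg _ _
    · rfl
  have h2 : 0 ≤ ∑ k, (if onE t k p then π else 0) := by
    apply sum_nonneg; intro k _; split_ifs
    · exact pi_pos.le
    · rfl
  split_ifs <;> linarith [pi_pos]

lemma Til.F1 (H : Til Z T t) (p : ℂ) : ∑ i, th (t i) p = th Z p := by
  have hall := (Filter.eventually_all.2 fun i => locvol (t i) (H.hD i) p)
  have hpos : ∀ᶠ r in nhdsWithin (0:ℝ) (Set.Ioi 0), 0 < r := eventually_mem_nhdsWithin
  obtain ⟨r, h1, h2, h3⟩ := (hall.and ((locvol Z H.hZ p).and hpos)).exists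
  have := H.vol (Metric.ball p r) measurableSet_ball
  rw [h2] at this
  simp only [h1] at this
  rw [← ENNReal.ofReal_sum_of_nonneg, ENNReal.ofReal_eq_ofReal_iff] at this
  · rw [← Finset.sum_div, ← sum_mul] at this
    have hr : (r ^ 2) ≠ 0 := by positivity
    field_simp at this
    exact this.symm
  · have := thnon Z p; positivity
  · apply sum_nonneg; intro i _; have := thnon (t i) p; positivity
  · intro i _; have := thnon (t i) p; positivity

lemma Til.area (H : Til Z T t) : |DD Z| = 7 * |DD T| := by
  have := H.vol Set.univ MeasurableSet.univ
  simp only [Set.inter_univ] at this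
  rw [hulvol] at this
  simp only [hulvol (t _), H.absD] at this
  rw [Finset.sum_const, Finset.card_univ, Fintype.card_fin, ← smul_mul_assoc,
    ENNReal.mul_left_inj stdpos.ne' stdfin.ne, nsmul_eq_mul] at this
  rw [show ((7:ℕ) : ENNReal) = ENNReal.ofReal 7 by simp, ← ENNReal.ofReal_mul (by norm_num),
    ENNReal.ofReal_eq_ofReal_iff (abs_nonneg _) (by positivity)] at this
  exact this

lemma Til.angeq (H : Til Z T t) (i : Fin 7) (k : Fin 3) : ang (t i) k = ang T k := by
  have h := H.cong i
  have e : ∀ s : CTri, ang s k = Real.arccos ((dist (s k) (s (k+1)) ^ 2 + dist (s k) (s (k+2)) ^ 2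
      - dist (s (k+1)) (s (k+2)) ^ 2) / 2 / (dist (s k) (s (k+1)) * dist (s k) (s (k+2)))) := by
    intro s
    rw [Seven.angeq, InnerProductGeometry.angle, dist_comm (s k), dist_eq_norm, dist_comm (s k),
      dist_eq_norm, dist_eq_norm (s (k+1))]
    congr 2
    have e := @norm_sub_sq_real ℂ _ _ (s (k+1) - s k) (s (k+2) - s k)
    rw [sub_sub_sub_cancel_right] at e
    linarith
  rw [e, e, h, h, h]
lemma mler {a b c : ℝ} (h : b ≤ c) (k : 0 ≤ a) : b * a ≤ c * a := mul_le_mul_of_nonneg_right h k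
lemma mlel {a b c : ℝ} (h : b ≤ c) (k : 0 ≤ a) : a * b ≤ a * c := mul_le_mul_of_nonneg_left h k
lemma mlc {R : Type*} [Field R] {a b c : R} (h : a ≠ 0) (k : a * b = a * c) : b = c := mul_left_cancel₀ h k
lemma mrc {R : Type*} [Field R] {a b c : R} (h : b ≠ 0) (k : a * b = c * b) : a = c := mul_right_cancel₀ h k
lemma e1 : (1 : Fin 3) + 1 = 2 := rfl
lemma e2 : (1 : Fin 3) + 2 = 0 := rfl
lemma e3 : (2 : Fin 3) + 1 = 0 := rfl
lemma e4 : (2 : Fin 3) + 2 = 1 := rfl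
end Seven

namespace Seven
open Finset (mem_filter mem_univ sum_congr sum_mul mem_image card_filter sum_add_distrib card_union_of_disjoint card_eq_one mem_union mem_singleton mem_sdiff filter_eq_empty_iff card_eq_zero sum_nonneg mem_insert)

def L (t : CTri) (k : Fin 3) : ℝ := dist (t (k+1)) (t (k+2))

lemma disk1 (t : CTri) (k : Fin 3) : dist (t k) (t (k+1)) = L t (k+2) := by
  fin_cases k <;> rfl
lemma disk2 (t : CTri) (k : Fin 3) : dist (t k) (t (k+2)) = L t (k+1) := by
  rw [dist_comm]; fin_cases k <;> rfl

lemma lpos (t : CTri) (h : DD t ≠ 0) (k : Fin 3) : 0 < L t k := by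
  apply dist_pos.2; intro hh
  have := injver t h _ _ hh
  clear * - this; revert this; decide +revert

lemma lawcos (t : CTri) (k : Fin 3) :
    L t k ^ 2 = L t (k+1) ^ 2 + L t (k+2) ^ 2 - 2 * L t (k+1) * L t (k+2) * cos (ang t k) := by
  have := EuclideanGeometry.dist_sq_eq_dist_sq_add_dist_sq_sub_two_mul_dist_mul_dist_mul_cos_angle
    (t (k+1)) (t k) (t (k+2))
  rw [dist_comm (t (k+1)) (t k), disk1, dist_comm (t (k+2)) (t k), disk2] at this
  have e : L t k = dist (t (k+1)) (t (k+2)) := rfl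
  rw [e]; unfold ang; linarith

lemma laware (t : CTri) (k : Fin 3) :
    |DD t| = L t (k+1) * L t (k+2) * sin (ang t k) := by
  have h0 : 0 ≤ sin (ang t k) := sin_nonneg_of_nonneg_of_le_pi (InnerProductGeometry.angle_nonneg _ _)
    (InnerProductGeometry.angle_le_pi _ _)
  have h1 := lawcos t k
  have h2 := ddsq t k
  have h3 := sin_sq_add_cos_sq (ang t k)
  rw [disk1, disk2] at h2
  have e : L t k = dist (t (k+1)) (t (k+2)) := rfl
  rw [← e, h1] at h2
  have hn : 0 ≤ L t (k+1) * L t (k+2) * sin (ang t k) :=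
    mul_nonneg (mul_nonneg dist_nonneg dist_nonneg) h0
  rw [← sqrt_sq_eq_abs, ← sqrt_sq hn, h2]
  congr 1
  have : sin (ang t k) ^ 2 = 1 - cos (ang t k) ^ 2 := by linarith
  rw [mul_pow, this]; ring

lemma sinangpos (t : CTri) (h : DD t ≠ 0) (k : Fin 3) : 0 < sin (ang t k) := by
  have h1 := laware t k
  have h2 : 0 < |DD t| := abs_pos.2 h
  have := lpos t h (k+1)
  have := lpos t h (k+2)
  rw [h1] at h2
  exact (pos_iff_pos_of_mul_pos h2).1 (by positivity)

lemma angpos (t : CTri) (h : DD t ≠ 0) (k : Fin 3) : 0 < ang t k := by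
  refine lt_of_le_of_ne (InnerProductGeometry.angle_nonneg _ _) fun hh => ?_
  have := sinangpos t h k
  rw [show ang t k = 0 from hh.symm] at this; simp at this
lemma anglt (t : CTri) (h : DD t ≠ 0) (k : Fin 3) : ang t k < π := by
  refine lt_of_le_of_ne (InnerProductGeometry.angle_le_pi _ _) fun hh => ?_
  have := sinangpos t h k
  rw [show ang t k = π from hh] at this; simp at this
lemma angsum (t : CTri) (h : DD t ≠ 0) : ang t 0 + ang t 1 + ang t 2 = π := by
  have h1 : t 1 ≠ t 0 := fun hh => by have := injver t h _ _ hh; simp at this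
  have h2 : t 2 ≠ t 0 := fun hh => by have := injver t h _ _ hh; simp at this
  have := EuclideanGeometry.angle_add_angle_add_angle_eq_pi (p₁ := t 0) (p₂ := t 1) (t 2) h1
  have e0 : ang t 0 = ∠ (t 1) (t 0) (t 2) := rfl
  have e1 : ang t 1 = ∠ (t 2) (t 1) (t 0) := rfl
  have e2 : ang t 2 = ∠ (t 0) (t 2) (t 1) := rfl
  rw [e0, e1, e2, ← this, EuclideanGeometry.angle_comm (t 0) (t 1) (t 2), EuclideanGeometry.angle_comm (t 1) (t 2) (t 0), EuclideanGeometry.angle_comm (t 2) (t 0) (t 1)]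
  ring

lemma Til.lp (H : Til Z T t) (k : Fin 3) : 0 < L T k := lpos T H.hT k
lemma Til.apos (H : Til Z T t) (k : Fin 3) : 0 < ang T k := angpos T H.hT k
lemma Til.asum (H : Til Z T t) : ang T 0 + ang T 1 + ang T 2 = π := angsum T H.hT
lemma Til.spos (H : Til Z T t) (k : Fin 3) : 0 < sin (ang T k) := sinangpos T H.hT k

variable {Z T : CTri} {t : Fin 7 → CTri}

open Classical in
def VV (t : Fin 7 → CTri) : Finset ℂ := Finset.univ.image (fun x : Fin 7 × Fin 3 => t x.1 x.2)
open Classical in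
def NN (t : Fin 7 → CTri) (p : ℂ) (j : Fin 3) : ℕ := (Finset.univ.filter fun i => t i j = p).card
open Classical in
def EE (t : Fin 7 → CTri) (p : ℂ) : ℕ :=
  (Finset.univ.filter fun x : Fin 7 × Fin 3 => onE (t x.1) x.2 p).card
open Classical in
def II (t : Fin 7 → CTri) (p : ℂ) : ℕ := (Finset.univ.filter fun i => inT (t i) p).card
open Classical in
def CC (Z : CTri) : Finset ℂ := Finset.univ.image Z
def WW (Z : CTri) (t : Fin 7 → CTri) : Finset ℂ := open Classical in VV t \ CC Z
open Classical in
def uu (Z : CTri) (t : Fin 7 → CTri) (p : ℂ) : ℕ := if inT Z p then 2 - EE t p else 1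

lemma memvv (i : Fin 7) (k : Fin 3) : t i k ∈ VV t := by
  simp [VV]

lemma Til.F1' (H : Til Z T t) (p : ℂ) :
    (NN t p 0 * ang T 0 + NN t p 1 * ang T 1 + NN t p 2 * ang T 2) + EE t p * π + II t p * (2 * π)
      = th Z p := by
  classical
  rw [← H.F1 p]
  unfold th
  rw [sum_add_distrib, sum_add_distrib]
  congr 1
  · congr 1
    · simp only [H.angeq]
      rw [Finset.sum_comm, Fin.sum_univ_three]
      simp only [NN, card_filter, Nat.cast_sum, sum_mul]
      congr 1
      · congr 1 <;> (apply sum_congr rfl; intro i _; split_ifs <;> simp)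
      · apply sum_congr rfl; intro i _; split_ifs <;> simp
    · rw [← Fintype.sum_prod_type' (f := fun (i : Fin 7) (k : Fin 3) => if onE (t i) k p then π else 0)]
      simp only [EE, card_filter, Nat.cast_sum, sum_mul]
      apply sum_congr rfl; intro i _; split_ifs <;> simp
  · simp only [II, card_filter, Nat.cast_sum, sum_mul]
    apply sum_congr rfl; intro i _; split_ifs <;> simp

lemma nnposof (i : Fin 7) (k : Fin 3) : 0 < NN t (t i k) k := by
  unfold NN; rw [Finset.card_pos]; exact ⟨i, by simp⟩

def NA (T : CTri) (t : Fin 7 → CTri) (p : ℂ) : ℝ :=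
  NN t p 0 * ang T 0 + NN t p 1 * ang T 1 + NN t p 2 * ang T 2

lemma nanon (H : Til Z T t) (p : ℂ) : 0 ≤ NA T t p := by
  have h0 := H.apos 0
  have h1 := H.apos 1
  have h2 := H.apos 2
  unfold NA; positivity

lemma Til.napos (H : Til Z T t) (p : ℂ) (hp : p ∈ VV t) : 0 < NA T t p := by
  have h0 := H.apos 0
  have h1 := H.apos 1
  have h2 := H.apos 2
  simp only [VV, mem_image, mem_univ, true_and] at hp
  obtain ⟨⟨i, k⟩, rfl⟩ := hp
  have : (1:ℝ) ≤ NN t (t i k) k := by exact_mod_cast nnposof i k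
  unfold NA
  fin_cases k <;> simp only [Fin.isValue, Fin.zero_eta, Fin.mk_one, Fin.reduceFinMk] at * <;> nlinarith [mul_nonneg (Nat.cast_nonneg (α := ℝ) (NN t (t i 0) 1)) h1.le,
    mul_nonneg (Nat.cast_nonneg (α := ℝ) (NN t (t i 0) 2)) h2.le,
    mul_nonneg (Nat.cast_nonneg (α := ℝ) (NN t (t i 1) 0)) h0.le,
    mul_nonneg (Nat.cast_nonneg (α := ℝ) (NN t (t i 1) 2)) h2.le,
    mul_nonneg (Nat.cast_nonneg (α := ℝ) (NN t (t i 2) 0)) h0.le,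
    mul_nonneg (Nat.cast_nonneg (α := ℝ) (NN t (t i 2) 1)) h1.le]

lemma Til.corner (H : Til Z T t) (K : Fin 3) :
    NA T t (Z K) = ang Z K ∧ EE t (Z K) = 0 ∧ II t (Z K) = 0 := by
  have h := H.F1' (Z K)
  rw [thver Z H.hZ] at h
  have h1 := anglt Z H.hZ K
  have h2 := nanon H (Z K)
  unfold NA at *
  have hE : EE t (Z K) = 0 := by
    by_contra hc
    have : (1:ℝ) ≤ EE t (Z K) := by exact_mod_cast Nat.one_le_iff_ne_zero.2 hc
    have : (0:ℝ) ≤ II t (Z K) := by positivity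
    nlinarith [pi_pos]
  have hI : II t (Z K) = 0 := by
    by_contra hc
    have : (1:ℝ) ≤ II t (Z K) := by exact_mod_cast Nat.one_le_iff_ne_zero.2 hc
    have : (0:ℝ) ≤ EE t (Z K) := by positivity
    nlinarith [pi_pos]
  refine ⟨?_, hE, hI⟩
  rw [hE, hI] at h; simp at h; exact h

lemma Til.memhull (H : Til Z T t) (i : Fin 7) (k : Fin 3) : t i k ∈ hull Z := by
  rw [← H.cover]; exact Set.mem_iUnion.2 ⟨i, subset_convexHull ℝ _ ⟨k, rfl⟩⟩

lemma Til.lamZ (H : Til Z T t) (i : Fin 7) (k K : Fin 3) : 0 ≤ lam Z K (t i k) :=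
  (memhul Z H.hZ _).1 (H.memhull i k) K

lemma Til.nonc (H : Til Z T t) (p : ℂ) (hp : p ∈ WW Z t) :
    NA T t p = uu Z t p * π ∧ (uu Z t p = 1 ∨ uu Z t p = 2) ∧ II t p = 0 ∧
    ((inT Z p ∧ EE t p + uu Z t p = 2) ∨ ((∃ K, onE Z K p) ∧ EE t p = 0 ∧ uu Z t p = 1)) := by
  have hV : p ∈ VV t ∧ p ∉ CC Z := by simpa [WW] using hp
  have hpos := H.napos p hV.1
  have h := H.F1' p
  have hh : p ∈ hull Z := by
    obtain ⟨⟨i, k⟩, hx⟩ : ∃ x : Fin 7 × Fin 3, t x.1 x.2 = p := by simpa [VV] using hV.1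
    rw [← hx]; exact H.memhull i k
  have hnc : ∀ k, Z k ≠ p := by
    intro k hk; exact hV.2 (by simp only [CC, mem_image]; exact ⟨k, by simp, hk⟩)
  have e0 : (0:ℝ) ≤ EE t p := by positivity
  have i0 : (0:ℝ) ≤ II t p := by positivity
  change NA T t p + _ + _ = _ at h
  rcases caspt Z H.hZ p with hc | hc | ⟨k, hk⟩ | ⟨k, hk⟩
  · exact absurd hh hc
  · rw [thint Z H.hZ p hc] at h
    have hI : II t p = 0 := by
      by_contra hc
      have : (1:ℝ) ≤ II t p := by exact_mod_cast Nat.one_le_iff_ne_zero.2 hc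
      nlinarith [pi_pos]
    have hE : EE t p < 2 := by
      by_contra hc
      have : (2:ℝ) ≤ EE t p := by exact_mod_cast not_lt.1 hc
      nlinarith [pi_pos]
    have hu : uu Z t p = 2 - EE t p := by simp [uu, hc]
    have hu2 : (uu Z t p : ℝ) = 2 - EE t p := by
      rw [hu]; push_cast [Nat.cast_sub hE.le]; ring
    rw [hI] at h
    refine ⟨?_, by omega, hI, Or.inl ⟨hc, by omega⟩⟩
    rw [hu2]; simp at h; linarith
  · rw [thedg Z H.hZ k p hk] at h
    have hc : ¬ inT Z p := fun hc => by have := hc k; rw [hk.1] at this; exact lt_irrefl _ this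
    have hI : II t p = 0 := by
      by_contra hc
      have : (1:ℝ) ≤ II t p := by exact_mod_cast Nat.one_le_iff_ne_zero.2 hc
      nlinarith [pi_pos]
    have hE : EE t p = 0 := by
      by_contra hc
      have : (1:ℝ) ≤ EE t p := by exact_mod_cast Nat.one_le_iff_ne_zero.2 hc
      nlinarith [pi_pos]
    have hu : uu Z t p = 1 := by simp [uu, hc]
    rw [hI, hE] at h
    refine ⟨?_, by omega, hI, Or.inr ⟨⟨k, hk⟩, hE, hu⟩⟩
    rw [hu]; simp at h; simp; linarith
  · exact absurd hk (hnc k)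

lemma Til.cormem (H : Til Z T t) (K : Fin 3) : Z K ∈ VV t := by
  have h1 := (H.corner K).1
  have h2 := angpos Z H.hZ K
  by_contra hc
  have : ∀ j, NN t (Z K) j = 0 := by
    intro j; unfold NN; rw [card_eq_zero, filter_eq_empty_iff]
    intro i _ hi; exact hc (hi ▸ memvv i j)
  simp [NA, this] at h1; linarith

lemma nntot (t : Fin 7 → CTri) (j : Fin 3) : ∑ p ∈ VV t, NN t p j = 7 := by
  classical
  unfold NN
  have := Finset.card_eq_sum_card_fiberwise (f := fun i : Fin 7 => t i j) (s := Finset.univ) (t := VV t)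
    (fun i _ => memvv i j)
  rw [Finset.card_univ, Fintype.card_fin] at this
  exact this.symm

def PP (Z : CTri) (t : Fin 7 → CTri) (j : Fin 3) : ℕ := NN t (Z 0) j + NN t (Z 1) j + NN t (Z 2) j

lemma Til.sumspl (H : Til Z T t) {M : Type*} [AddCommMonoid M] (f : ℂ → M) :
    ∑ p ∈ VV t, f p = (f (Z 0) + f (Z 1) + f (Z 2)) + ∑ p ∈ WW Z t, f p := by
  classical
  have hsub : CC Z ⊆ VV t := by
    intro p hp; simp only [CC, mem_image] at hp
    obtain ⟨k, _, rfl⟩ := hp; exact H.cormem k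
  have h1 : ∑ p ∈ CC Z, f p = f (Z 0) + f (Z 1) + f (Z 2) := by
    unfold CC
    rw [Finset.sum_image (fun a _ b _ h => injver Z H.hZ a b h), Fin.sum_univ_three]
  rw [← h1, add_comm]
  have : WW Z t = VV t \ CC Z := by unfold WW; congr!
  rw [this]
  exact (Finset.sum_sdiff hsub).symm

lemma Til.tot (H : Til Z T t) (j : Fin 3) : PP Z t j + ∑ p ∈ WW Z t, NN t p j = 7 := by
  rw [← nntot t j, H.sumspl]; rfl

lemma Til.Peq (H : Til Z T t) : PP Z t 0 * ang T 0 + PP Z t 1 * ang T 1 + PP Z t 2 * ang T 2 = π := by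
  have h := angsum Z H.hZ
  rw [← (H.corner 0).1, ← (H.corner 1).1, ← (H.corner 2).1] at h
  unfold NA at h; unfold PP; push_cast; linarith

lemma Til.sumu (H : Til Z T t) : ∑ p ∈ WW Z t, uu Z t p = 6 := by
  have h1 : ∑ p ∈ WW Z t, NA T t p = (∑ p ∈ WW Z t, (uu Z t p : ℝ)) * π := by
    rw [sum_mul]; exact sum_congr rfl fun p hp => (H.nonc p hp).1
  have h2 : ∑ p ∈ VV t, NA T t p = 7 * π := by
    unfold NA
    rw [sum_add_distrib, sum_add_distrib, ← sum_mul, ← sum_mul,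
      ← sum_mul, ← Nat.cast_sum, ← Nat.cast_sum, ← Nat.cast_sum, nntot, nntot, nntot,
      ← H.asum]
    push_cast; ring
  rw [H.sumspl, h1] at h2
  have h := angsum Z H.hZ
  rw [← (H.corner 0).1, ← (H.corner 1).1, ← (H.corner 2).1] at h
  rw [h] at h2
  have h3 : (∑ p ∈ WW Z t, (uu Z t p : ℝ)) = 6 := by
    have : ((∑ p ∈ WW Z t, (uu Z t p : ℝ)) - 6) * π = 0 := by linarith
    rcases mul_eq_zero.1 this with h | h
    · linarith
    · exact absurd h pi_pos.ne'
  exact_mod_cast h3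
end Seven

namespace Seven
open Finset (mem_filter mem_univ sum_congr sum_mul mem_image card_filter sum_add_distrib card_union_of_disjoint card_eq_one mem_union mem_singleton mem_sdiff filter_eq_empty_iff card_eq_zero sum_nonneg mem_insert)
open MeasureTheory

lemma sumlen0 {ι : Type*} (E : Finset ι) (l r : ι → ℝ) (h : ∀ e ∈ E, l e < r e) :
    ENNReal.ofReal (∑ e ∈ E, (r e - l e))
      = ∫⁻ s, ((∑ e ∈ E, if l e < s ∧ s < r e then 1 else 0 : ℕ) : ENNReal) := by
  push_cast
  rw [lintegral_finsetSum]
  · rw [ENNReal.ofReal_sum_of_nonneg (fun e he => by linarith [h e he])]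
    apply sum_congr rfl
    intro e _
    rw [← Real.volume_Ioo, ← lintegral_indicator_one measurableSet_Ioo]
    congr 1
    ext a; simp [Set.indicator]
  · intro e _
    exact Measurable.ite measurableSet_Ioo measurable_const measurable_const

lemma sumlen {ι κ : Type*} (E : Finset ι) (E' : Finset κ) (l r : ι → ℝ) (l' r' : κ → ℝ)
    (h : ∀ e ∈ E, l e < r e) (h' : ∀ e ∈ E', l' e < r' e) (B : Finset ℝ)
    (hB : ∀ s, s ∉ B → (∑ e ∈ E, if l e < s ∧ s < r e then 1 else 0 : ℕ)
      = ∑ e ∈ E', if l' e < s ∧ s < r' e then 1 else 0) :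
    ∑ e ∈ E, (r e - l e) = ∑ e ∈ E', (r' e - l' e) := by
  have h1 := sumlen0 E l r h
  have h2 := sumlen0 E' l' r' h'
  have h3 : ENNReal.ofReal (∑ e ∈ E, (r e - l e)) = ENNReal.ofReal (∑ e ∈ E', (r' e - l' e)) := by
    rw [h1, h2]
    apply lintegral_congr_ae
    have : ∀ᵐ s : ℝ, s ∉ B := by
      rw [ae_iff]; simp only [not_not]
      exact B.finite_toSet.measure_zero volume
    filter_upwards [this] with s hs
    rw [hB s hs]
  rwa [ENNReal.ofReal_eq_ofReal_iff] at h3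
  · exact sum_nonneg fun e he => by linarith [h e he]
  · exact sum_nonneg fun e he => by linarith [h' e he]

structure IPart {ι : Type*} (E : Finset ι) (l r : ι → ℝ) : Prop where
  l0 : ∀ e ∈ E, 0 ≤ l e
  lr : ∀ e ∈ E, l e < r e
  r1 : ∀ e ∈ E, r e ≤ 1
  tot : ∑ e ∈ E, (r e - l e) = 1
  right : ∀ x, 0 ≤ x → x < 1 → ∃ e ∈ E, l e ≤ x ∧ x < r e
  left : ∀ x, 0 < x → x ≤ 1 → ∃ e ∈ E, l e < x ∧ x ≤ r e
  dj : ∀ e ∈ E, ∀ f ∈ E, e ≠ f → r e ≤ l f ∨ r f ≤ l e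

lemma IPart.mk' {ι : Type*} (E : Finset ι) (l r : ι → ℝ)
    (l0 : ∀ e ∈ E, 0 ≤ l e) (lr : ∀ e ∈ E, l e < r e) (r1 : ∀ e ∈ E, r e ≤ 1) (B : Finset ℝ)
    (h1 : ∀ s, 0 < s → s < 1 → s ∉ B → ∃ e ∈ E, l e < s ∧ s < r e)
    (h2 : ∀ s, 0 < s → s < 1 → s ∉ B → ∀ e ∈ E, ∀ f ∈ E, l e < s → s < r e → l f < s → s < r f → e = f) :
    IPart E l r := by
  have dj : ∀ e ∈ E, ∀ f ∈ E, e ≠ f → r e ≤ l f ∨ r f ≤ l e := by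
    intro e he f hf hef
    by_contra hc; push Not at hc
    have hlt : max (l e) (l f) < min (r e) (r f) := by
      simp only [max_lt_iff, lt_min_iff]; exact ⟨⟨lr e he, hc.1⟩, ⟨hc.2, lr f hf⟩⟩
    obtain ⟨s, hs, hsB⟩ := (Set.Ioo_infinite hlt).exists_notMem_finset B
    have a1 := le_max_left (l e) (l f)
    have a2 := le_max_right (l e) (l f)
    have a3 := min_le_left (r e) (r f)
    have a4 := min_le_right (r e) (r f)
    exact hef (h2 s (by linarith [l0 e he, hs.1]) (by linarith [r1 e he, hs.2]) hsB e he f hf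
      (by linarith [hs.1]) (by linarith [hs.2]) (by linarith [hs.1]) (by linarith [hs.2]))
  refine ⟨l0, lr, r1, ?_, ?_, ?_, dj⟩
  · have := sumlen E ({0} : Finset ℕ) l r (fun _ => 0) (fun _ => 1) lr (by simp)
      (B ∪ {0, 1}) ?_
    · simpa using this
    · intro s hs
      simp only [mem_union, mem_insert, mem_singleton, not_or] at hs
      rw [Finset.sum_singleton]
      by_cases h : 0 < s ∧ s < 1
      · rw [if_pos h]
        obtain ⟨e, he, h3⟩ := h1 s h.1 h.2 hs.1
        rw [Finset.sum_eq_single_of_mem e he, if_pos h3]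
        intro f hf hfe
        rw [if_neg]
        intro h4
        exact hfe (h2 s h.1 h.2 hs.1 f hf e he h4.1 h4.2 h3.1 h3.2)
      · rw [if_neg h]
        apply Finset.sum_eq_zero
        intro e he
        rw [if_neg]
        rintro ⟨h3, h4⟩
        exact h ⟨by linarith [l0 e he], by linarith [r1 e he]⟩
  · intro x hx0 hx1
    have ev : ∀ᶠ s in nhdsWithin x (Set.Ioi x), ∀ e ∈ E, (l e < s ∧ s < r e) → (l e ≤ x ∧ x < r e) := by
      rw [Filter.eventually_all_finset]
      intro e he
      by_cases hl : x < l e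
      · filter_upwards [Ioo_mem_nhdsGT hl] with s hs hh
        linarith [hs.2, hh.1]
      · filter_upwards [self_mem_nhdsWithin] with s hs hh
        have hs' : x < s := hs
        exact ⟨not_lt.1 hl, by linarith [hh.2]⟩
    have ev2 : ∀ᶠ s in nhdsWithin x (Set.Ioi x), s ∉ B := by
      have : (↑(B.erase x) : Set ℝ)ᶜ ∈ nhds x :=
        (B.erase x).finite_toSet.isClosed.isOpen_compl.mem_nhds (by simp)
      filter_upwards [mem_nhdsWithin_of_mem_nhds this, self_mem_nhdsWithin] with s hs hs2 hsB
      have hs' : x < s := hs2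
      exact hs (by simp [hsB, hs'.ne'])
    obtain ⟨s, hs1, hs2, hs3⟩ := (ev.and (ev2.and (Ioo_mem_nhdsGT hx1))).exists
    obtain ⟨e, he, h3⟩ := h1 s (by linarith [hs3.1]) hs3.2 hs2
    exact ⟨e, he, hs1 e he h3⟩
  · intro x hx0 hx1
    have ev : ∀ᶠ s in nhdsWithin x (Set.Iio x), ∀ e ∈ E, (l e < s ∧ s < r e) → (l e < x ∧ x ≤ r e) := by
      rw [Filter.eventually_all_finset]
      intro e he
      by_cases hl : r e < x
      · filter_upwards [Ioo_mem_nhdsLT hl] with s hs hh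
        linarith [hs.1, hh.2]
      · filter_upwards [self_mem_nhdsWithin] with s hs hh
        have hs' : s < x := hs
        exact ⟨by linarith [hh.1], not_lt.1 hl⟩
    have ev2 : ∀ᶠ s in nhdsWithin x (Set.Iio x), s ∉ B := by
      have : (↑(B.erase x) : Set ℝ)ᶜ ∈ nhds x :=
        (B.erase x).finite_toSet.isClosed.isOpen_compl.mem_nhds (by simp)
      filter_upwards [mem_nhdsWithin_of_mem_nhds this, self_mem_nhdsWithin] with s hs hs2 hsB
      have hs' : s < x := hs2
      exact hs (by simp [hsB, hs'.ne])
    obtain ⟨s, hs1, hs2, hs3⟩ := (ev.and (ev2.and (Ioo_mem_nhdsLT hx0))).exists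
    obtain ⟨e, he, h3⟩ := h1 s hs3.1 (by linarith [hs3.2]) hs2
    exact ⟨e, he, hs1 e he h3⟩

lemma IPart.card {ι : Type*} {E : Finset ι} {l r : ι → ℝ} (h : IPart E l r) :
    (E.filter fun e => r e < 1).card + 1 = E.card := by
  classical
  obtain ⟨e, he, h1, h2⟩ := h.left 1 (by norm_num) le_rfl
  have hr : r e = 1 := le_antisymm (h.r1 e he) h2
  have : E.filter (fun e => r e < 1) = E.erase e := by
    ext f; simp only [mem_filter, Finset.mem_erase]
    constructor
    · rintro ⟨a, b⟩; exact ⟨by rintro rfl; linarith, a⟩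
    · rintro ⟨a, b⟩
      refine ⟨b, lt_of_le_of_ne (h.r1 f b) fun hf => ?_⟩
      rcases h.dj f b e he a with h3 | h3
      · linarith
      · linarith [h.lr f b]
  rw [this, Finset.card_erase_of_mem he]
  have := Finset.card_pos.2 ⟨e, he⟩
  omega

lemma IPart.rinj {ι : Type*} {E : Finset ι} {l r : ι → ℝ} (h : IPart E l r) :
    ∀ e ∈ E, ∀ f ∈ E, r e = r f → e = f := by
  intro e he f hf hr
  by_contra hc
  have := h.lr e he
  have := h.lr f hf
  rcases h.dj e he f hf hc with h3 | h3 <;> linarith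

lemma IPart.ends {ι : Type*} {E : Finset ι} {l r : ι → ℝ} (h : IPart E l r)
    (e : ι) (he : e ∈ E) (h0 : l e = 0) (h1 : r e = 1) : E.card = 1 := by
  rw [card_eq_one]
  refine ⟨e, Finset.eq_singleton_iff_unique_mem.2 ⟨he, fun f hf => ?_⟩⟩
  by_contra hc
  have := h.lr f hf
  have := h.r1 f hf
  have := h.l0 f hf
  rcases h.dj f hf e he hc with h3 | h3 <;> linarith

lemma fradis (F : CTri) (h : DD F ≠ 0) (K : Fin 3) (p q : ℂ) (hpq : lam F K p = lam F K q) :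
    dist p q = |lam F (K+2) p - lam F (K+2) q| * L F K := by
  have e1 := lamsum' F h K p
  have e2 := lamsum' F h K q
  have hp : p - q = ((lam F (K+2) p - lam F (K+2) q : ℝ) : ℂ) * (F (K+2) - F (K+1)) := by
    have h1 : lam F (K+1) p - lam F (K+1) q = -(lam F (K+2) p - lam F (K+2) q) := by linarith
    have h3 : p - q = ((lam F K p - lam F K q : ℝ) : ℂ) * F K +
      ((lam F (K+1) p - lam F (K+1) q : ℝ) : ℂ) * F (K+1) +
      ((lam F (K+2) p - lam F (K+2) q : ℝ) : ℂ) * F (K+2) := by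
      conv_lhs => rw [lamrep F h p, lamrep F h q]
      push_cast
      fin_cases K <;> simp <;> ring
    rw [h3, h1, sub_eq_zero.2 hpq]; push_cast; ring
  rw [dist_eq_norm, hp, norm_mul, Complex.norm_real, Real.norm_eq_abs, ← dist_eq_norm, dist_comm]
  rfl

lemma fraext (F : CTri) (h : DD F ≠ 0) (K : Fin 3) (p q : ℂ) (hpq : lam F K p = lam F K q)
    (hs : lam F (K+2) p = lam F (K+2) q) : p = q := by
  have := fradis F h K p q hpq
  rw [hs, sub_self, abs_zero, zero_mul] at this
  exact dist_eq_zero.1 this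

lemma onecom (t : CTri) (h : DD t ≠ 0) (k : Fin 3) (q : ℂ) (hq : onE t k q) :
    q = (lam t (k+1) q : ℂ) * t (k+1) + (lam t (k+2) q : ℂ) * t (k+2) := by
  have h1 := lamrep t h q
  have h2 := hq.1
  fin_cases k <;> simp at * <;> rw [h2] at h1 <;> simp at h1
  · exact h1
  · rw [add_comm]; exact h1
  · exact h1

lemma comone (t : CTri) (h : DD t ≠ 0) (k : Fin 3) (x y : ℝ) (hx : 0 < x) (hy : 0 < y)
    (hxy : x + y = 1) : onE t k ((x : ℂ) * t (k+1) + (y : ℂ) * t (k+2)) := by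
  refine ⟨?_, ?_, ?_⟩
  · rw [lamcom _ _ _ _ _ _ hxy, lamo1, lamo2]; ring
  · rw [lamcom _ _ _ _ _ _ hxy, lamsel t h, lamne t (k+1) (k+2) (by clear * -; decide +revert)]; simpa
  · rw [lamcom _ _ _ _ _ _ hxy, lamsel t h, lamne t (k+2) (k+1) (by clear * -; decide +revert)]; simpa

def lo (F : CTri) (K : Fin 3) (t : CTri) (k : Fin 3) : ℝ :=
  min (lam F (K+2) (t (k+1))) (lam F (K+2) (t (k+2)))
def hi (F : CTri) (K : Fin 3) (t : CTri) (k : Fin 3) : ℝ :=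
  max (lam F (K+2) (t (k+1))) (lam F (K+2) (t (k+2)))

lemma hisublo (F : CTri) (h : DD F ≠ 0) (K : Fin 3) (t : CTri) (k : Fin 3)
    (h1 : lam F K (t (k+1)) = 0) (h2 : lam F K (t (k+2)) = 0) :
    (hi F K t k - lo F K t k) * L F K = L t k := by
  have := fradis F h K (t (k+1)) (t (k+2)) (h1.trans h2.symm)
  unfold hi lo; rw [max_sub_min_eq_abs, abs_sub_comm]; exact this.symm

lemma lolthi (F : CTri) (h : DD F ≠ 0) (K : Fin 3) (t : CTri) (ht : DD t ≠ 0) (k : Fin 3)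
    (h1 : lam F K (t (k+1)) = 0) (h2 : lam F K (t (k+2)) = 0) : lo F K t k < hi F K t k := by
  have := hisublo F h K t k h1 h2
  have a := lpos t ht k
  have b := lpos F h K
  rw [← this] at a
  have := (pos_iff_pos_of_mul_pos a).2 b
  linarith

lemma onefra (F : CTri) (h : DD F ≠ 0) (K : Fin 3) (t : CTri) (ht : DD t ≠ 0) (k : Fin 3)
    (h1 : lam F K (t (k+1)) = 0) (h2 : lam F K (t (k+2)) = 0) (q : ℂ) (hq : lam F K q = 0) :
    onE t k q ↔ lo F K t k < lam F (K+2) q ∧ lam F (K+2) q < hi F K t k := by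
  have hlh := lolthi F h K t ht k h1 h2
  unfold lo hi at *
  set s1 := lam F (K+2) (t (k+1))
  set s2 := lam F (K+2) (t (k+2))
  constructor
  · intro ho
    have hs := lamsum' t ht k q
    rw [ho.1] at hs
    have hc := onecom t ht k q ho
    have hl : lam F (K+2) q = lam t (k+1) q * s1 + lam t (k+2) q * s2 := by
      conv_lhs => rw [hc]
      rw [lamcom _ _ _ _ _ _ (by linarith)]
    have a := ho.2.1
    have b := ho.2.2
    rw [hl]
    have hx : lam t (k+1) q = 1 - lam t (k+2) q := by linarith
    rw [hx] at a ⊢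
    rcases le_total s1 s2 with h3 | h3
    · rw [min_eq_left h3, max_eq_right h3] at *
      constructor <;> nlinarith
    · rw [min_eq_right h3, max_eq_left h3] at *
      constructor <;> nlinarith
  · rintro ⟨a, b⟩
    have hne : s2 - s1 ≠ 0 := by
      intro h3; have : s2 = s1 := by linarith
      rw [this] at hlh; simp at hlh
    set x := (lam F (K+2) q - s1) / (s2 - s1) with hx
    have hx1 : x * (s2 - s1) = lam F (K+2) q - s1 := div_mul_cancel₀ _ hne
    have hq2 : q = ((1 - x : ℝ) : ℂ) * t (k+1) + (x : ℂ) * t (k+2) := by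
      apply fraext F h K
      · rw [hq, lamcom _ _ _ _ _ _ (by ring), h1, h2]; ring
      · rw [lamcom _ _ _ _ _ _ (by ring)]; change _ = (1 - x) * s1 + x * s2; linarith
    have : 0 < x ∧ x < 1 := by
      rcases le_total s1 s2 with h3 | h3
      · rw [min_eq_left h3, max_eq_right h3] at *
        constructor
        · rw [hx]; apply div_pos <;> linarith
        · rw [hx, div_lt_one] <;> linarith
      · rw [min_eq_right h3, max_eq_left h3] at *
        constructor
        · rw [hx]; apply div_pos_of_neg_of_neg <;> linarith
        · rw [hx, div_lt_one_of_neg] <;> linarith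
    rw [hq2]
    exact comone t ht k _ _ (by linarith) this.1 (by ring)
end Seven

namespace Seven
open Finset (mem_filter mem_univ sum_congr sum_mul mem_image card_filter sum_add_distrib card_union_of_disjoint card_eq_one mem_union mem_singleton mem_sdiff filter_eq_empty_iff card_eq_zero sum_nonneg mem_insert)
variable {Z T : CTri} {t : Fin 7 → CTri}

open Classical in
def SE (Z : CTri) (t : Fin 7 → CTri) (K : Fin 3) : Finset (Fin 7 × Fin 3) :=
  Finset.univ.filter fun x => lam Z K (t x.1 (x.2+1)) = 0 ∧ lam Z K (t x.1 (x.2+2)) = 0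
def mm (Z : CTri) (t : Fin 7 → CTri) (K k : Fin 3) : ℕ := ((SE Z t K).filter fun x => x.2 = k).card
def slo (Z : CTri) (t : Fin 7 → CTri) (K : Fin 3) (x : Fin 7 × Fin 3) : ℝ := lo Z K (t x.1) x.2
def shi (Z : CTri) (t : Fin 7 → CTri) (K : Fin 3) (x : Fin 7 × Fin 3) : ℝ := hi Z K (t x.1) x.2

lemma memse {K : Fin 3} {x : Fin 7 × Fin 3} :
    x ∈ SE Z t K ↔ lam Z K (t x.1 (x.2+1)) = 0 ∧ lam Z K (t x.1 (x.2+2)) = 0 := by simp [SE]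

lemma notV (H : Til Z T t) (p : ℂ) (hp : p ∉ VV t) : EE t p * π + II t p * (2 * π) = th Z p := by
  have h := H.F1' p
  have : ∀ j, NN t p j = 0 := by
    intro j; unfold NN; rw [card_eq_zero, filter_eq_empty_iff]
    intro i _ hi; exact hp (hi ▸ memvv i j)
  simpa [this] using h

lemma caronepi (e i : ℕ) (h : (e : ℝ) * π + i * (2 * π) = π) : e = 1 := by
  have : ((e : ℝ) + 2 * i - 1) * π = 0 := by linarith
  rcases mul_eq_zero.1 this with h | h
  · have : (e : ℝ) + 2 * i = 1 := by linarith
    have : e + 2 * i = 1 := by exact_mod_cast this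
    omega
  · exact absurd h pi_pos.ne'

lemma Til.sidpar (H : Til Z T t) (K : Fin 3) : IPart (SE Z t K) (slo Z t K) (shi Z t K) := by
  classical
  have hpt : ∀ s, 0 < s → s < 1 → ∃ q, onE Z K q ∧ lam Z (K+2) q = s := by
    intro s h0 h1
    refine ⟨((1 - s : ℝ) : ℂ) * Z (K+1) + (s : ℂ) * Z (K+2), comone Z H.hZ K _ _ (by linarith) h0 (by ring), ?_⟩
    rw [lamcom _ _ _ _ _ _ (by ring), lamsel Z H.hZ, lamne Z (K+2) (K+1) (by clear * -; decide +revert)]; ring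
  have hone : ∀ q, onE Z K q → lam Z (K+2) q ∉ (VV t).image (lam Z (K+2)) → EE t q = 1 := by
    intro q hq hB
    have hV : q ∉ VV t := fun h => hB (Finset.mem_image_of_mem _ h)
    have := notV H q hV
    rw [thedg Z H.hZ K q hq] at this
    exact caronepi _ _ this
  refine IPart.mk' _ _ _ ?_ ?_ ?_ ((VV t).image (lam Z (K+2))) ?_ ?_
  · intro x _; exact le_min (H.lamZ _ _ _) (H.lamZ _ _ _)
  · intro x hx; rw [memse] at hx; exact lolthi Z H.hZ K _ (H.hD _) _ hx.1 hx.2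
  · intro x _
    have : ∀ p, (∀ k, 0 ≤ lam Z k p) → lam Z (K+2) p ≤ 1 := by
      intro p hp
      have := lamsum' Z H.hZ K p
      linarith [hp K, hp (K+1)]
    exact max_le (this _ (H.lamZ _ _)) (this _ (H.lamZ _ _))
  · intro s h0 h1 hB
    obtain ⟨q, hq, rfl⟩ := hpt s h0 h1
    have := hone q hq hB
    obtain ⟨x, hx⟩ := card_eq_one.1 this
    have hxo : onE (t x.1) x.2 q := by
      have : x ∈ Finset.univ.filter fun x : Fin 7 × Fin 3 => onE (t x.1) x.2 q := by rw [hx]; simp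
      simpa using this
    have hS : lam Z K (t x.1 (x.2+1)) = 0 ∧ lam Z K (t x.1 (x.2+2)) = 0 := by
      have hc := onecom _ (H.hD x.1) _ q hxo
      have hs := lamsum' _ (H.hD x.1) x.2 q
      have hq0 := hq.1
      rw [hxo.1] at hs
      rw [hc, lamcom _ _ _ _ _ _ (by linarith)] at hq0
      have a1 := H.lamZ x.1 (x.2+1) K
      have a2 := H.lamZ x.1 (x.2+2) K
      have b1 := hxo.2.1
      have b2 := hxo.2.2
      have c1 := mul_nonneg b1.le a1
      have c2 := mul_nonneg b2.le a2
      constructor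
      · have : lam (t x.1) (x.2+1) q * lam Z K (t x.1 (x.2+1)) = 0 := by linarith
        exact (mul_eq_zero.1 this).resolve_left b1.ne'
      · have : lam (t x.1) (x.2+2) q * lam Z K (t x.1 (x.2+2)) = 0 := by linarith
        exact (mul_eq_zero.1 this).resolve_left b2.ne'
    exact ⟨x, memse.2 hS, (onefra Z H.hZ K _ (H.hD x.1) x.2 hS.1 hS.2 q hq.1).1 hxo⟩
  · intro s h0 h1 hB e he f hf a1 a2 a3 a4
    obtain ⟨q, hq, rfl⟩ := hpt s h0 h1
    rw [memse] at he hf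
    have o1 := (onefra Z H.hZ K _ (H.hD e.1) e.2 he.1 he.2 q hq.1).2 ⟨a1, a2⟩
    have o2 := (onefra Z H.hZ K _ (H.hD f.1) f.2 hf.1 hf.2 q hq.1).2 ⟨a3, a4⟩
    have := hone q hq hB
    exact Finset.card_le_one.1 this.le e (by simpa using o1) f (by simpa using o2)

lemma Til.L_eq (H : Til Z T t) (i : Fin 7) (k : Fin 3) : L (t i) k = L T k := H.cong _ _ _

lemma carse (K : Fin 3) : (SE Z t K).card = mm Z t K 0 + mm Z t K 1 + mm Z t K 2 := by
  have := Finset.card_eq_sum_card_fiberwise (f := fun x : Fin 7 × Fin 3 => x.2) (s := SE Z t K) (t := Finset.univ)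
    (fun i _ => mem_univ _)
  rw [this, Fin.sum_univ_three]; rfl

lemma Til.sidlen (H : Til Z T t) (K : Fin 3) :
    L Z K = mm Z t K 0 * L T 0 + mm Z t K 1 * L T 1 + mm Z t K 2 * L T 2 := by
  have h := (H.sidpar K).tot
  have h2 : L Z K = ∑ x ∈ SE Z t K, L T x.2 := by
    have : L Z K = (∑ e ∈ SE Z t K, (shi Z t K e - slo Z t K e)) * L Z K := by rw [h, one_mul]
    rw [this, sum_mul]
    apply sum_congr rfl
    intro x hx
    rw [memse] at hx
    rw [← H.L_eq x.1]
    exact hisublo Z H.hZ K _ _ hx.1 hx.2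
  rw [h2, ← Finset.sum_fiberwise_of_maps_to (g := fun x : Fin 7 × Fin 3 => x.2) (t := Finset.univ) (fun i _ => mem_univ _),
    Fin.sum_univ_three]
  have : ∀ k, ∑ i ∈ SE Z t K with i.2 = k, L T i.2 = mm Z t K k * L T k := by
    intro k
    rw [sum_congr rfl (g := fun _ => L T k), Finset.sum_const, nsmul_eq_mul]; rfl
    intro x hx; rw [(mem_filter.1 hx).2]
  rw [this, this, this]

lemma mmpos {K : Fin 3} {x : Fin 7 × Fin 3} (hx : x ∈ SE Z t K) : 1 ≤ mm Z t K x.2 :=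
  Finset.card_pos.2 ⟨x, by simp [hx]⟩

lemma Til.start (H : Til Z T t) (K : Fin 3) : ∃ x ∈ SE Z t K, slo Z t K x = 0 ∧
    ∃ j, j ≠ x.2 ∧ t x.1 j = Z (K+1) := by
  obtain ⟨x, hx, h1, h2⟩ := (H.sidpar K).right 0 le_rfl (by norm_num)
  have h0 : slo Z t K x = 0 := le_antisymm h1 ((H.sidpar K).l0 x hx)
  refine ⟨x, hx, h0, ?_⟩
  rw [memse] at hx
  have e1 := lamo1 Z K
  have e2 : lam Z (K+2) (Z (K+1)) = 0 := lamne _ _ _ (by clear * -; decide +revert)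
  rcases min_choice (lam Z (K+2) (t x.1 (x.2+1))) (lam Z (K+2) (t x.1 (x.2+2))) with h | h
  · exact ⟨x.2+1, by have := x.2; clear * -; generalize x.2 = y; decide +revert, fraext Z H.hZ K _ _ (hx.1.trans e1.symm)
      (by rw [e2, ← h]; exact h0)⟩
  · exact ⟨x.2+2, by clear * -; generalize x.2 = y; decide +revert, fraext Z H.hZ K _ _ (hx.2.trans e1.symm)
      (by rw [e2, ← h]; exact h0)⟩

lemma Til.finish (H : Til Z T t) (K : Fin 3) : ∃ x ∈ SE Z t K, shi Z t K x = 1 ∧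
    ∃ j, j ≠ x.2 ∧ t x.1 j = Z (K+2) := by
  obtain ⟨x, hx, h1, h2⟩ := (H.sidpar K).left 1 (by norm_num) le_rfl
  have h0 : shi Z t K x = 1 := le_antisymm ((H.sidpar K).r1 x hx) h2
  refine ⟨x, hx, h0, ?_⟩
  rw [memse] at hx
  have e1 := lamo2 Z K
  have e2 : lam Z (K+2) (Z (K+2)) = 1 := lamsel _ H.hZ _
  rcases max_choice (lam Z (K+2) (t x.1 (x.2+1))) (lam Z (K+2) (t x.1 (x.2+2))) with h | h
  · exact ⟨x.2+1, by clear * -; generalize x.2 = y; decide +revert, fraext Z H.hZ K _ _ (hx.1.trans e1.symm)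
      (by rw [e2, ← h]; exact h0)⟩
  · exact ⟨x.2+2, by clear * -; generalize x.2 = y; decide +revert, fraext Z H.hZ K _ _ (hx.2.trans e1.symm)
      (by rw [e2, ← h]; exact h0)⟩

def Single (Z : CTri) (t : Fin 7 → CTri) (M j : Fin 3) : Prop :=
  NN t (Z M) j = 1 ∧ ∀ j', j' ≠ j → NN t (Z M) j' = 0

lemma sineq {M j : Fin 3} (h : Single Z t M j) {i i' : Fin 7} {k k' : Fin 3} (h1 : t i k = Z M)
    (h2 : t i' k' = Z M) : i = i' ∧ k = j ∧ k' = j := by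
  classical
  have aux : ∀ i k, t i k = Z M → k = j := by
    intro i k hk; by_contra hc
    have h3 := h.2 k hc
    have := nnposof (t := t) i k
    rw [hk] at this; omega
  have a := aux i k h1
  have b := aux i' k' h2
  refine ⟨?_, a, b⟩
  subst a; subst b
  have := h.1
  unfold NN at this
  exact Finset.card_le_one.1 this.le i (by simp [h1]) i' (by simp [h2])

lemma notwosid (H : Til Z T t) (K K' : Fin 3) (hK : K ≠ K') (x : Fin 7 × Fin 3)
    (h : x ∈ SE Z t K) (h' : x ∈ SE Z t K') : False := by
  rw [memse] at h h'
  have : ∀ p, lam Z K p = 0 → lam Z K' p = 0 → ∃ M, Z M = p ∧ M ≠ K ∧ M ≠ K' := by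
    intro p h1 h2
    have : (K' = K + 1 ∧ True) ∨ K' = K + 2 := by clear * - hK; decide +revert
    rcases this with ⟨rfl, _⟩ | rfl
    · refine ⟨K+2, eqver Z H.hZ _ p ?_ ?_, ?_⟩
      · rw [show K + 2 + 1 = K by clear * -; decide +revert]; exact h1
      · rw [show K + 2 + 2 = K + 1 by clear * -; decide +revert]; exact h2
      · clear * -; decide +revert
    · refine ⟨K+1, eqver Z H.hZ _ p ?_ ?_, ?_⟩
      · rw [show K + 1 + 1 = K + 2 by clear * -; decide +revert]; exact h2
      · rw [show K + 1 + 2 = K by clear * -; decide +revert]; exact h1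
      · clear * -; decide +revert
  obtain ⟨M, hM, hM1⟩ := this _ h.1 h'.1
  obtain ⟨M', hM', hM1'⟩ := this _ h.2 h'.2
  have hMM : M = M' := by clear * - hM1 hM1' hK; decide +revert
  subst hMM
  have := injver _ (H.hD x.1) _ _ (hM.symm.trans hM')
  clear * - this; generalize x.2 = y at *; revert this; decide +revert

lemma Til.ends (H : Til Z T t) : ∃ f g : Fin 3 → Fin 3,
    (∀ K, 1 ≤ mm Z t K (f K) ∧ 1 ≤ mm Z t K (g K)) ∧
    (∀ K, 2 ≤ (SE Z t K).card → f K = g K → 2 ≤ mm Z t K (f K)) ∧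
    (∀ M j, Single Z t M j → g (M+1) ≠ j ∧ f (M+2) ≠ j ∧ g (M+1) ≠ f (M+2)) := by
  choose X hX hX0 J hJ hJX using H.start
  choose Y hY hY0 J' hJ' hJY using H.finish
  refine ⟨fun K => (X K).2, fun K => (Y K).2, fun K => ⟨mmpos (hX K), mmpos (hY K)⟩, ?_, ?_⟩
  · intro K h2 hfg
    have hne : X K ≠ Y K := by
      intro he
      have := (H.sidpar K).ends (X K) (hX K) (hX0 K) (by rw [he]; exact hY0 K)
      omega
    unfold mm
    have : ({X K, Y K} : Finset (Fin 7 × Fin 3)) ⊆ (SE Z t K).filter fun x => x.2 = (X K).2 := by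
      intro z hz; simp only [mem_insert, mem_singleton] at hz
      rcases hz with rfl | rfl
      · simp [hX]
      · simp [hY, hfg]
    have := Finset.card_le_card this
    rwa [Finset.card_pair hne] at this
  · intro M j hs
    have e1 : t (Y (M+1)).1 (J' (M+1)) = Z M := by
      rw [hJY]; congr 1; clear * -; decide +revert
    have e2 : t (X (M+2)).1 (J (M+2)) = Z M := by
      rw [hJX]; congr 1; clear * -; decide +revert
    obtain ⟨h1, h2, h3⟩ := sineq hs e1 e2
    refine ⟨?_, ?_, ?_⟩
    · rw [← h2]; exact (hJ' _).symm
    · rw [← h3]; exact (hJ _).symm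
    · intro h4
      have : Y (M+1) = X (M+2) := Prod.ext h1 h4
      exact notwosid H (M+1) (M+2) (by clear * -; decide +revert) _ (hY _) (this ▸ hX _)

lemma onenotcor (H : Til Z T t) {K M : Fin 3} {p : ℂ} (h : onE Z K p) : Z M ≠ p := by
  rintro rfl
  have a := thedg Z H.hZ K _ h
  rw [thver Z H.hZ] at a
  exact (anglt Z H.hZ M).ne a

lemma memww (i : Fin 7) (k : Fin 3) (h : ∀ M, Z M ≠ t i k) : t i k ∈ WW Z t := by
  simp only [WW, mem_sdiff, CC, mem_image, not_exists]
  exact ⟨memvv i k, fun M hM => h M hM.2⟩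

lemma sidone (H : Til Z T t) {K : Fin 3} (p : ℂ) (h0 : lam Z K p = 0) (h1 : 0 < lam Z (K+2) p)
    (h2 : lam Z (K+2) p < 1) : onE Z K p :=
  ⟨h0, by have := lamsum' Z H.hZ K p; linarith, h1⟩

open Classical in
lemma Til.sidcou (H : Til Z T t) (K : Fin 3) :
    (SE Z t K).card ≤ ((WW Z t).filter fun p => onE Z K p).card + 1 := by
  have hp := H.sidpar K
  rw [← hp.card]
  apply Nat.add_le_add_right
  have hmap : ∀ x ∈ (SE Z t K).filter (fun e => shi Z t K e < 1),
      shi Z t K x ∈ ((WW Z t).filter fun p => onE Z K p).image (lam Z (K+2)) := by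
    intro x hx
    rw [mem_filter] at hx
    have h0 : 0 < shi Z t K x := lt_of_le_of_lt (hp.l0 x hx.1) (hp.lr x hx.1)
    have hS := memse.1 hx.1
    rw [mem_image]
    have : ∃ j, lam Z K (t x.1 j) = 0 ∧ shi Z t K x = lam Z (K+2) (t x.1 j) := by
      rcases max_choice (lam Z (K+2) (t x.1 (x.2+1))) (lam Z (K+2) (t x.1 (x.2+2))) with h | h
      · exact ⟨x.2+1, hS.1, h⟩
      · exact ⟨x.2+2, hS.2, h⟩
    obtain ⟨j, hj, hj2⟩ := this
    have ho := sidone H (t x.1 j) hj (hj2 ▸ h0) (hj2 ▸ hx.2)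
    exact ⟨t x.1 j, mem_filter.2 ⟨memww _ _ (fun M => onenotcor H ho), ho⟩, hj2.symm⟩
  refine le_trans (Finset.card_le_card_of_injOn (shi Z t K) hmap ?_) Finset.card_image_le
  intro a ha b hb hab
  simp only [Finset.coe_filter, Set.mem_ofPred_eq] at ha hb
  exact hp.rinj a ha.1 b hb.1 hab

open Classical in
lemma Til.edgcou (H : Til Z T t) :
    (SE Z t 0).card + (SE Z t 1).card + (SE Z t 2).card
      ≤ ((WW Z t).filter fun p => ¬ inT Z p).card + 3 := by
  have h0 := H.sidcou 0
  have h1 := H.sidcou 1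
  have h2 := H.sidcou 2
  have hd : ∀ K K' : Fin 3, K ≠ K' → Disjoint ((WW Z t).filter fun p => onE Z K p) ((WW Z t).filter fun p => onE Z K' p) := by
    intro K K' hK
    rw [Finset.disjoint_left]
    intro p h1 h2
    have a := (mem_filter.1 h1).2
    have b := (mem_filter.1 h2).2
    have : K' = K + 1 ∨ K' = K + 2 := by clear * - hK; decide +revert
    rcases this with rfl | rfl
    · have := a.2.1; rw [b.1] at this; exact lt_irrefl _ this
    · have := a.2.2; rw [b.1] at this; exact lt_irrefl _ this
  have hu : ((WW Z t).filter fun p => onE Z 0 p) ∪ ((WW Z t).filter fun p => onE Z 1 p) ∪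
      ((WW Z t).filter fun p => onE Z 2 p) ⊆ (WW Z t).filter fun p => ¬ inT Z p := by
    intro p hp
    simp only [mem_union, mem_filter] at hp ⊢
    have aux : ∀ K, onE Z K p → ¬ inT Z p := fun K hK hi => by
      have := hi K; rw [hK.1] at this; exact lt_irrefl _ this
    rcases hp with (⟨a, b⟩ | ⟨a, b⟩) | ⟨a, b⟩ <;> exact ⟨a, aux _ b⟩
  have := Finset.card_le_card hu
  rw [card_union_of_disjoint, card_union_of_disjoint (hd 0 1 (by decide))] at this
  · omega
  · rw [Finset.disjoint_union_left]; exact ⟨hd _ _ (by decide), hd _ _ (by decide)⟩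

lemma Til.cside (H : Til Z T t) (hR : PP Z t 2 = 0)
    (hg : ∀ p ∈ WW Z t, uu Z t p = 1 → NN t p 2 ≤ 1) (K : Fin 3) : 1 ≤ mm Z t K 2 := by
  classical
  by_contra hc
  have hp := H.sidpar K
  have h2 : ∀ x ∈ SE Z t K, x.2 ≠ 2 := by
    intro x hx hx2; have := mmpos hx; rw [hx2] at this; exact hc this
  have hcorner : ∀ M i, Z M ≠ t i 2 := by
    intro M i h
    have h1 := nnposof (t := t) i 2
    rw [← h] at h1
    have : NN t (Z M) 2 = 0 := by unfold PP at hR; fin_cases M <;> simp <;> omega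
    omega
  have hv : ∀ x ∈ SE Z t K, lam Z K (t x.1 2) = 0 ∧
      (lam Z (K+2) (t x.1 2) = slo Z t K x ∨ lam Z (K+2) (t x.1 2) = shi Z t K x) := by
    intro x hx
    have hS := memse.1 hx
    have h3 := h2 x hx
    have : 2 = x.2 + 1 ∨ 2 = x.2 + 2 := by
      clear * - h3; generalize x.2 = y at *; decide +revert
    unfold slo shi lo hi
    rcases this with h | h
    · rw [← h] at hS ⊢
      refine ⟨hS.1, ?_⟩
      rcases le_total (lam Z (K+2) (t x.1 2)) (lam Z (K+2) (t x.1 (x.2+2))) with h5 | h5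
      · left; rw [min_eq_left h5]
      · right; rw [max_eq_left h5]
    · rw [← h] at hS ⊢
      refine ⟨hS.2, ?_⟩
      rcases le_total (lam Z (K+2) (t x.1 (x.2+1))) (lam Z (K+2) (t x.1 2)) with h5 | h5
      · right; rw [max_eq_right h5]
      · left; rw [min_eq_right h5]
  have h01 : ∀ x ∈ SE Z t K, 0 < lam Z (K+2) (t x.1 2) ∧ lam Z (K+2) (t x.1 2) < 1 := by
    intro x hx
    have h0 := (hv x hx).1
    have hs := lamsum' Z H.hZ K (t x.1 2)
    constructor
    · refine lt_of_le_of_ne (H.lamZ _ _ _) fun h => ?_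
      refine hcorner (K+1) x.1 (eqver Z H.hZ _ _ ?_ ?_)
      · rw [show K + 1 + 1 = K + 2 by clear * -; decide +revert]; exact h.symm
      · rw [show K + 1 + 2 = K by clear * -; decide +revert]; exact h0
    · refine lt_of_le_of_ne (by linarith [H.lamZ x.1 2 (K+1)]) fun h => ?_
      refine hcorner (K+2) x.1 (eqver Z H.hZ _ _ ?_ ?_)
      · rw [show K + 2 + 1 = K by clear * -; decide +revert]; exact h0
      · rw [show K + 2 + 2 = K + 1 by clear * -; decide +revert]; linarith
  have hmaps : ∀ x ∈ SE Z t K, lam Z (K+2) (t x.1 2) ∈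
      ((SE Z t K).filter fun e => shi Z t K e < 1).image (shi Z t K) := by
    intro x hx
    rw [mem_image]
    rcases (hv x hx).2 with h | h
    · obtain ⟨e, he, h3, h4⟩ := hp.left _ (h01 x hx).1 (h01 x hx).2.le
      have hex : e ≠ x := by rintro rfl; linarith
      have : shi Z t K e = lam Z (K+2) (t x.1 2) := by
        rcases hp.dj e he x hx hex with h5 | h5
        · linarith
        · linarith [hp.lr x hx]
      exact ⟨e, mem_filter.2 ⟨he, this ▸ (h01 x hx).2⟩, this⟩
    · exact ⟨x, mem_filter.2 ⟨hx, h ▸ (h01 x hx).2⟩, h.symm⟩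
  have hinj : Set.InjOn (fun x : Fin 7 × Fin 3 => lam Z (K+2) (t x.1 2)) (SE Z t K) := by
    intro x hx y hy hxy
    have hpq : t x.1 2 = t y.1 2 := fraext Z H.hZ K _ _ ((hv x hx).1.trans (hv y hy).1.symm) hxy
    have ho := sidone H (t x.1 2) (hv x hx).1 (h01 x hx).1 (h01 x hx).2
    have hW := memww (Z := Z) (t := t) x.1 2 (fun M => onenotcor H (M := M) ho)
    have hu : uu Z t (t x.1 2) = 1 := by
      have : ¬ inT Z (t x.1 2) := fun hi => by have := hi K; rw [ho.1] at this; exact lt_irrefl _ this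
      simp [uu, this]
    have hle := hg _ hW hu
    unfold NN at hle
    have h1 : x.1 = y.1 := Finset.card_le_one.1 hle x.1 (by simp) y.1 (by simp [hpq])
    apply Prod.ext h1
    by_contra hne
    have hS := memse.1 hx
    have hS' := memse.1 hy
    rw [← h1] at hS'
    have hall : ∀ j, lam Z K (t x.1 j) = 0 := by
      intro j
      have : (j = x.2 + 1 ∨ j = x.2 + 2) ∨ (j = y.2 + 1 ∨ j = y.2 + 2) := by
        clear * - hne; generalize x.2 = a at *; generalize y.2 = b at *; decide +revert
      rcases this with (rfl | rfl) | (rfl | rfl)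
      · exact hS.1
      · exact hS.2
      · exact hS'.1
      · exact hS'.2
    have hr := lamrep (t x.1) (H.hD _) (Z K)
    have h1 := lamsel Z H.hZ K
    rw [hr, lamcomb _ _ _ _ _ _ _ _ (lamsum _ (H.hD _) _), hall, hall, hall] at h1
    norm_num at h1
  have h1 := Finset.card_le_card_of_injOn _ hmaps hinj
  have h3 := Finset.card_image_le (s := (SE Z t K).filter fun e => shi Z t K e < 1) (f := shi Z t K)
  have h4 := hp.card
  omega

lemma intnea (s : CTri) (k : Fin 3) (z q : ℂ) (hz : onE s k z) (hq : 0 < lam s k q) :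
    ∃ e > 0, ∀ x : ℝ, 0 < x → x < e → inT s (((1 - x : ℝ) : ℂ) * z + (x : ℂ) * q) := by
  have key : ∀ A B : ℝ, 0 < A → ∃ e > 0, ∀ x : ℝ, 0 < x → x < e → 0 < (1 - x) * A + x * B := by
    intro A B hA
    refine ⟨A / (A + |B| + 1), by positivity, fun x h0 h1 => ?_⟩
    rw [lt_div_iff₀ (by positivity)] at h1
    have := neg_abs_le B
    nlinarith [abs_nonneg B]
  obtain ⟨e1, h1, k1⟩ := key _ (lam s (k+1) q) hz.2.1
  obtain ⟨e2, h2, k2⟩ := key _ (lam s (k+2) q) hz.2.2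
  refine ⟨min e1 e2, lt_min h1 h2, fun x h0 hx m => ?_⟩
  rw [lamcom _ _ _ _ _ _ (by ring)]
  have : m = k ∨ m = k + 1 ∨ m = k + 2 := by clear * -; decide +revert
  rcases this with rfl | rfl | rfl
  · rw [hz.1]; nlinarith
  · exact k1 x h0 (lt_of_lt_of_le hx (min_le_left _ _))
  · exact k2 x h0 (lt_of_lt_of_le hx (min_le_right _ _))

lemma Til.sep (H : Til Z T t) {i j : Fin 7} (hij : i ≠ j) {k l : Fin 3} {z : ℂ} (h1 : onE (t i) k z)
    (h2 : onE (t j) l z) (q : ℂ) (a : 0 < lam (t i) k q) (b : 0 < lam (t j) l q) : False := by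
  obtain ⟨e1, p1, k1⟩ := intnea _ _ z q h1 a
  obtain ⟨e2, p2, k2⟩ := intnea _ _ z q h2 b
  have hm : 0 < min e1 e2 := lt_min p1 p2
  have c1 := k1 (min e1 e2 / 2) (by linarith) (by linarith [min_le_left e1 e2])
  have c2 := k2 (min e1 e2 / 2) (by linarith) (by linarith [min_le_right e1 e2])
  rw [← memint _ (H.hD _)] at c1 c2
  have := H.disj i j hij
  have h := Set.mem_inter c1 c2
  rw [this] at h
  exact h

lemma Til.opp (H : Til Z T t) {x y : Fin 7 × Fin 3} (hxy : x ≠ y) {z : ℂ} (h1 : onE (t x.1) x.2 z)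
    (h2 : onE (t y.1) y.2 z) : lam (t x.1) x.2 (t y.1 (y.2+1)) = 0 ∧ lam (t x.1) x.2 (t y.1 (y.2+2)) = 0 ∧
      lam (t x.1) x.2 (t y.1 y.2) < 0 := by
  obtain ⟨i, k⟩ := x
  obtain ⟨j, l⟩ := y
  simp only at *
  have hij : i ≠ j := by
    rintro rfl
    have hkl : k ≠ l := fun h => hxy (by rw [h])
    have : k = l + 1 ∨ k = l + 2 := by clear * - hkl; decide +revert
    have h0 := h1.1
    rcases this with h | h <;> rw [h] at h0
    · exact h2.2.1.ne' h0
    · exact h2.2.2.ne' h0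
  have hD := H.hD j
  have sep := fun q => H.sep hij h1 h2 q
  have hz := onecom _ hD l z h2
  have hs := lamsum' _ hD l z
  rw [h2.1] at hs
  have h0 := h1.1
  rw [hz, lamcom _ _ _ _ _ _ (by linarith)] at h0
  set A0 := lam (t i) k (t j l) with hA0
  have key : ∀ m, m ≠ l → lam (t i) k (t j m) ≤ 0 := by
    intro m hm
    by_contra hc; push Not at hc
    set d := lam (t i) k (t j m) / (2 * (lam (t i) k (t j m) + |A0|)) with hd
    have hd0 : 0 < d := by positivity
    have hd1 : d * (2 * (lam (t i) k (t j m) + |A0|)) = lam (t i) k (t j m) := by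
      rw [hd]; field_simp
    apply sep (((1 - d : ℝ) : ℂ) * t j m + (d : ℂ) * t j l)
    · rw [lamcom _ _ _ _ _ _ (by ring)]
      have := neg_abs_le A0
      have := abs_nonneg A0
      change 0 < (1 - d) * _ + d * A0
      nlinarith
    · rw [lamcom _ _ _ _ _ _ (by ring), lamsel _ hD, lamne _ _ _ (Ne.symm hm)]; linarith
  have g1 := key (l+1) (by clear * -; decide +revert)
  have g2 := key (l+2) (by clear * -; decide +revert)
  have e1 := mul_nonpos_of_nonneg_of_nonpos h2.2.1.le g1
  have e2 := mul_nonpos_of_nonneg_of_nonpos h2.2.2.le g2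
  have f1 : lam (t i) k (t j (l+1)) = 0 :=
    (mul_eq_zero.1 (by linarith : lam (t j) (l+1) z * _ = 0)).resolve_left h2.2.1.ne'
  have f2 : lam (t i) k (t j (l+2)) = 0 :=
    (mul_eq_zero.1 (by linarith : lam (t j) (l+2) z * _ = 0)).resolve_left h2.2.2.ne'
  refine ⟨f1, f2, ?_⟩
  rcases lt_trichotomy A0 0 with h | h | h
  · exact h
  · exfalso
    have hr := lamrep (t j) hD (t i k)
    have hsum := lamsum (t j) hD (t i k)
    have h1' := lamsel (t i) (H.hD i) k
    rw [hr, lamcomb _ _ _ _ _ _ _ _ hsum] at h1'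
    have : ∀ m, lam (t i) k (t j m) = 0 := by
      intro m
      have : m = l ∨ m = l + 1 ∨ m = l + 2 := by clear * -; decide +revert
      rcases this with rfl | rfl | rfl
      · exact h
      · exact f1
      · exact f2
    rw [this, this, this] at h1'
    norm_num at h1'
  · exact absurd (sep (t j l) h (by rw [lamsel _ hD]; norm_num)) id

lemma Til.intedg (H : Til Z T t) {x : Fin 7 × Fin 3} (hx : ∀ K, x ∉ SE Z t K) {z : ℂ}
    (hz : onE (t x.1) x.2 z) : inT Z z := by
  intro K
  have hc := onecom _ (H.hD x.1) _ z hz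
  have hs := lamsum' _ (H.hD x.1) x.2 z
  rw [hz.1] at hs
  rw [hc, lamcom _ _ _ _ _ _ (by linarith)]
  have a1 := H.lamZ x.1 (x.2+1) K
  have a2 := H.lamZ x.1 (x.2+2) K
  have := hx K
  rw [memse, not_and_or] at this
  rcases this with h | h
  · have := mul_pos hz.2.1 (lt_of_le_of_ne a1 (Ne.symm h))
    have := mul_nonneg hz.2.2.le a2
    linarith
  · have := mul_pos hz.2.2 (lt_of_le_of_ne a2 (Ne.symm h))
    have := mul_nonneg hz.2.1.le a1
    linarith

lemma Til.sidnotint (H : Til Z T t) {x : Fin 7 × Fin 3} {K : Fin 3} (hx : x ∈ SE Z t K) {z : ℂ}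
    (hz : onE (t x.1) x.2 z) : ¬ inT Z z := by
  intro hi
  have hc := onecom _ (H.hD x.1) _ z hz
  have hs := lamsum' _ (H.hD x.1) x.2 z
  rw [hz.1] at hs
  have h0 := hi K
  rw [memse] at hx
  rw [hc, lamcom _ _ _ _ _ _ (by linarith), hx.1, hx.2] at h0
  norm_num at h0

lemma Til.eetwo (H : Til Z T t) {z : ℂ} (hV : z ∉ VV t) (hz : inT Z z) (x : Fin 7 × Fin 3)
    (hx : onE (t x.1) x.2 z) : EE t z = 2 := by
  have := notV H z hV
  rw [thint Z H.hZ z hz] at this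
  have h1 : (EE t z : ℝ) + 2 * II t z = 2 := by
    have : ((EE t z : ℝ) + 2 * II t z - 2) * π = 0 := by linarith
    have := (mul_eq_zero.1 this).resolve_right pi_pos.ne'
    linarith
  have h2 : EE t z + 2 * II t z = 2 := by exact_mod_cast h1
  have : 0 < EE t z := Finset.card_pos.2 ⟨x, by simpa using hx⟩
  omega

lemma Til.partner (H : Til Z T t) {z : ℂ} (hV : z ∉ VV t) (hz : inT Z z) (x : Fin 7 × Fin 3)
    (hx : onE (t x.1) x.2 z) : ∃ y, y ≠ x ∧ onE (t y.1) y.2 z ∧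
      ∀ w, onE (t w.1) w.2 z → w = x ∨ w = y := by
  classical
  have h := H.eetwo hV hz x hx
  unfold EE at h
  obtain ⟨a, b, hab, hs⟩ := Finset.card_eq_two.1 h
  have mem : ∀ w, onE (t w.1) w.2 z ↔ w = a ∨ w = b := by
    intro w
    have : w ∈ Finset.univ.filter (fun x : Fin 7 × Fin 3 => onE (t x.1) x.2 z) ↔ w = a ∨ w = b := by
      rw [hs]; simp
    rwa [mem_filter, and_iff_right (mem_univ _)] at this
  rcases (mem x).1 hx with rfl | rfl
  · exact ⟨b, hab.symm, (mem b).2 (Or.inr rfl), fun w hw => (mem w).1 hw⟩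
  · exact ⟨a, hab, (mem a).2 (Or.inl rfl), fun w hw => ((mem w).1 hw).symm⟩

lemma Til.clean (_H : Til Z T t) {x : Fin 7 × Fin 3} {p : ℂ} (hp : p ∈ VV t) (hi : inT Z p)
    (h0 : p ∈ WW Z t → EE t p = 0) : ¬ onE (t x.1) x.2 p := by
  classical
  intro h
  have hW : p ∈ WW Z t := by
    unfold WW CC; rw [mem_sdiff]
    refine ⟨hp, fun hc => ?_⟩
    simp only [mem_image, mem_univ, true_and] at hc
    obtain ⟨K, rfl⟩ := hc
    have := hi (K+1)
    rw [lamne _ _ _ (by clear * -; decide +revert)] at this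
    exact lt_irrefl _ this
  have : 0 < EE t p := Finset.card_pos.2 ⟨x, by simpa using h⟩
  rw [h0 hW] at this
  exact lt_irrefl _ this

lemma segaux (u v a b : ℝ) (ab : a < b) (nA : min u v < a ∧ a < max u v → False)
    (nB : min u v < b ∧ b < max u v → False) (m1 : a < u → u < b → False) (m2 : a < v → v < b → False)
    (hs : min u v < (a + b) / 2 ∧ (a + b) / 2 < max u v) : min u v = a ∧ max u v = b := by
  rcases le_total u v with h | h
  · rw [min_eq_left h, max_eq_right h] at *; grind
  · rw [min_eq_right h, max_eq_left h] at *; grind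

lemma Til.seg (H : Til Z T t) {x : Fin 7 × Fin 3} (hx : ∀ K, x ∉ SE Z t K) {A B : ℂ} (hA : A ∈ VV t)
    (hB : B ∈ VV t) (a0 : lam (t x.1) x.2 A = 0) (b0 : lam (t x.1) x.2 B = 0)
    (a1 : 0 ≤ lam (t x.1) (x.2+2) A) (ab : lam (t x.1) (x.2+2) A < lam (t x.1) (x.2+2) B)
    (b1 : lam (t x.1) (x.2+2) B ≤ 1)
    (hno : ∀ p ∈ VV t, onE (t x.1) x.2 p → lam (t x.1) (x.2+2) A < lam (t x.1) (x.2+2) p →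
      lam (t x.1) (x.2+2) p < lam (t x.1) (x.2+2) B → False)
    (hcl : ∀ y, y ≠ x → (∀ K, y ∉ SE Z t K) → ∀ p ∈ VV t, ¬ onE (t y.1) y.2 p) :
    ∃ y, y ≠ x ∧ (∀ K, y ∉ SE Z t K) ∧
      lam (t x.1) x.2 (t y.1 (y.2+1)) = 0 ∧ lam (t x.1) x.2 (t y.1 (y.2+2)) = 0 ∧
      lo (t x.1) x.2 (t y.1) y.2 = lam (t x.1) (x.2+2) A ∧
      hi (t x.1) x.2 (t y.1) y.2 = lam (t x.1) (x.2+2) B ∧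
      onE (t x.1) x.2 ((A + B) / 2) ∧ onE (t y.1) y.2 ((A + B) / 2) ∧
      ∀ w, onE (t w.1) w.2 ((A + B) / 2) → w = x ∨ w = y := by
  have hD := H.hD x.1
  set F := t x.1
  set K := x.2
  have hmid : (A + B) / 2 = ((1/2 : ℝ) : ℂ) * A + ((1/2 : ℝ) : ℂ) * B := by push_cast; ring
  have hm0 : lam F K ((A + B) / 2) = 0 := by
    rw [hmid, lamcom _ _ _ _ _ _ (by norm_num), a0, b0]; ring
  have hm2 : lam F (K+2) ((A + B) / 2) = (lam F (K+2) A + lam F (K+2) B) / 2 := by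
    rw [hmid, lamcom _ _ _ _ _ _ (by norm_num)]; ring
  have honE : ∀ p, lam F K p = 0 → 0 < lam F (K+2) p → lam F (K+2) p < 1 → onE F K p := by
    intro p h h1 h2
    have := lamsum' F hD K p
    exact ⟨h, by linarith, h1⟩
  have hmo : onE F K ((A + B) / 2) := honE _ hm0 (by linarith) (by linarith)
  have hV : (A + B) / 2 ∉ VV t := fun h => hno _ h hmo (by linarith) (by linarith)
  have hin := H.intedg hx hmo
  obtain ⟨y, hyx, hy, huniq⟩ := H.partner hV hin x hmo
  have hyS : ∀ K, y ∉ SE Z t K := fun K h => H.sidnotint h hy hin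
  obtain ⟨e1, e2, -⟩ := H.opp hyx.symm hmo hy
  refine ⟨y, hyx, hyS, e1, e2, ?_, ?_, hmo, hy, huniq⟩
  on_goal 1 => refine And.left (b := hi F K (t y.1) y.2 = lam F (K+2) B) ?_
  on_goal 2 => refine And.right (a := lo F K (t y.1) y.2 = lam F (K+2) A) ?_
  all_goals
    have fr := onefra F hD K (t y.1) (H.hD _) y.2 e1 e2
    have hs := (fr _ hm0).1 hy
    have nA := fun h => hcl y hyx hyS A hA ((fr A a0).2 h)
    have nB := fun h => hcl y hyx hyS B hB ((fr B b0).2 h)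
    have n1 : ∀ m, m = y.2 + 1 ∨ m = y.2 + 2 → lam F (K+2) A < lam F (K+2) (t y.1 m) →
        lam F (K+2) (t y.1 m) < lam F (K+2) B → False := by
      intro m hm h1 h2
      have : lam F K (t y.1 m) = 0 := by rcases hm with rfl | rfl <;> assumption
      exact hno _ (memvv y.1 m) (honE _ this (by linarith) (by linarith)) h1 h2
    have m1 := n1 _ (Or.inl rfl)
    have m2 := n1 _ (Or.inr rfl)
    rw [hm2] at hs
    unfold lo hi at *
    generalize lam F (K+2) (t y.1 (y.2+1)) = u at *
    generalize lam F (K+2) (t y.1 (y.2+2)) = v at *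
    generalize lam F (K+2) A = a at *
    generalize lam F (K+2) B = b at *
    exact segaux u v a b ab nA nB m1 m2 hs

open Classical in
def IE (Z : CTri) (t : Fin 7 → CTri) : Finset (Fin 7 × Fin 3) :=
  Finset.univ.filter fun x => ∀ K, x ∉ SE Z t K

lemma Til.pair (H : Til Z T t) (h0 : ∀ p ∈ WW Z t, inT Z p → EE t p = 0) {x : Fin 7 × Fin 3}
    (hx : ∀ K, x ∉ SE Z t K) :
    ∃ y, y ≠ x ∧ (∀ K, y ∉ SE Z t K) ∧ L T x.2 = L T y.2 ∧
    ((t y.1 (y.2+1) = t x.1 (x.2+1) ∧ t y.1 (y.2+2) = t x.1 (x.2+2)) ∨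
     (t y.1 (y.2+1) = t x.1 (x.2+2) ∧ t y.1 (y.2+2) = t x.1 (x.2+1))) ∧
      ∀ w, onE (t w.1) w.2 ((t x.1 (x.2+1) + t x.1 (x.2+2)) / 2) → w = x ∨ w = y := by
  have hD := H.hD x.1
  have cl : ∀ y : Fin 7 × Fin 3, (∀ K, y ∉ SE Z t K) → ∀ p ∈ VV t, ¬ onE (t y.1) y.2 p := by
    intro y hy p hp ho
    have hi := H.intedg hy ho
    exact H.clean hp hi (fun hW => h0 p hW hi) ho
  have l1 : lam (t x.1) (x.2+2) (t x.1 (x.2+1)) = 0 := lamne _ _ _ (by generalize x.2 = k; clear * -; decide +revert)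
  have l2 : lam (t x.1) (x.2+2) (t x.1 (x.2+2)) = 1 := lamsel _ hD _
  obtain ⟨y, h1, h2, h3, h4, h5, h6, h7, h8, h9⟩ := H.seg hx (memvv x.1 (x.2+1)) (memvv x.1 (x.2+2))
    (lamo1 _ _) (lamo2 _ _) l1.ge (by rw [l1, l2]; norm_num) l2.le
    (fun p hp ho => absurd ho (cl x hx p hp)) (fun y _ hy => cl y hy)
  refine ⟨y, h1, h2, ?_, ?_, h9⟩
  · have := hisublo _ hD x.2 (t y.1) y.2 h3 h4
    rw [h5, h6, l1, l2, H.L_eq, H.L_eq] at this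
    linarith
  · rw [l1] at h5
    rw [l2] at h6
    unfold lo at h5; unfold hi at h6
    rcases le_total (lam (t x.1) (x.2+2) (t y.1 (y.2+1))) (lam (t x.1) (x.2+2) (t y.1 (y.2+2))) with h | h
    · rw [min_eq_left h] at h5; rw [max_eq_right h] at h6
      left
      exact ⟨fraext _ hD _ _ _ (h3.trans (lamo1 _ _).symm) (h5.trans l1.symm),
        fraext _ hD _ _ _ (h4.trans (lamo2 _ _).symm) (h6.trans l2.symm)⟩
    · rw [min_eq_right h] at h5; rw [max_eq_left h] at h6
      right
      exact ⟨fraext _ hD _ _ _ (h3.trans (lamo2 _ _).symm) (h6.trans l2.symm),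
        fraext _ hD _ _ _ (h4.trans (lamo1 _ _).symm) (h5.trans l1.symm)⟩

lemma Til.even (H : Til Z T t) (h0 : ∀ p ∈ WW Z t, inT Z p → EE t p = 0) (Q : Fin 7 × Fin 3 → Prop)
    [DecidablePred Q]
    (hQ : ∀ x y, L T x.2 = L T y.2 → ((t y.1 (y.2+1) = t x.1 (x.2+1) ∧ t y.1 (y.2+2) = t x.1 (x.2+2)) ∨
     (t y.1 (y.2+1) = t x.1 (x.2+2) ∧ t y.1 (y.2+2) = t x.1 (x.2+1))) → Q x → Q y) :
    Even (((IE Z t).filter Q).card) := by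
  classical
  set m : Fin 7 × Fin 3 → ℂ := fun x => (t x.1 (x.2+1) + t x.1 (x.2+2)) / 2
  have hon : ∀ x : Fin 7 × Fin 3, onE (t x.1) x.2 (m x) := by
    intro x
    have := comone (t x.1) (H.hD _) x.2 (1/2) (1/2) (by norm_num) (by norm_num) (by norm_num)
    convert this using 1
    push_cast; simp only [m]; ring
  rw [Finset.card_eq_sum_card_image m]
  apply Finset.even_sum
  intro c hc
  obtain ⟨x, hx, rfl⟩ := mem_image.1 hc
  rw [mem_filter, IE, mem_filter] at hx
  obtain ⟨y, h1, h2, h3, h4, h5⟩ := H.pair h0 hx.1.2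
  have : ((IE Z t).filter Q).filter (fun w => m w = m x) = {x, y} := by
    ext w
    simp only [mem_filter, IE, mem_univ, true_and, mem_insert, mem_singleton]
    constructor
    · rintro ⟨_, hw⟩
      apply h5
      have := hon w
      rw [hw] at this; exact this
    · rintro (rfl | rfl)
      · exact ⟨⟨hx.1.2, hx.2⟩, rfl⟩
      · refine ⟨⟨h2, hQ x _ h3 h4 hx.2⟩, ?_⟩
        rcases h4 with h | h <;> simp only [m] <;> rw [h.1, h.2]
        rw [add_comm]
  rw [this, Finset.card_pair h1.symm]
  exact even_two

lemma Til.eveat (H : Til Z T t) (h0 : ∀ p ∈ WW Z t, inT Z p → EE t p = 0)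
    (hs : ∀ k l, L T k = L T l → k = l) (v : ℂ) (hv : inT Z v) (k : Fin 3) :
    Even (NN t v (k+1) + NN t v (k+2)) := by
  classical
  have h := H.even h0 (fun x => x.2 = k ∧ (t x.1 (x.2+1) = v ∨ t x.1 (x.2+2) = v)) (by
    rintro x y h1 h2 ⟨h3, h4⟩
    have := hs _ _ h1
    refine ⟨this ▸ h3, ?_⟩
    rcases h2 with h2 | h2 <;> rw [h2.1, h2.2] <;> tauto)
  convert h using 1
  unfold NN
  rw [← card_union_of_disjoint]
  · apply Finset.card_bij (fun i _ => (i, k))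
    · intro i hi
      simp only [mem_union, mem_filter, mem_univ, true_and] at hi
      simp only [mem_filter, IE, mem_univ, true_and]
      refine ⟨fun K hK => ?_, hi⟩
      rw [memse] at hK
      have := hv K
      rcases hi with rfl | rfl
      · rw [hK.1] at this; exact lt_irrefl _ this
      · rw [hK.2] at this; exact lt_irrefl _ this
    · intro i _ j _ h; exact (Prod.ext_iff.1 h).1
    · rintro ⟨i, l⟩ h
      simp only [mem_filter] at h
      obtain ⟨-, rfl, h6⟩ := h
      exact ⟨i, by simpa using h6, rfl⟩
  · rw [Finset.disjoint_left]
    intro i h1 h2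
    simp only [mem_filter, mem_univ, true_and] at h1 h2
    have := injver _ (H.hD i) _ _ (h1.trans h2.symm)
    clear * - this; revert this; decide +revert

lemma Til.oneT (H : Til Z T t) (q : ℂ) (hq : q ∈ WW Z t) (hi : inT Z q) (hE : EE t q = 1)
    (h0 : ∀ p ∈ WW Z t, inT Z p → p ≠ q → EE t p = 0) : ∃ k l m : Fin 3, L T k = L T l + L T m := by
  classical
  obtain ⟨x, hx⟩ := card_eq_one.1 hE
  have mem : ∀ w, onE (t w.1) w.2 q ↔ w = x := by
    intro w
    have : w ∈ Finset.univ.filter (fun x : Fin 7 × Fin 3 => onE (t x.1) x.2 q) ↔ w = x := by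
      rw [hx]; simp
    rwa [mem_filter, and_iff_right (mem_univ _)] at this
  have hxq := (mem x).2 rfl
  have hxS : ∀ K, x ∉ SE Z t K := fun K h => H.sidnotint h hxq hi
  have hD := H.hD x.1
  have hqV : q ∈ VV t := by unfold WW at hq; exact (mem_sdiff.1 hq).1
  have cl : ∀ y : Fin 7 × Fin 3, (∀ K, y ∉ SE Z t K) → ∀ p ∈ VV t, onE (t y.1) y.2 p → p = q := by
    intro y hy p hp ho
    by_contra hne
    have hi := H.intedg hy ho
    exact H.clean hp hi (fun hW => h0 p hW hi hne) ho
  have hcl : ∀ y, y ≠ x → (∀ K, y ∉ SE Z t K) → ∀ p ∈ VV t, ¬ onE (t y.1) y.2 p := by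
    intro y hy hyS p hp ho
    have := cl y hyS p hp ho
    subst this
    exact hy ((mem y).1 ho)
  have l1 : lam (t x.1) (x.2+2) (t x.1 (x.2+1)) = 0 := lamne _ _ _ (by generalize x.2 = k; clear * -; decide +revert)
  have l2 : lam (t x.1) (x.2+2) (t x.1 (x.2+2)) = 1 := lamsel _ hD _
  have hs := lamsum' _ hD x.2 q
  rw [hxq.1] at hs
  have q1 := hxq.2.1
  have q2 := hxq.2.2
  obtain ⟨y, -, -, h3, h4, h5, h6, -⟩ := H.seg hxS (memvv x.1 (x.2+1)) hqV
    (lamo1 _ _) hxq.1 l1.ge (by rw [l1]; exact q2) (by linarith)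
    (fun p hp ho _ h => by rw [cl x hxS p hp ho] at h; exact lt_irrefl _ h) hcl
  obtain ⟨y', -, -, h3', h4', h5', h6', -⟩ := H.seg hxS hqV (memvv x.1 (x.2+2))
    hxq.1 (lamo2 _ _) q2.le (by rw [l2]; linarith) l2.le
    (fun p hp ho h _ => by rw [cl x hxS p hp ho] at h; exact lt_irrefl _ h) hcl
  have e1 := hisublo _ hD x.2 (t y.1) y.2 h3 h4
  have e2 := hisublo _ hD x.2 (t y'.1) y'.2 h3' h4'
  rw [h5, h6, l1, H.L_eq, H.L_eq] at e1
  rw [h5', h6', l2, H.L_eq, H.L_eq] at e2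
  exact ⟨x.2, y.2, y'.2, by rw [← e1, ← e2]; ring⟩

lemma Til.prolam (H : Til Z T t) {x y : Fin 7 × Fin 3} (h1 : lam (t x.1) x.2 (t y.1 (y.2+1)) = 0)
    (h2 : lam (t x.1) x.2 (t y.1 (y.2+2)) = 0) (p : ℂ) :
    lam (t x.1) x.2 p = lam (t x.1) x.2 (t y.1 y.2) * lam (t y.1) y.2 p := by
  have hr := lamrep (t y.1) (H.hD _) p
  have hs := lamsum (t y.1) (H.hD _) p
  have h3 : lam (t x.1) x.2 p = lam (t y.1) 0 p * lam (t x.1) x.2 (t y.1 0) +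
      lam (t y.1) 1 p * lam (t x.1) x.2 (t y.1 1) + lam (t y.1) 2 p * lam (t x.1) x.2 (t y.1 2) := by
    conv_lhs => rw [hr]
    rw [lamcomb _ _ _ _ _ _ _ _ hs]
  rw [h3]
  generalize y.2 = l at *
  generalize x.2 = k at *
  have : l = 0 ∨ l = 1 ∨ l = 2 := by clear * -; decide +revert
  rcases this with rfl | rfl | rfl <;> simp at h1 h2 <;> rw [h1, h2] <;> ring

lemma Til.prone (H : Til Z T t) {x y : Fin 7 × Fin 3} (h1 : lam (t x.1) x.2 (t y.1 (y.2+1)) = 0)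
    (h2 : lam (t x.1) x.2 (t y.1 (y.2+2)) = 0) : lam (t x.1) x.2 (t y.1 y.2) ≠ 0 := by
  intro h
  have h3 := H.prolam h1 h2 (t x.1 x.2)
  rw [h, lamsel _ (H.hD _)] at h3
  norm_num at h3

def ln (t : Fin 7 → CTri) (x : Fin 7 × Fin 3) : Set ℂ := {p | lam (t x.1) x.2 p = 0}

lemma Til.lniff (H : Til Z T t) (x y : Fin 7 × Fin 3) : ln t y = ln t x ↔
    lam (t x.1) x.2 (t y.1 (y.2+1)) = 0 ∧ lam (t x.1) x.2 (t y.1 (y.2+2)) = 0 := by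
  constructor
  · intro h
    have h1 : t y.1 (y.2+1) ∈ ln t y := lamo1 _ _
    have h2 : t y.1 (y.2+2) ∈ ln t y := lamo2 _ _
    rw [h] at h1 h2
    exact ⟨h1, h2⟩
  · rintro ⟨h1, h2⟩
    ext p
    have := H.prolam h1 h2 p
    change lam (t y.1) y.2 p = 0 ↔ lam (t x.1) x.2 p = 0
    rw [this, mul_eq_zero, or_iff_right (H.prone h1 h2)]

lemma Til.linbal (H : Til Z T t) (x : Fin 7 × Fin 3) (S : ℝ → Finset (Fin 7 × Fin 3))
    (hS : ∀ e y, y ∈ S e ↔ y ∈ IE Z t ∧ ln t y = ln t x ∧ 0 < e * lam (t x.1) x.2 (t y.1 y.2)) :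
    ∑ y ∈ S 1, L T y.2 = ∑ y ∈ S (-1), L T y.2 := by
  classical
  have hD := H.hD x.1
  set F := t x.1
  set K := x.2
  have hcol : ∀ e, ∀ y ∈ S e, lam F K (t y.1 (y.2+1)) = 0 ∧ lam F K (t y.1 (y.2+2)) = 0 := by
    intro e y hy; exact (H.lniff x y).1 ((hS e y).1 hy).2.1
  have hlt : ∀ e, ∀ y ∈ S e, lo F K (t y.1) y.2 < hi F K (t y.1) y.2 := by
    intro e y hy; exact lolthi F hD K _ (H.hD _) _ (hcol e y hy).1 (hcol e y hy).2
  have key := sumlen (S 1) (S (-1)) (fun y => lo F K (t y.1) y.2) (fun y => hi F K (t y.1) y.2)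
    (fun y => lo F K (t y.1) y.2) (fun y => hi F K (t y.1) y.2) (hlt 1) (hlt (-1))
    ((VV t).image (lam F (K+2))) ?_
  · have e : ∀ e, (∑ y ∈ S e, (hi F K (t y.1) y.2 - lo F K (t y.1) y.2)) * L F K = ∑ y ∈ S e, L T y.2 := by
      intro e
      rw [sum_mul]
      apply sum_congr rfl
      intro y hy
      rw [hisublo F hD K _ _ (hcol e y hy).1 (hcol e y hy).2, H.L_eq]
    rw [← e, ← e, key]
  · intro s hs
    obtain ⟨q, hq0, hqs⟩ : ∃ q, lam F K q = 0 ∧ lam F (K+2) q = s := by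
      refine ⟨((1 - s : ℝ) : ℂ) * F (K+1) + (s : ℂ) * F (K+2), ?_, ?_⟩
      · rw [lamcom _ _ _ _ _ _ (by ring), lamo1, lamo2]; ring
      · rw [lamcom _ _ _ _ _ _ (by ring), lamsel F hD, lamne F (K+2) (K+1) (by generalize K = k; clear * -; decide +revert)]; ring
    have hV : q ∉ VV t := fun h => hs (mem_image.2 ⟨q, h, hqs⟩)
    have conv : ∀ e, (∑ y ∈ S e, if lo F K (t y.1) y.2 < s ∧ s < hi F K (t y.1) y.2 then 1 else 0 : ℕ)
        = ((S e).filter fun y => onE (t y.1) y.2 q).card := by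
      intro e
      rw [card_filter]
      apply sum_congr rfl
      intro y hy
      have := onefra F hD K _ (H.hD y.1) y.2 (hcol e y hy).1 (hcol e y hy).2 q hq0
      rw [hqs] at this
      simp only [this]
    rw [conv, conv]
    have main : ∀ e : ℝ, e = 1 ∨ e = -1 → ∀ y ∈ S e, onE (t y.1) y.2 q →
        ((S e).filter fun y => onE (t y.1) y.2 q).card = 1 ∧
        ((S (-e)).filter fun y => onE (t y.1) y.2 q).card = 1 := by
      intro e he y hy ho
      have hy' := (hS e y).1 hy
      have hI := (mem_filter.1 hy'.1).2
      have hin := H.intedg hI ho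
      obtain ⟨y', hne, ho', huniq⟩ := H.partner hV hin y ho
      obtain ⟨c1, c2, c3⟩ := H.opp hne.symm ho ho'
      have hln : ln t y' = ln t y := (H.lniff y y').2 ⟨c1, c2⟩
      have hI' : y' ∈ IE Z t := mem_filter.2 ⟨mem_univ _, fun K h => H.sidnotint h ho' hin⟩
      have hc := hcol e y hy
      have hp := H.prolam hc.1 hc.2 (t y'.1 y'.2)
      have hpos := hy'.2.2
      have hneg : e * lam F K (t y'.1 y'.2) < 0 := by
        have : e * lam F K (t y'.1 y'.2) = (e * lam F K (t y.1 y.2)) * lam (t y.1) y.2 (t y'.1 y'.2) := by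
          rw [mul_assoc, ← hp]
        rw [this]; exact mul_neg_of_pos_of_neg hpos c3
      constructor
      · rw [card_eq_one]
        refine ⟨y, Finset.eq_singleton_iff_unique_mem.2 ⟨mem_filter.2 ⟨hy, ho⟩, fun w hw => ?_⟩⟩
        rw [mem_filter] at hw
        rcases huniq w hw.2 with h | h
        · exact h
        · have := ((hS e w).1 hw.1).2.2
          rw [h] at this; exact absurd this (not_lt.2 hneg.le)
      · rw [card_eq_one]
        refine ⟨y', Finset.eq_singleton_iff_unique_mem.2 ⟨mem_filter.2
          ⟨(hS (-e) y').2 ⟨hI', hln.trans hy'.2.1, by change 0 < -e * lam F K (t y'.1 y'.2); linarith⟩, ho'⟩, fun w hw => ?_⟩⟩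
        rw [mem_filter] at hw
        rcases huniq w hw.2 with h | h
        · have := ((hS (-e) w).1 hw.1).2.2
          rw [h] at this; change 0 < -e * lam F K _ at this; change 0 < e * lam F K _ at hpos; linarith
        · exact h
    by_cases h1 : ∃ y ∈ S 1, onE (t y.1) y.2 q
    · obtain ⟨y, hy, ho⟩ := h1
      have := main 1 (Or.inl rfl) y hy ho
      rw [this.1, this.2]
    · by_cases h2 : ∃ y ∈ S (-1), onE (t y.1) y.2 q
      · obtain ⟨y, hy, ho⟩ := h2
        have := main (-1) (Or.inr rfl) y hy ho
        rw [neg_neg] at this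
        rw [this.1, this.2]
      · push Not at h1 h2
        rw [Finset.filter_false_of_mem h1, Finset.filter_false_of_mem h2]

lemma Til.baleve (H : Til Z T t)
    (hind : ∀ p q r : ℤ, p * L T 0 + q * L T 1 + r * L T 2 = 0 → p = 0) :
    Even (((IE Z t).filter fun x => x.2 = 0).card) := by
  classical
  rw [Finset.card_eq_sum_card_image (ln t)]
  apply Finset.even_sum
  intro c hc
  obtain ⟨x, hx, rfl⟩ := mem_image.1 hc
  set S : ℝ → Finset (Fin 7 × Fin 3) := fun e => (IE Z t).filter fun y => ln t y = ln t x ∧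
    0 < e * lam (t x.1) x.2 (t y.1 y.2) with hSdef
  have hS : ∀ e y, y ∈ S e ↔ y ∈ IE Z t ∧ ln t y = ln t x ∧ 0 < e * lam (t x.1) x.2 (t y.1 y.2) := by
    intro e y; simp [hSdef]
  have hb := H.linbal x S hS
  have hsp : ∀ e, ∑ y ∈ S e, L T y.2 = ((S e).filter fun y => y.2 = 0).card * L T 0 +
      ((S e).filter fun y => y.2 = 1).card * L T 1 + ((S e).filter fun y => y.2 = 2).card * L T 2 := by
    intro e
    simp only [card_filter]
    push_cast
    simp only [sum_mul]
    rw [← sum_add_distrib, ← sum_add_distrib]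
    apply sum_congr rfl
    rintro ⟨i, k⟩ _
    fin_cases k <;> simp
  rw [hsp, hsp] at hb
  have h0 := hind (((S 1).filter fun y => y.2 = 0).card - ((S (-1)).filter fun y => y.2 = 0).card)
    (((S 1).filter fun y => y.2 = 1).card - ((S (-1)).filter fun y => y.2 = 1).card)
    (((S 1).filter fun y => y.2 = 2).card - ((S (-1)).filter fun y => y.2 = 2).card) (by
      push_cast; linarith)
  have hu : ((IE Z t).filter fun x => x.2 = 0).filter (fun y => ln t y = ln t x) =
      ((S 1).filter fun y => y.2 = 0) ∪ ((S (-1)).filter fun y => y.2 = 0) := by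
    ext y
    simp only [mem_union, mem_filter, hS]
    constructor
    · rintro ⟨⟨h1, h2⟩, h3⟩
      have h4 := (H.lniff x y).1 h3
      rcases lt_or_gt_of_ne (H.prone h4.1 h4.2) with h | h
      · right; exact ⟨⟨h1, h3, by linarith⟩, h2⟩
      · left; exact ⟨⟨h1, h3, by linarith⟩, h2⟩
    · rintro (⟨⟨h1, h3, -⟩, h2⟩ | ⟨⟨h1, h3, -⟩, h2⟩) <;> exact ⟨⟨h1, h2⟩, h3⟩
  rw [hu, card_union_of_disjoint]
  · exact ⟨((S 1).filter fun y => y.2 = 0).card, by omega⟩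
  · rw [Finset.disjoint_left]
    intro y h1 h2
    have a := ((hS _ _).1 (mem_filter.1 h1).1).2.2
    have b := ((hS _ _).1 (mem_filter.1 h2).1).2.2
    linarith

lemma Til.balfal (H : Til Z T t)
    (hind : ∀ p q r : ℤ, p * L T 0 + q * L T 1 + r * L T 2 = 0 → p = 0)
    (hm : ∀ K, mm Z t K 0 = 0) : False := by
  classical
  have h := H.baleve hind
  have : (IE Z t).filter (fun x => x.2 = 0) = Finset.univ.image (fun i : Fin 7 => (i, (0 : Fin 3))) := by
    ext ⟨i, k⟩
    simp only [mem_filter, IE, mem_univ, true_and, mem_image, Prod.mk.injEq, exists_eq_left]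
    constructor
    · rintro ⟨_, h⟩; exact h.symm
    · intro h
      refine ⟨fun K hK => ?_, h.symm⟩
      have := mmpos hK
      simp only [← h, hm K] at this
      omega
  rw [this, Finset.card_image_of_injective _ (fun i j h => by simpa using h)] at h
  revert h; simp; decide

lemma ddne (s : CTri) (h : AffineIndependent ℝ s) : DD s ≠ 0 := by
  intro h0
  rw [affineIndependent_iff] at h
  unfold DD cr at h0
  have key : ∀ x y : ℝ, (x : ℂ) * (s 1 - s 0) + y * (s 2 - s 0) = 0 → x = 0 ∧ y = 0 := by
    intro x y hxy
    have := h Finset.univ ![-x - y, x, y] (by simp [Fin.sum_univ_three]; ring)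
      (by simp [Fin.sum_univ_three]; linear_combination hxy)
    exact ⟨by simpa using this 1 (by simp), by simpa using this 2 (by simp)⟩
  have h1 := key (s 2 - s 0).re (-(s 1 - s 0).re) (by
    apply Complex.ext <;> simp at * <;> linarith)
  have h2 := key (s 2 - s 0).im (-(s 1 - s 0).im) (by
    apply Complex.ext <;> simp at * <;> linarith)
  have h3 : s 1 - s 0 = 0 := by
    apply Complex.ext
    · have := h1.2; simp at *; linarith
    · have := h2.2; simp at *; linarith
  have := key 1 0 (by rw [h3]; simp)
  exact one_ne_zero this.1

lemma percas (σ : Equiv.Perm (Fin 3)) : (σ 0 = 0 ∧ σ 1 = 1 ∧ σ 2 = 2) ∨ (σ 0 = 0 ∧ σ 1 = 2 ∧ σ 2 = 1) ∨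
    (σ 0 = 1 ∧ σ 1 = 0 ∧ σ 2 = 2) ∨ (σ 0 = 1 ∧ σ 1 = 2 ∧ σ 2 = 0) ∨
    (σ 0 = 2 ∧ σ 1 = 0 ∧ σ 2 = 1) ∨ (σ 0 = 2 ∧ σ 1 = 1 ∧ σ 2 = 0) := by
  revert σ; decide

lemma ddper (s : CTri) (h : DD s ≠ 0) (σ : Equiv.Perm (Fin 3)) : DD (s ∘ σ) ≠ 0 := by
  have : DD (s ∘ σ) ^ 2 = DD s ^ 2 := by
    unfold DD cr
    rcases percas σ with ⟨h0, h1, h2⟩ | ⟨h0, h1, h2⟩ | ⟨h0, h1, h2⟩ | ⟨h0, h1, h2⟩ | ⟨h0, h1, h2⟩ | ⟨h0, h1, h2⟩ <;>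
      simp [h0, h1, h2] <;> ring
  intro h0
  rw [h0] at this
  exact h (by simpa using this.symm)

lemma hulper (s : CTri) (σ : Equiv.Perm (Fin 3)) : hull (s ∘ σ) = hull s := by
  unfold hull; rw [σ.surjective.range_comp]

lemma Til.permZ (H : Til Z T t) (σ : Equiv.Perm (Fin 3)) : Til (Z ∘ σ) T t :=
  ⟨ddper Z H.hZ σ, H.hT, H.cong, H.disj, by rw [hulper]; exact H.cover⟩

lemma Til.permT (H : Til Z T t) (σ : Equiv.Perm (Fin 3)) : Til Z (T ∘ σ) (fun i => t i ∘ σ) :=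
  ⟨H.hZ, ddper T H.hT σ, fun i j k => H.cong i _ _, fun i j h => by
    simp only [hulper]; exact H.disj i j h, by simp only [hulper]; exact H.cover⟩

lemma transfer (hmain : ∀ (Z T : CTri) (t : Fin 7 → CTri), Til Z T t → L T 0 ≤ L T 1 → L T 1 ≤ L T 2 → False)
    (ABC T : Tri) (hABC : IsTriangle ABC) (hT : IsTriangle T)
    (tiles : Fin 7 → Tri) : ¬ IsTiling 7 ABC T tiles := by
  intro H
  let φ : Pt ≃ₗᵢ[ℝ] ℂ := Complex.orthonormalBasisOneI.repr.symm
  have aff : ∀ s : Tri, AffineIndependent ℝ s → AffineIndependent ℝ (φ ∘ s) := by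
    intro s hs
    exact hs.map' (φ.toLinearEquiv.toLinearMap.toAffineMap) φ.injective
  have hh : ∀ s : Tri, hull (φ ∘ s) = φ '' triSet s := by
    intro s
    unfold hull triSet
    rw [Set.range_comp]
    exact (φ.toLinearEquiv.toLinearMap.image_convexHull _).symm
  choose σ hσ using H.congr
  let f : Fin 3 → ℝ := fun k => dist (T (k+1)) (T (k+2))
  let ρ : Equiv.Perm (Fin 3) := Tuple.sort f
  have hm : Monotone (f ∘ ρ) := Tuple.monotone_sort f
  have H0 : Til (φ ∘ ABC) (φ ∘ T) (fun i => (φ ∘ tiles i) ∘ (σ i).symm) := by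
    refine ⟨ddne _ (aff _ hABC), ddne _ (aff _ hT), ?_, ?_, ?_⟩
    · intro i j k
      simp only [Function.comp, φ.dist_map]
      rw [hσ]; simp
    · intro i j hij
      simp only [hulper, hh]
      have e : ∀ S : Set Pt, interior (φ '' S) = φ '' interior S := fun S =>
        (φ.toHomeomorph.image_interior S).symm
      rw [e, e, ← Set.image_inter φ.injective, H.disj i j hij, Set.image_empty]
    · simp only [hulper, hh]
      rw [← Set.image_iUnion, H.cover]
  have H1 := H0.permT ρ
  have hL : ∀ k, L ((φ ∘ T) ∘ ρ) k = f (ρ k) := by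
    intro k
    have : (ρ (k+1) = ρ k + 1 ∧ ρ (k+2) = ρ k + 2) ∨ (ρ (k+1) = ρ k + 2 ∧ ρ (k+2) = ρ k + 1) := by
      generalize ρ = r; clear * -; revert k r; decide
    unfold L
    simp only [Function.comp, φ.dist_map, f]
    rcases this with h | h <;> rw [h.1, h.2]
    exact dist_comm _ _
  refine hmain _ _ _ H1 ?_ ?_ <;> rw [hL, hL] <;> exact hm (by decide)

def SN (N : ℕ) : Subring ℂ := Subring.closure {w | w ^ (4 * N) = 1}

lemma snint (N : ℕ) (hN : 0 < N) (y : ℂ) (hy : y ∈ SN N) : IsIntegral ℤ y := by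
  have : SN N ≤ (integralClosure ℤ ℂ).toSubring := by
    unfold SN
    rw [Subring.closure_le]
    intro w hw
    exact IsIntegral.of_pow (n := 4 * N) (by omega) (by rw [show w ^ (4 * N) = 1 from hw]; exact isIntegral_one)
  exact this hy

lemma snfro (N : ℕ) (hN : 0 < N) (h7 : ¬ 7 ∣ N) : ∃ f, 0 < f ∧ ∀ y ∈ SN N, ∃ r ∈ SN N, y ^ (7 ^ f) = y + 7 * r := by
  have hc : Nat.Coprime 7 (4 * N) := by
    rw [Nat.Prime.coprime_iff_not_dvd (by norm_num)]
    intro h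
    rcases (Nat.Prime.dvd_mul (by norm_num)).1 h with h | h
    · norm_num at h
    · exact h7 h
  refine ⟨Nat.totient (4 * N), Nat.totient_pos.2 (by omega), fun y hy => ?_⟩
  have hm := Nat.ModEq.pow_totient hc
  set f := Nat.totient (4 * N)
  have hodd : Odd (7 ^ f) := Odd.pow (by decide)
  induction hy using Subring.closure_induction with
  | mem w hw =>
    refine ⟨0, Subring.zero_mem _, ?_⟩
    have h1 : 4 * N ∣ 7 ^ f - 1 := (Nat.modEq_iff_dvd' (Nat.one_le_pow _ _ (by norm_num))).1 hm.symm
    obtain ⟨k, hk⟩ := h1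
    have h2 : 7 ^ f = 4 * N * k + 1 := by
      have : 1 ≤ 7 ^ f := Nat.one_le_pow _ _ (by norm_num)
      omega
    rw [h2, pow_succ, pow_mul, show w ^ (4 * N) = 1 from hw]; simp
  | zero => exact ⟨0, Subring.zero_mem _, by simp⟩
  | one => exact ⟨0, Subring.zero_mem _, by simp⟩
  | add x y hx hy h1 h2 =>
    obtain ⟨r, hr, e1⟩ := h1
    obtain ⟨s, hs, e2⟩ := h2
    obtain ⟨q, hq⟩ := exists_add_pow_prime_pow_eq (R := SN N) (p := 7) (by norm_num) ⟨x, hx⟩ ⟨y, hy⟩ f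
    have := congrArg (Subtype.val) hq
    push_cast at this
    refine ⟨r + s + q.1 * x * y, ?_, ?_⟩
    · have := q.2
      exact Subring.add_mem _ (Subring.add_mem _ hr hs) (Subring.mul_mem _ (Subring.mul_mem _ this hx) hy)
    · have h77 : ((7 : SN N) : ℂ) = 7 := rfl
      rw [this, e1, e2, h77]; ring
  | neg x hx h1 =>
    obtain ⟨r, hr, e1⟩ := h1
    exact ⟨-r, Subring.neg_mem _ hr, by rw [hodd.neg_pow, e1]; ring⟩
  | mul x y hx hy h1 h2 =>
    obtain ⟨r, hr, e1⟩ := h1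
    obtain ⟨s, hs, e2⟩ := h2
    refine ⟨x * s + r * y + 7 * (r * s), ?_, by rw [mul_pow, e1, e2]; ring⟩
    have h7 : (7 : ℂ) ∈ SN N := by exact_mod_cast natCast_mem (SN N) 7
    exact Subring.add_mem _ (Subring.add_mem _ (Subring.mul_mem _ hx hs) (Subring.mul_mem _ hr hy))
      (Subring.mul_mem _ h7 (Subring.mul_mem _ hr hs))

lemma roodiv (N : ℕ) (ξ : ℂ) (h : ξ ^ N = 1) (h1 : ξ ≠ 1) :
    (ξ - 1) * ∑ j ∈ Finset.range N, (j : ℂ) * ξ ^ j = N := by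
  have key : ∀ n : ℕ, (ξ - 1) * ∑ j ∈ Finset.range n, (j : ℂ) * ξ ^ j
      = n * ξ ^ n - ξ * ∑ j ∈ Finset.range n, ξ ^ j := by
    intro n
    induction n with
    | zero => simp
    | succ n ih => rw [Finset.sum_range_succ, mul_add, ih, Finset.sum_range_succ]; push_cast; ring
  have hg : ∑ j ∈ Finset.range N, ξ ^ j = 0 := by
    have := geom_sum_mul ξ N
    rw [h, sub_self] at this
    exact (mul_eq_zero.1 this).resolve_right (sub_ne_zero.2 h1)
  rw [key, hg, h]; ring

lemma twosin (N : ℕ) (x : ℝ) (u : ℤ) (hx : N * x = u * π) (hs : sin x ≠ 0) :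
    ((2 * sin x : ℝ) : ℂ) ∈ SN N ∧ ∃ s ∈ SN N, ((2 * sin x : ℝ) : ℂ) * s = N := by
  have root : ∀ w : ℂ, w ^ (4 * N) = 1 → w ∈ SN N := fun w hw => Subring.subset_closure hw
  set e := Complex.exp (x * Complex.I) with he
  have heN : e ^ (2 * N) = 1 := by
    rw [he, ← Complex.exp_nat_mul, Complex.exp_eq_one_iff]
    refine ⟨u, ?_⟩
    have : ((N * x : ℝ) : ℂ) = ((u * π : ℝ) : ℂ) := by rw [hx]
    push_cast at this ⊢
    linear_combination 2 * Complex.I * this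
  have he0 : e ≠ 0 := Complex.exp_ne_zero _
  have heS : e ∈ SN N := root _ (by rw [show 4 * N = 2 * N * 2 by ring, pow_mul, heN, one_pow])
  have heS' : e⁻¹ ∈ SN N := root _ (by rw [inv_pow, show 4 * N = 2 * N * 2 by ring, pow_mul, heN, one_pow, inv_one])
  have hI : Complex.I ∈ SN N := root _ (by rw [pow_mul, Complex.I_pow_four, one_pow])
  have hsin : ((2 * sin x : ℝ) : ℂ) = Complex.I * (e⁻¹ - e) := by
    push_cast
    rw [Complex.sin, he, ← Complex.exp_neg]
    rw [neg_mul]; ring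
  constructor
  · rw [hsin]; exact Subring.mul_mem _ hI (Subring.sub_mem _ heS' heS)
  · have hne : e ^ 2 ≠ 1 := by
      intro h
      have : e⁻¹ = e := inv_eq_of_mul_eq_one_right (by rw [← h]; ring)
      rw [this, sub_self, mul_zero] at hsin
      have h2 : (2 * sin x : ℝ) = 0 := by exact_mod_cast hsin
      exact hs (by linarith)
    have hd := roodiv N (e ^ 2) (by rw [← pow_mul]; exact heN) hne
    refine ⟨Complex.I * e * ∑ j ∈ Finset.range N, (j : ℂ) * (e ^ 2) ^ j, ?_, ?_⟩
    · refine Subring.mul_mem _ (Subring.mul_mem _ hI heS) (Subring.sum_mem _ fun j _ => ?_)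
      exact Subring.mul_mem _ (natCast_mem (SN N) j) (Subring.pow_mem _ (Subring.pow_mem _ heS _) _)
    · rw [hsin, ← hd]
      have : Complex.I * Complex.I = -1 := Complex.I_mul_I
      field_simp
      linear_combination ((1 - e ^ 2) * ∑ j ∈ Finset.range N, (j : ℂ) * (e ^ 2) ^ j) * this

lemma notdvd (N : ℕ) (hN : 0 < N) (h7 : ¬ 7 ∣ N) (k : ℕ) (w : ℂ) (hw : w ∈ SN N) (h : (N : ℂ) ^ k = 7 * w) : False := by
  have h1 := snint N hN w hw
  have h2 : w = algebraMap ℚ ℂ ((N : ℚ) ^ k / 7) := by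
    simp; rw [h]; field_simp
  rw [h2] at h1
  have h3 := (isIntegral_algebraMap_iff (algebraMap ℚ ℂ).injective).1 h1
  obtain ⟨z, hz⟩ := IsIntegrallyClosed.isIntegral_iff.1 h3
  have : ((7 * z : ℤ) : ℚ) = ((N ^ k : ℤ) : ℚ) := by
    push_cast; simp at hz; rw [hz]; field_simp
  have h4 : 7 * z = (N : ℤ) ^ k := by exact_mod_cast this
  have h5 : (7 : ℤ) ∣ (N : ℤ) ^ k := ⟨z, h4.symm⟩
  have h6 : 7 ∣ N ^ k := by exact_mod_cast h5
  exact h7 (Nat.Prime.dvd_of_dvd_pow (by norm_num) h6)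

lemma frob (N : ℕ) (hN : 0 < N) (h7 : ¬ 7 ∣ N) (s0 s1 s2 S0 S1 S2 x : ℂ)
    (h : ∀ y ∈ ({s0, s1, s2, S0, S1, S2} : Set ℂ), y ∈ SN N ∧ ∃ s ∈ SN N, y * s = N)
    (hx : x ∈ SN N) (he : x ^ 2 * S1 * S2 = 7 * s0 * s1 * s2 * S0) : False := by
  obtain ⟨m0, a0, ha0, e0⟩ := h s0 (by simp)
  obtain ⟨m1, a1, ha1, e1⟩ := h s1 (by simp)
  obtain ⟨m2, a2, ha2, e2⟩ := h s2 (by simp)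
  obtain ⟨M0, A0, hA0, E0⟩ := h S0 (by simp)
  obtain ⟨M1, A1, hA1, E1⟩ := h S1 (by simp)
  obtain ⟨M2, A2, hA2, E2⟩ := h S2 (by simp)
  have hmul : ∀ {a b : ℂ}, a ∈ SN N → b ∈ SN N → a * b ∈ SN N := fun h1 h2 => Subring.mul_mem _ h1 h2
  obtain ⟨f, hf, hfr⟩ := snfro N hN h7
  have hx2 : ∃ y ∈ SN N, x ^ 2 = 7 * y := by
    have hc : IsCoprime ((N : ℤ) ^ 2) 7 := by
      apply IsCoprime.pow_left
      have : IsCoprime (N : ℤ) ((7 : ℕ) : ℤ) := Nat.isCoprime_iff_coprime.2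
        ((Nat.Prime.coprime_iff_not_dvd (by norm_num)).2 h7).symm
      exact_mod_cast this
    obtain ⟨u, v, huv⟩ := hc
    have huv' : (u : ℂ) * (N : ℂ) ^ 2 + v * 7 = 1 := by exact_mod_cast huv
    refine ⟨u * (s0 * s1 * s2 * S0 * A1 * A2) + v * x ^ 2, ?_, ?_⟩
    · refine Subring.add_mem _ (hmul (intCast_mem (SN N) u) (hmul (hmul (hmul (hmul (hmul m0 m1) m2) M0) hA1) hA2))
        (hmul (intCast_mem (SN N) v) (Subring.pow_mem _ hx _))
    · have : x ^ 2 * (N : ℂ) ^ 2 = 7 * (s0 * s1 * s2 * S0 * A1 * A2) := by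
        calc x ^ 2 * (N : ℂ) ^ 2 = x ^ 2 * (S1 * A1) * (S2 * A2) := by rw [E1, E2]; ring
          _ = _ := by linear_combination A1 * A2 * he
      linear_combination (u : ℂ) * this - x ^ 2 * huv'
  have hx1 : ∃ y ∈ SN N, x = 7 * y := by
    obtain ⟨y, hy, e⟩ := hx2
    obtain ⟨r, hr, e'⟩ := hfr x hx
    have h2 : 2 ≤ 7 ^ f := by
      calc 2 ≤ 7 ^ 1 := by norm_num
        _ ≤ 7 ^ f := Nat.pow_le_pow_right (by norm_num) hf
    obtain ⟨g, hg⟩ := Nat.exists_eq_add_of_le h2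
    rw [hg, pow_add, e] at e'
    exact ⟨y * x ^ g - r, Subring.sub_mem _ (hmul hy (Subring.pow_mem _ hx _)) hr, by linear_combination -e'⟩
  obtain ⟨y, hy, rfl⟩ := hx1
  have h1 : 7 * (y ^ 2 * S1 * S2) = s0 * s1 * s2 * S0 := by
    have h7 : (7 : ℂ) ≠ 0 := by norm_num
    apply mlc h7
    linear_combination he
  apply notdvd N hN h7 4 (y ^ 2 * S1 * S2 * a0 * a1 * a2 * A0)
  · exact hmul (hmul (hmul (hmul (hmul (hmul (Subring.pow_mem _ hy _) M1) M2) ha0) ha1) ha2) hA0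
  · calc (N : ℂ) ^ 4 = (s0 * a0) * (s1 * a1) * (s2 * a2) * (S0 * A0) := by rw [e0, e1, e2, E0]; ring
      _ = _ := by linear_combination (-a0 * a1 * a2 * A0) * h1

lemma lawsin (t : CTri) (h : DD t ≠ 0) (k l : Fin 3) : L t k * sin (ang t l) = L t l * sin (ang t k) := by
  have h0 := laware t 0
  have h1 := laware t 1
  have h2 := laware t 2
  have p0 := lpos t h 0
  have p1 := lpos t h 1
  have p2 := lpos t h 2
  simp only [zero_add, e1, e2, e3, e4] at h0 h1 h2
  have a01 : L t 0 * sin (ang t 1) = L t 1 * sin (ang t 0) := by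
    apply mlc p2.ne'; linarith
  have a02 : L t 0 * sin (ang t 2) = L t 2 * sin (ang t 0) := by
    apply mlc p1.ne'; linarith
  have a12 : L t 1 * sin (ang t 2) = L t 2 * sin (ang t 1) := by
    apply mlc p0.ne'; linarith
  fin_cases k <;> fin_cases l <;> simp [a01, a02, a12]

lemma Til.key (H : Til Z T t) : ((mm Z t 0 0 * (2 * sin (ang T 0)) + mm Z t 0 1 * (2 * sin (ang T 1))
      + mm Z t 0 2 * (2 * sin (ang T 2))) ^ 2 * (2 * sin (ang Z 1)) * (2 * sin (ang Z 2))
      = 7 * (2 * sin (ang T 0)) * (2 * sin (ang T 1)) * (2 * sin (ang T 2)) * (2 * sin (ang Z 0))) := by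
  have ha := H.area
  have hs := H.sidlen 0
  have z1 := lawsin Z H.hZ 1 0
  have z2 := lawsin Z H.hZ 2 0
  have t1 := lawsin T H.hT 1 0
  have t2 := lawsin T H.hT 2 0
  rw [laware Z 0, laware T 0] at ha
  have q0 := H.spos 0
  have p0 := H.lp 0
  have Q0 := sinangpos Z H.hZ 0
  simp only [zero_add] at ha
  set a := L T 0
  set b := L T 1
  set c := L T 2
  set s0 := sin (ang T 0)
  set s1 := sin (ang T 1)
  set s2 := sin (ang T 2)
  have hX : a * (mm Z t 0 0 * s0 + mm Z t 0 1 * s1 + mm Z t 0 2 * s2) = L Z 0 * s0 := by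
    rw [hs]; linear_combination -(mm Z t 0 1 : ℝ) * t1 - (mm Z t 0 2 : ℝ) * t2
  set x := (mm Z t 0 0 * s0 + mm Z t 0 1 * s1 + mm Z t 0 2 * s2)
  have key : x ^ 2 * sin (ang Z 1) * sin (ang Z 2) = 7 * s0 * s1 * s2 * sin (ang Z 0) := by
    have : (a ^ 2) * (x ^ 2 * sin (ang Z 1) * sin (ang Z 2)) = a ^ 2 * (7 * s0 * s1 * s2 * sin (ang Z 0)) := by
      calc (a ^ 2) * (x ^ 2 * sin (ang Z 1) * sin (ang Z 2)) = (a * x) ^ 2 * sin (ang Z 1) * sin (ang Z 2) := by ring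
        _ = s0 ^ 2 * (L Z 0 * sin (ang Z 1)) * (L Z 0 * sin (ang Z 2)) := by rw [hX]; ring
        _ = s0 ^ 2 * sin (ang Z 0) * (L Z 1 * L Z 2 * sin (ang Z 0)) := by rw [← z1, ← z2]; ring
        _ = 7 * s0 * sin (ang Z 0) * (b * s0) * (c * s0) := by rw [ha]; ring
        _ = _ := by rw [t1, t2]; ring
    exact mlc (by positivity) this
  linear_combination 16 * key

lemma Til.frobN (H : Til Z T t) (N : ℕ) (h7 : ¬ 7 ∣ N) (hang : ∀ j, ∃ u : ℤ, N * ang T j = u * π) : False := by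
  have hN : 0 < N := by rcases Nat.eq_zero_or_pos N with h | h; · simp [h] at h7
                        · exact h
  have hZ : ∀ K, ∃ u : ℤ, N * ang Z K = u * π := by
    intro K
    obtain ⟨u0, h0⟩ := hang 0
    obtain ⟨u1, h1⟩ := hang 1
    obtain ⟨u2, h2⟩ := hang 2
    refine ⟨NN t (Z K) 0 * u0 + NN t (Z K) 1 * u1 + NN t (Z K) 2 * u2, ?_⟩
    rw [← (H.corner K).1]; unfold NA; push_cast
    linear_combination (NN t (Z K) 0 : ℝ) * h0 + (NN t (Z K) 1 : ℝ) * h1 + (NN t (Z K) 2 : ℝ) * h2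
  have hT' : ∀ j, ((2 * sin (ang T j) : ℝ) : ℂ) ∈ SN N ∧ ∃ s ∈ SN N, ((2 * sin (ang T j) : ℝ) : ℂ) * s = N := by
    intro j; obtain ⟨u, hu⟩ := hang j
    exact twosin N _ u hu (H.spos j).ne'
  have hZ' : ∀ j, ((2 * sin (ang Z j) : ℝ) : ℂ) ∈ SN N ∧ ∃ s ∈ SN N, ((2 * sin (ang Z j) : ℝ) : ℂ) * s = N := by
    intro j; obtain ⟨u, hu⟩ := hZ j
    exact twosin N _ u hu (sinangpos Z H.hZ j).ne'
  have key := congrArg (fun x : ℝ => (x : ℂ)) H.key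
  simp only [Complex.ofReal_mul, Complex.ofReal_pow] at key
  refine frob N hN h7 (S0 := ((2 * sin (ang Z 0) : ℝ) : ℂ)) (S1 := ((2 * sin (ang Z 1) : ℝ) : ℂ)) (S2 := ((2 * sin (ang Z 2) : ℝ) : ℂ))
    (x := (((mm Z t 0 0 * (2 * sin (ang T 0)) + mm Z t 0 1 * (2 * sin (ang T 1))
      + mm Z t 0 2 * (2 * sin (ang T 2))) : ℝ) : ℂ)) (s0 := ((2 * sin (ang T 0) : ℝ) : ℂ))
      (s1 := ((2 * sin (ang T 1) : ℝ) : ℂ)) (s2 := ((2 * sin (ang T 2) : ℝ) : ℂ)) ?_ ?_ ?_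
  · intro y hy
    simp only [Set.mem_insert_iff, Set.mem_singleton_iff] at hy
    rcases hy with rfl | rfl | rfl | rfl | rfl | rfl
    · exact hT' 0
    · exact hT' 1
    · exact hT' 2
    · exact hZ' 0
    · exact hZ' 1
    · exact hZ' 2
  · rw [Complex.ofReal_add, Complex.ofReal_add, Complex.ofReal_mul (mm Z t 0 0 : ℝ), Complex.ofReal_mul (mm Z t 0 1 : ℝ),
      Complex.ofReal_mul (mm Z t 0 2 : ℝ), Complex.ofReal_natCast, Complex.ofReal_natCast, Complex.ofReal_natCast]
    exact Subring.add_mem _ (Subring.add_mem _ (Subring.mul_mem _ (natCast_mem (SN N) _) (hT' 0).1)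
      (Subring.mul_mem _ (natCast_mem (SN N) _) (hT' 1).1)) (Subring.mul_mem _ (natCast_mem (SN N) _) (hT' 2).1)
  · exact_mod_cast key

lemma Til.frob2 (H : Til Z T t) (a1 b1 c1 a2 b2 c2 : ℤ) (h1 : a1 * ang T 0 + b1 * ang T 1 = c1 * π)
    (h2 : a2 * ang T 0 + b2 * ang T 1 = c2 * π) (hD : ¬ 7 ∣ a1 * b2 - a2 * b1) : False := by
  set D := a1 * b2 - a2 * b1 with hDd
  have hs := H.asum
  have e0 : (D : ℝ) * ang T 0 = (b2 * c1 - b1 * c2 : ℤ) * π := by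
    rw [hDd]; push_cast; linear_combination (b2 : ℝ) * h1 - (b1 : ℝ) * h2
  have e1 : (D : ℝ) * ang T 1 = (a1 * c2 - a2 * c1 : ℤ) * π := by
    rw [hDd]; push_cast; linear_combination (-a2 : ℝ) * h1 + (a1 : ℝ) * h2
  have e : ∀ j, ∃ u : ℤ, (D : ℝ) * ang T j = u * π := by
    intro j
    fin_cases j
    · exact ⟨_, e0⟩
    · exact ⟨_, e1⟩
    · refine ⟨D - (b2 * c1 - b1 * c2) - (a1 * c2 - a2 * c1), ?_⟩
      push_cast at e0 e1 ⊢
      have : ang T 2 = π - ang T 0 - ang T 1 := by linarith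
      change (D : ℝ) * ang T 2 = _
      rw [this]; linear_combination -e0 - e1
  refine H.frobN D.natAbs (fun h => hD (Int.natCast_dvd.2 h)) fun j => ?_
  obtain ⟨u, hu⟩ := e j
  rcases Int.natAbs_eq D with h | h
  · refine ⟨u, ?_⟩
    have : ((D.natAbs : ℤ) : ℝ) = (D : ℝ) := by congr 1; omega
    rw [Int.cast_natCast] at this
    rw [this]; linarith
  · refine ⟨-u, ?_⟩
    have : ((D.natAbs : ℤ) : ℝ) = ((-D : ℤ) : ℝ) := by congr 1; omega
    rw [Int.cast_natCast] at this
    rw [this]; push_cast; linarith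

def n3 (p q r : ℤ) : ℤ := p^3 + p^2*q + 5*p^2*r - 2*p*q^2 + p*q*r + 6*p*r^2 - q^3 - q^2*r + 2*q*r^2 + r^3

lemma n3zer : ∀ (n : ℕ) (p q r : ℤ), p.natAbs + q.natAbs + r.natAbs ≤ n → n3 p q r = 0 → p = 0 ∧ q = 0 ∧ r = 0 := by
  intro n
  induction n with
  | zero => intro p q r h _; omega
  | succ n ih =>
    intro p q r h h0
    have hc : ∀ p q r : ZMod 2, p^3 + p^2*q + 5*p^2*r - 2*p*q^2 + p*q*r + 6*p*r^2 - q^3 - q^2*r + 2*q*r^2 + r^3 = 0 →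
      p = 0 ∧ q = 0 ∧ r = 0 := by decide
    have h1 := congrArg (fun z : ℤ => (z : ZMod 2)) h0
    unfold n3 at h1; push_cast at h1
    obtain ⟨a, b, c⟩ := hc _ _ _ h1
    rw [ZMod.intCast_zmod_eq_zero_iff_dvd] at a b c
    obtain ⟨p, rfl⟩ := a
    obtain ⟨q, rfl⟩ := b
    obtain ⟨r, rfl⟩ := c
    have h2 : n3 p q r = 0 := by
      have : 8 * n3 p q r = 0 := by rw [← h0]; unfold n3; push_cast; ring
      omega
    by_cases hz : p = 0 ∧ q = 0 ∧ r = 0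
    · obtain ⟨rfl, rfl, rfl⟩ := hz; simp
    · obtain ⟨rfl, rfl, rfl⟩ := ih p q r (by push_cast at h; omega) h2
      simp

lemma indep3 (x : ℝ) (hx : x^3 - x^2 - 2*x + 1 = 0) (p q r : ℤ) (h : p + q * x + r * x^2 = 0) :
    p = 0 ∧ q = 0 ∧ r = 0 := by
  apply n3zer _ p q r le_rfl
  have : (n3 p q r : ℝ) = 0 := by
    unfold n3; push_cast
    linear_combination ((p^2+p*q+5*p*r-2*q^2-q*r+5*r^2) + (-(p*q+q^2+q*r-r^2)) * x + (q^2+q*r-p*r-2*r^2) * x^2) * h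
      - ((q^2+q*r-p*r-2*r^2)*r * x + (q^2+q*r-p*r-2*r^2)*(q+r) + (-(p*q+q^2+q*r-r^2))*r) * hx
  exact_mod_cast this

def Un (x : ℝ) : Fin 3 → ℝ := ![1, x, x^2 - 1]

lemma hepalg (x : ℝ) (hx : x^3 - x^2 - 2*x + 1 = 0) (m0 m1 m2 : ℤ) (A B C : Fin 3)
    (h : (m0 + m1 * x + m2 * (x^2 - 1))^2 * Un x B * Un x C = 7 * 1 * x * (x^2-1) * Un x A) : False := by
  have fin : ∀ n : ℤ, n ^ 2 = 343 ∨ n ^ 2 = -343 → False := by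
    rintro n (h | h)
    · have h1 : n < 19 := by nlinarith
      have h2 : -19 < n := by nlinarith
      interval_cases n <;> omega
    · nlinarith
  have fin' : ∀ p q r u v w : ℤ, (p + q * x + r * x^2 : ℝ)^2 = 7 * (u + v * x + w * x^2) →
      (n3 u v w = 1 ∨ n3 u v w = -1) → False := by
    intro p q r u v w h hn
    have h3 := indep3 x hx (p^2 - 2*q*r - r^2 - 7*u) (2*p*q + 4*q*r + r^2 - 7*v) (q^2+2*p*r+2*q*r+3*r^2-7*w) (by
      push_cast
      linear_combination h - (2*q*r + r^2 + r^2 * x) * hx)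
    have hN : n3 (p^2 - 2*q*r - r^2) (2*p*q + 4*q*r + r^2) (q^2+2*p*r+2*q*r+3*r^2) = (n3 p q r)^2 := by
      unfold n3; ring
    have hM : n3 (7*u) (7*v) (7*w) = 343 * n3 u v w := by unfold n3; ring
    rw [show p^2 - 2*q*r - r^2 = 7*u by linarith, show 2*p*q + 4*q*r + r^2 = 7*v by linarith,
      show q^2+2*p*r+2*q*r+3*r^2 = 7*w by linarith, hM] at hN
    rcases hn with hn | hn <;> rw [hn] at hN
    · exact fin _ (Or.inl hN.symm)
    · exact fin _ (Or.inr hN.symm)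
  let G : ℝ → Prop := fun y => ∃ u v w : ℤ, y = u + v * x + w * x^2 ∧ (n3 u v w = 1 ∨ n3 u v w = -1)
  have gm : ∀ y z, G y → G z → G (y * z) := by
    rintro y z ⟨u, v, w, rfl, h1⟩ ⟨u', v', w', rfl, h2⟩
    refine ⟨u*u' - (v*w'+w*v') - w*w', u*v'+v*u' + 2*(v*w'+w*v') + w*w', u*w'+v*v'+w*u' + (v*w'+w*v') + 3*(w*w'), ?_, ?_⟩
    · push_cast; linear_combination ((v*w'+w*v') + w*w' + w*w' * x) * hx
    · have : n3 (u*u' - (v*w'+w*v') - w*w') (u*v'+v*u' + 2*(v*w'+w*v') + w*w') (u*w'+v*v'+w*u' + (v*w'+w*v') + 3*(w*w'))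
        = n3 u v w * n3 u' v' w' := by unfold n3; ring
      rw [this]
      rcases h1 with h1 | h1 <;> rcases h2 with h2 | h2 <;> rw [h1, h2] <;> norm_num
  have gx : G x := ⟨0, 1, 0, by simp, by norm_num [n3]⟩
  have gi : G (-x^2 + x + 2) := ⟨2, 1, -1, by push_cast; ring, by norm_num [n3]⟩
  have g1 : G (x - 1) := ⟨-1, 1, 0, by push_cast; ring, by norm_num [n3]⟩
  have hi : x * (-x^2 + x + 2) = 1 := by linear_combination -hx
  have gU : ∀ A, G (Un x A) := by
    intro A; fin_cases A
    · exact ⟨1, 0, 0, by simp [Un], by norm_num [n3]⟩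
    · exact gx
    · exact ⟨-1, 0, 1, by simp [Un]; ring, by norm_num [n3]⟩
  have gI : ∀ A, ∃ y, G y ∧ Un x A * y = 1 := by
    intro A; fin_cases A
    · exact ⟨1, ⟨1, 0, 0, by simp, by norm_num [n3]⟩, by simp [Un]⟩
    · exact ⟨_, gi, hi⟩
    · refine ⟨_, gm _ _ g1 gi, ?_⟩
      show (x^2 - 1) * _ = _
      linear_combination hi + (-x^2+x+2) * hx
  obtain ⟨y, gy, hy⟩ := gI B
  obtain ⟨z, gz, hz⟩ := gI C
  have h2 : (m0 + m1 * x + m2 * (x^2 - 1))^2 = 7 * (x * Un x 2 * Un x A * y * z) := by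
    have e : Un x 2 = x^2 - 1 := rfl
    rw [e]
    calc (m0 + m1 * x + m2 * (x^2 - 1))^2 = (m0 + m1 * x + m2 * (x^2 - 1))^2 * (Un x B * y) * (Un x C * z) := by rw [hy, hz]; ring
      _ = _ := by linear_combination y * z * h
  obtain ⟨u, v, w, e, hn⟩ := gm _ _ (gm _ _ (gm _ _ (gm _ _ gx (gU 2)) (gU A)) gy) gz
  refine fin' (m0 - m2) m1 m2 u v w ?_ hn
  rw [← e, ← h2]; push_cast; ring

lemma Til.hept (H : Til Z T t) (h0 : 7 * ang T 0 = π) (h1 : ang T 1 = 2 * ang T 0) : False := by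
  set θ := ang T 0 with hθ
  have h2 : ang T 2 = 4 * θ := by have := H.asum; linarith
  set x := 2 * cos θ with hx
  have hs := H.spos 0
  rw [← hθ] at hs
  have s2 : sin (2 * θ) = sin θ * x := by rw [sin_two_mul, hx]; ring
  have s3 : sin (3 * θ) = sin θ * (x^2 - 1) := by
    rw [sin_three_mul, hx]
    have := sin_sq_add_cos_sq θ
    linear_combination (-4 * sin θ) * this
  have s4 : sin (4 * θ) = sin (3 * θ) := by rw [← sin_pi_sub, ← h0]; ring_nf
  have s5 : sin (5 * θ) = sin (2 * θ) := by rw [← sin_pi_sub, ← h0]; ring_nf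
  have s6 : sin (6 * θ) = sin θ := by rw [← sin_pi_sub, ← h0]; ring_nf
  have hx3 : x^3 - x^2 - 2*x + 1 = 0 := by
    have : sin (4 * θ) = sin θ * (x^3 - 2*x) := by
      rw [show 4 * θ = 2 * (2 * θ) by ring, sin_two_mul, s2, cos_two_mul, hx]; ring
    rw [s4, s3] at this
    have := mlc hs.ne' this
    linarith
  have hZ : ∀ K, ∃ A, sin (ang Z K) = sin θ * Un x A := by
    intro K
    have h := (H.corner K).1
    unfold NA at h; rw [h1, h2, ← hθ] at h
    obtain ⟨n, hn⟩ : ∃ n : ℕ, ang Z K = n * θ := ⟨NN t (Z K) 0 + 2 * NN t (Z K) 1 + 4 * NN t (Z K) 2, by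
      rw [← h]; push_cast; ring⟩
    have hp := angpos Z H.hZ K
    have hl := anglt Z H.hZ K
    have hth : 0 < θ := H.apos 0
    rw [hn] at hp hl
    have n7 : n < 7 := by
      rw [← h0] at hl
      have := lt_of_mul_lt_mul_right hl hth.le
      exact_mod_cast this
    have n0 : 0 < n := by
      rcases Nat.eq_zero_or_pos n with h | h
      · rw [h] at hp; simp at hp
      · exact h
    rw [hn]
    interval_cases n
    · exact ⟨0, by simp [Un]⟩
    · exact ⟨1, by push_cast; rw [s2]; rfl⟩
    · exact ⟨2, by push_cast; rw [s3]; rfl⟩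
    · exact ⟨2, by push_cast; rw [s4, s3]; rfl⟩
    · exact ⟨1, by push_cast; rw [s5, s2]; rfl⟩
    · exact ⟨0, by push_cast; rw [s6]; simp [Un]⟩
  obtain ⟨A, hA⟩ := hZ 0
  obtain ⟨B, hB⟩ := hZ 1
  obtain ⟨C, hC⟩ := hZ 2
  have key := H.key
  rw [hA, hB, hC, h1, h2, ← hθ, s4, s2, s3] at key
  apply hepalg x hx3 (mm Z t 0 0) (mm Z t 0 1) (mm Z t 0 2) A B C
  have : (16 * sin θ ^ 4) ≠ 0 := by positivity
  apply mlc this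
  push_cast
  linear_combination key

lemma cosdif (t : CTri) (h : DD t ≠ 0) (k : Fin 3) :
    2 * L t k * L t (k+1) * L t (k+2) * (cos (ang t k) - cos (ang t (k+1)))
      = (L t (k+1) - L t k) * ((L t k + L t (k+1)) ^ 2 - L t (k+2) ^ 2) := by
  have h1 := lawcos t k
  have h2 := lawcos t (k+1)
  have e1 : k + 1 + 1 = k + 2 := by clear * -; decide +revert
  have e2 : k + 1 + 2 = k := by clear * -; decide +revert
  rw [e1, e2] at h2
  linear_combination (L t k) * h1 - (L t (k+1)) * h2

lemma triine (t : CTri) (h : DD t ≠ 0) (k : Fin 3) : L t k < L t (k+1) + L t (k+2) := by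
  have h1 := lawcos t k
  have p0 := lpos t h k
  have p1 := lpos t h (k+1)
  have p2 := lpos t h (k+2)
  have hs := sinangpos t h k
  have hc : -1 < cos (ang t k) := by
    have := sin_sq_add_cos_sq (ang t k)
    nlinarith
  apply lt_of_pow_lt_pow_left₀ 2 (by positivity)
  rw [h1]
  nlinarith [mul_pos p1 p2]

lemma angltiff (t : CTri) (h : DD t ≠ 0) (k : Fin 3) : ang t k < ang t (k+1) ↔ L t k < L t (k+1) := by
  have h1 := cosdif t h k
  have p0 := lpos t h k
  have p1 := lpos t h (k+1)
  have p2 := lpos t h (k+2)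
  have h3 := triine t h (k+2)
  have e1 : k + 2 + 1 = k := by clear * -; decide +revert
  have e2 : k + 2 + 2 = k + 1 := by clear * -; decide +revert
  rw [e1, e2] at h3
  have hp : 0 < (L t k + L t (k+1)) ^ 2 - L t (k+2) ^ 2 := by nlinarith
  have hq : 0 < 2 * L t k * L t (k+1) * L t (k+2) := by positivity
  have hcc : ang t k < ang t (k+1) ↔ cos (ang t (k+1)) < cos (ang t k) :=
    (strictAntiOn_cos.lt_iff_gt ⟨(angpos t h _).le, (anglt t h _).le⟩ ⟨(angpos t h _).le, (anglt t h _).le⟩).symm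
  rw [hcc]
  constructor
  · intro hh
    have : 0 < (L t (k+1) - L t k) * ((L t k + L t (k+1)) ^ 2 - L t (k+2) ^ 2) := by
      rw [← h1]; exact mul_pos hq (by linarith)
    have := (mul_pos_iff_of_pos_right hp).1 this
    linarith
  · intro hh
    have : 0 < 2 * L t k * L t (k+1) * L t (k+2) * (cos (ang t k) - cos (ang t (k+1))) := by
      rw [h1]; exact mul_pos (by linarith) hp
    have := (mul_pos_iff_of_pos_left hq).1 this
    linarith

lemma angeqof (t : CTri) (h : DD t ≠ 0) (k : Fin 3) (hl : L t k = L t (k+1)) : ang t k = ang t (k+1) := by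
  have h1 := cosdif t h k
  have p0 := lpos t h k
  have p1 := lpos t h (k+1)
  have p2 := lpos t h (k+2)
  rw [hl, sub_self, zero_mul] at h1
  have : cos (ang t k) - cos (ang t (k+1)) = 0 := by
    rcases mul_eq_zero.1 h1 with h | h
    · exfalso
      have : 0 < 2 * L t (k+1) * L t (k+1) * L t (k+2) := by positivity
      linarith
    · exact h
  exact injOn_cos ⟨(angpos t h _).le, (anglt t h _).le⟩ ⟨(angpos t h _).le, (anglt t h _).le⟩ (by linarith)

lemma Til.frobG (H : Til Z T t) (D A B : ℤ) (h0 : D * ang T 0 = A * π) (h1 : D * ang T 1 = B * π)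
    (h7 : ¬ (7 : ℤ) ∣ D / (Int.gcd D (Int.gcd A B) : ℤ)) : False := by
  set g : ℤ := (Int.gcd D (Int.gcd A B) : ℤ) with hg
  have hgD : g ∣ D := Int.gcd_dvd_left ..
  have hg2 : g ∣ (Int.gcd A B : ℤ) := Int.gcd_dvd_right ..
  have hgA : g ∣ A := hg2.trans (Int.gcd_dvd_left ..)
  have hgB : g ∣ B := hg2.trans (Int.gcd_dvd_right ..)
  have hg0 : g ≠ 0 := by
    intro h; rw [h] at h7; simp at h7
  clear_value g
  obtain ⟨D, rfl⟩ := hgD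
  obtain ⟨A, rfl⟩ := hgA
  obtain ⟨B, rfl⟩ := hgB
  rw [Int.mul_ediv_cancel_left _ hg0] at h7
  have hgr : (g : ℝ) ≠ 0 := by exact_mod_cast hg0
  have e0 : D * ang T 0 = A * π := by
    apply mlc hgr; push_cast at h0; linarith
  have e1 : D * ang T 1 = B * π := by
    apply mlc hgr; push_cast at h1; linarith
  refine H.frob2 D 0 A 0 D B (by push_cast; linarith) (by push_cast; linarith) ?_
  intro h
  have : (7 : ℤ) ∣ D * D := by simpa using h
  rcases (Int.prime_iff_natAbs_prime.2 (by norm_num : Nat.Prime (7 : ℤ).natAbs)).dvd_or_dvd this with h | h <;> exact h7 h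

lemma Til.le1 (H : Til Z T t) (j : Fin 3) {p : ℂ} (hp : p ∈ WW Z t) : PP Z t j + NN t p j ≤ 7 := by
  rw [← H.tot j]
  have := Finset.single_le_sum (f := fun p => NN t p j) (fun _ _ => Nat.zero_le _) hp
  omega

lemma Til.le2 (H : Til Z T t) (j : Fin 3) {p q : ℂ} (hp : p ∈ WW Z t) (hq : q ∈ WW Z t) (hpq : p ≠ q) :
    PP Z t j + NN t p j + NN t q j ≤ 7 := by
  classical
  rw [← H.tot j]
  have := Finset.sum_le_sum_of_subset (f := fun p => NN t p j) (s := {p, q}) (t := WW Z t)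
    (by intro x hx; simp at hx; rcases hx with rfl | rfl <;> assumption)
  rw [Finset.sum_pair hpq] at this; omega

lemma Til.pig (H : Til Z T t) (j : Fin 3) (hj : PP Z t j = 0) : ∃ p ∈ WW Z t, uu Z t p < NN t p j := by
  apply Finset.exists_lt_of_sum_lt
  have h1 := H.tot j
  have h2 := H.sumu
  omega

lemma Til.vrel (H : Til Z T t) {p : ℂ} (hp : p ∈ WW Z t) :
    NN t p 0 * ang T 0 + NN t p 1 * ang T 1 + NN t p 2 * ang T 2 = uu Z t p * π := (H.nonc p hp).1

lemma Til.ucase (H : Til Z T t) {p : ℂ} (hp : p ∈ WW Z t) : uu Z t p = 1 ∨ uu Z t p = 2 := (H.nonc p hp).2.1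

lemma Til.cpos (H : Til Z T t) (K : Fin 3) : 1 ≤ NN t (Z K) 0 + NN t (Z K) 1 + NN t (Z K) 2 := by
  by_contra hc
  have h := (H.corner K).1
  have h2 := angpos Z H.hZ K
  unfold NA at h
  have e0 : NN t (Z K) 0 = 0 := by omega
  have e1 : NN t (Z K) 1 = 0 := by omega
  have e2 : NN t (Z K) 2 = 0 := by omega
  rw [e0, e1, e2] at h; simp at h; linarith

lemma irr7 (x y : ℤ) (h : (x : ℝ) = y * √7) : x = 0 ∧ y = 0 := by
  have hy : y = 0 := by
    by_contra hy
    have : Irrational (√7) := by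
      have := Nat.Prime.irrational_sqrt (p := 7) (by norm_num)
      exact_mod_cast this
    apply this
    refine ⟨(x : ℚ) / y, ?_⟩
    have : (y : ℝ) ≠ 0 := by exact_mod_cast hy
    push_cast
    rw [h]; field_simp
  refine ⟨?_, hy⟩
  rw [hy] at h; simpa using h

lemma Til.sim (H : Til Z T t) (h : ∀ k, ang Z k = ang T k) (k : Fin 3) : L Z k = √7 * L T k := by
  have hz := lawsin Z H.hZ k
  have ht := lawsin T H.hT k
  have ha := H.area
  rw [laware Z k, laware T k, h] at ha
  have z1 := hz (k+1)
  have z2 := hz (k+2)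
  have t1 := ht (k+1)
  have t2 := ht (k+2)
  rw [h, h] at z1 z2
  have s0 := H.spos k
  have s1 := H.spos (k+1)
  have s2 := H.spos (k+2)
  have p := H.lp k
  have P := lpos Z H.hZ k
  have : L Z k ^ 2 = 7 * L T k ^ 2 := by
    have : (sin (ang T (k+1)) * sin (ang T (k+2))) * L Z k ^ 2 = (sin (ang T (k+1)) * sin (ang T (k+2))) * (7 * L T k ^ 2) := by
      calc _ = (L Z k * sin (ang T (k+1))) * (L Z k * sin (ang T (k+2))) := by ring
        _ = sin (ang T k) * (L Z (k+1) * L Z (k+2) * sin (ang T k)) := by rw [z1, z2]; ring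
        _ = 7 * (L T (k+1) * sin (ang T k)) * (L T (k+2) * sin (ang T k)) := by rw [ha]; ring
        _ = _ := by rw [← t1, ← t2]; ring
    exact mlc (by positivity) this
  have h7 := Real.sq_sqrt (show (0:ℝ) ≤ 7 by norm_num)
  have : (L Z k - √7 * L T k) * (L Z k + √7 * L T k) = 0 := by linear_combination this - L T k ^ 2 * h7
  rcases mul_eq_zero.1 this with h | h
  · linarith
  · have : 0 < L Z k + √7 * L T k := by positivity
    linarith

lemma sim2 (a c : ℝ) (ha : 0 < a) (hc : 0 < c) (p r p' r' : ℕ) (h1 : p * a + r * c = √7 * a)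
    (h2 : p' * a + r' * c = √7 * c) : p = 0 := by
  have h7 := Real.sq_sqrt (show (0:ℝ) ≤ 7 by norm_num)
  have h : (a * c) * ((p - √7) * (r' - √7)) = (a * c) * (r * p') := by
    have e1 : (p - √7) * a = - (r * c) := by linarith
    have e2 : (r' - √7) * c = - (p' * a) := by linarith
    calc _ = ((p - √7) * a) * ((r' - √7) * c) := by ring
      _ = _ := by rw [e1, e2]; ring
  have h' := mlc (by positivity) h
  have := irr7 (p * r' + 7 - r * p') (p + r') (by push_cast; linear_combination h' - h7)
  omega

lemma Til.iso0 (H : Til Z T t) (h : L T 0 = L T 1) (h2 : NN t (Z 2) 2 = 1)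
    (h20 : NN t (Z 2) 0 + NN t (Z 2) 1 = 0) (h0 : NN t (Z 0) 2 = 0) (h1 : NN t (Z 1) 2 = 0)
    (h01 : NN t (Z 0) 0 + NN t (Z 0) 1 = 1) (h11 : NN t (Z 1) 0 + NN t (Z 1) 1 = 1) : False := by
  have hδ := angeqof T H.hT 0 h
  rw [zero_add] at hδ
  have c0 := (H.corner 0).1
  have c1 := (H.corner 1).1
  have c2 := (H.corner 2).1
  have hs : ∀ k, ang Z k = ang T k := by
    intro k
    fin_cases k
    · show ang Z 0 = ang T 0
      unfold NA at c0; rw [h0, ← hδ] at c0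
      have : (NN t (Z 0) 0 : ℝ) + NN t (Z 0) 1 = 1 := by exact_mod_cast h01
      rw [← c0]; push_cast; linear_combination ang T 0 * this
    · show ang Z 1 = ang T 1
      unfold NA at c1; rw [h1, hδ] at c1
      have : (NN t (Z 1) 0 : ℝ) + NN t (Z 1) 1 = 1 := by exact_mod_cast h11
      rw [← c1]; push_cast; linear_combination ang T 1 * this
    · show ang Z 2 = ang T 2
      unfold NA at c2; rw [h2] at c2
      have e1 : NN t (Z 2) 0 = 0 := by omega
      have e2 : NN t (Z 2) 1 = 0 := by omega
      rw [e1, e2] at c2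
      rw [← c2]; push_cast; ring
  have e0 := H.sim hs 0
  have e2 := H.sim hs 2
  rw [H.sidlen, ← h] at e0 e2
  have p0 := H.lp 0
  have p2 := H.lp 2
  have hm := sim2 (L T 0) (L T 2) p0 p2 (mm Z t 0 0 + mm Z t 0 1) (mm Z t 0 2) (mm Z t 2 0 + mm Z t 2 1) (mm Z t 2 2)
    (by push_cast; linarith) (by push_cast; linarith)
  obtain ⟨f, g, hfg, -, hS⟩ := H.ends
  have hsing : Single Z t 2 2 := by
    refine ⟨h2, fun j hj => ?_⟩
    fin_cases j
    · show NN t (Z 2) 0 = 0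
      omega
    · show NN t (Z 2) 1 = 0
      omega
    · exact absurd rfl hj
  have := (hS 2 2 hsing).1
  have e : (2 : Fin 3) + 1 = 0 := rfl
  rw [e] at this
  have hg := (hfg 0).2
  generalize g 0 = j at *
  fin_cases j
  · have : 1 ≤ mm Z t 0 0 := hg
    omega
  · have : 1 ≤ mm Z t 0 1 := hg
    omega
  · exact absurd rfl this

lemma Til.iso (H : Til Z T t) (h : L T 0 = L T 1) : False := by
  have hδ := angeqof T H.hT 0 h
  rw [zero_add] at hδ
  have hpi := pi_pos
  have hs := H.asum
  have hP := H.Peq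
  have t0 := H.tot 0
  have t1 := H.tot 1
  have t2 := H.tot 2
  have c0 := H.cpos 0
  have c1 := H.cpos 1
  have c2 := H.cpos 2
  have pd := H.apos 0
  have pe := H.apos 2
  set δ := ang T 0 with hδ0
  set ε := ang T 2
  rw [← hδ] at hs hP
  have he : ε = π - 2 * δ := by linarith
  by_cases hc : PP Z t 0 + PP Z t 1 = 2 ∧ PP Z t 2 = 1
  · obtain ⟨K, hK⟩ : ∃ K, NN t (Z K) 2 = 1 := by
      unfold PP at hc
      by_contra hcon; push Not at hcon
      have := hcon 0; have := hcon 1; have := hcon 2; omega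
    refine (H.permZ (Equiv.addRight (K + 1))).iso0 h ?_ ?_ ?_ ?_ ?_ ?_
    all_goals
      simp only [Function.comp, Equiv.coe_addRight]
      unfold PP at hc
      fin_cases K
      all_goals
        first
        | (show NN t (Z 0) _ = 1; exact hK) | (show NN t (Z 1) _ = 1; exact hK) | (show NN t (Z 2) _ = 1; exact hK)
        | (simp at hK ⊢; omega)
        | (change NN t (Z 0) _ = 0; simp at hK; omega)
  · have hD : ((PP Z t 0 + PP Z t 1 : ℤ) - 2 * PP Z t 2 : ℤ) * δ = (1 - PP Z t 2 : ℤ) * π := by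
      push_cast; rw [he] at hP; linarith
    have hr : PP Z t 0 ≤ 7 ∧ PP Z t 1 ≤ 7 ∧ PP Z t 2 ≤ 7 := by omega
    have h3 : 3 ≤ PP Z t 0 + PP Z t 1 + PP Z t 2 := by unfold PP; omega
    have hfr : (7 : ℤ) ∣ ((PP Z t 0 + PP Z t 1 : ℤ) - 2 * PP Z t 2) := by
      by_contra h7
      refine H.frob2 ((PP Z t 0 + PP Z t 1 : ℤ) - 2 * PP Z t 2) 0 (1 - PP Z t 2) 1 (-1) 0 (by push_cast at hD ⊢; linarith) (by push_cast; linarith) ?_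
      intro hd; apply h7; rw [← Int.dvd_neg]; convert hd using 1; ring
    have hpig2 : PP Z t 2 = 0 → 2 * π < 3 * ε → False := by
      intro h0 he
      obtain ⟨p, hp, hlt⟩ := H.pig 2 h0
      have hv := H.vrel hp
      rw [← hδ] at hv
      have : (uu Z t p + 1 : ℝ) ≤ NN t p 2 := by exact_mod_cast hlt
      have n0 : (0:ℝ) ≤ NN t p 0 := by positivity
      have n1 : (0:ℝ) ≤ NN t p 1 := by positivity
      have := mler this pe.le
      have := mul_nonneg n0 pd.le
      have := mul_nonneg n1 pd.le
      rcases H.ucase hp with hu | hu <;> simp only [hu] at * <;> push_cast at * <;> linarith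
    have hpig0 : PP Z t 0 + PP Z t 1 ≤ 1 → 2 * π < 5 * δ → False := by
      intro h0 he
      obtain ⟨p, hp, hlt⟩ : ∃ p ∈ WW Z t, 2 * uu Z t p < NN t p 0 + NN t p 1 := by
        apply Finset.exists_lt_of_sum_lt
        rw [← Finset.mul_sum, sum_add_distrib, H.sumu]
        omega
      have hv := H.vrel hp
      rw [← hδ] at hv
      have : (2 * uu Z t p + 1 : ℝ) ≤ NN t p 0 + NN t p 1 := by exact_mod_cast hlt
      have n0 : (0:ℝ) ≤ NN t p 2 := by positivity
      have := mler this pd.le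
      have := mul_nonneg n0 pe.le
      rcases H.ucase hp with hu | hu <;> simp only [hu] at * <;> push_cast at * <;> linarith
    obtain ⟨x, hx⟩ : ∃ x, x = PP Z t 0 + PP Z t 1 := ⟨_, rfl⟩
    have hxr : (x : ℝ) = PP Z t 0 + PP Z t 1 := by exact_mod_cast hx
    rw [← hx] at hc hpig0 h3
    have hx' : (x : ℤ) = PP Z t 0 + PP Z t 1 := by exact_mod_cast hx
    rw [← hx'] at hD hfr
    have hx14 : x ≤ 14 := by omega
    have hy7 := hr.2.2
    generalize PP Z t 2 = y at *
    clear hP hx' hxr hx hr t0 t1 t2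
    obtain ⟨k, hk⟩ := hfr
    rw [hk] at hD
    have k1 : k ≤ 2 := by omega
    have k2 : -2 ≤ k := by omega
    have hxy : (x : ℤ) = 7 * k + 2 * y := by omega
    have : δ * 2 < π := by linarith
    have hy0 : y = 0 ∨ 1 ≤ (y : ℝ) := by
      rcases Nat.eq_zero_or_pos y with h | h
      · exact Or.inl h
      · right; exact_mod_cast h
    interval_cases k
    · obtain rfl : y = 7 := by omega
      obtain rfl : x = 0 := by omega
      norm_num at hD
      exact hpig0 (by norm_num) (by linarith)
    · have : y ≤ 4 := by
        by_contra hc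
        have : (5 : ℝ) ≤ y := by exact_mod_cast (by omega : 5 ≤ y)
        have := mler this hpi.le
        push_cast at hD; linarith
      obtain rfl : y = 4 := by omega
      obtain rfl : x = 1 := by omega
      norm_num at hD
      exact hpig0 (by norm_num) (by linarith)
    · have : (1 : ℝ) - y = 0 := by
        push_cast at hD
        have : (1 - (y : ℝ)) * π = 0 := by linarith
        exact (mul_eq_zero.1 this).resolve_right hpi.ne'
      have : y = 1 := by
        have : (y : ℝ) = 1 := by linarith
        exact_mod_cast this
      omega
    · rcases hy0 with h | h
      · subst h; norm_num at hD; exact hpig2 rfl (by linarith)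
      · have := mler h hpi.le
        push_cast at hD; linarith
    · rcases hy0 with h | h
      · subst h; norm_num at hD; exact hpig2 rfl (by linarith)
      · have := mler h hpi.le
        push_cast at hD; linarith

def allN (n : ℕ) (f : ℕ → Bool) : Bool := (List.range n).all f
lemma alliff (n : ℕ) (f : ℕ → Bool) : allN n f = true ↔ ∀ x < n, f x = true := by
  simp [allN]

lemma simdec0 : (allN 3 fun x0 => allN (3 - x0) fun x1 => allN (3 - x0 - x1) fun x2 => allN 10 fun y0 =>
    allN (10 - y0) fun y1 => allN (10 - y0 - y1) fun y2 => allN (10 - y0 - y1 - y2 - x0 - x1 - x2) fun z0 =>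
    allN (10 - y0 - y1 - y2 - x0 - x1 - x2 - z0) fun z1 => allN (10 - y0 - y1 - y2 - x0 - x1 - x2 - z0 - z1) fun z2 =>
    decide (x0 * y1 + x0 * z2 + y1 * z2 + 7 = x1 * y0 + x2 * z0 + y2 * z1 →
    x0 * y1 * z2 + x1 * y2 * z0 + x2 * y0 * z1 + 7 * (x0 + y1 + z2) = x0 * y2 * z1 + x1 * y0 * z2 + x2 * y1 * z0 →
    0 < y1 + y2 → 0 < x0 + x2 → 0 < z1 + z2 → 0 < z0 + z2 → x0 = 0 ∧ x1 = 0 ∧ y0 = 0 ∧ y1 = 0)) = true := by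
  decide +kernel

lemma simdec (x0 x1 x2 y0 y1 y2 z0 z1 z2 : ℕ) (hx : x0 + x1 + x2 < 3)
    (hn : x0 + x1 + x2 + (y0 + y1 + y2) + (z0 + z1 + z2) ≤ 9)
    (h1 : x0 * y1 + x0 * z2 + y1 * z2 + 7 = x1 * y0 + x2 * z0 + y2 * z1)
    (h2 : x0 * y1 * z2 + x1 * y2 * z0 + x2 * y0 * z1 + 7 * (x0 + y1 + z2) = x0 * y2 * z1 + x1 * y0 * z2 + x2 * y1 * z0)
    (h3 : 0 < y1 + y2) (h4 : 0 < x0 + x2) (h5 : 0 < z1 + z2) (h6 : 0 < z0 + z2) : x0 = 0 ∧ x1 = 0 ∧ y0 = 0 ∧ y1 = 0 := by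
  have := simdec0
  simp only [alliff, decide_eq_true_iff] at this
  exact this x0 (by omega) x1 (by omega) x2 (by omega) y0 (by omega) y1 (by omega) y2 (by omega) z0 (by omega)
    z1 (by omega) z2 (by omega) h1 h2 h3 h4 h5 h6

open Classical in
lemma Til.count (H : Til Z T t) : ∃ h f T1 : ℕ, h + 2 * f = 6 ∧
    (SE Z t 0).card + (SE Z t 1).card + (SE Z t 2).card + T1 ≤ 3 + h ∧
    h = ((WW Z t).filter fun p => uu Z t p = 1).card ∧ f = ((WW Z t).filter fun p => uu Z t p = 2).card ∧
    T1 = ((WW Z t).filter fun p => inT Z p ∧ uu Z t p = 1).card := by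
  refine ⟨_, _, _, ?_, ?_, rfl, rfl, rfl⟩
  · rw [← H.sumu, card_filter, card_filter, Finset.mul_sum, ← sum_add_distrib]
    refine sum_congr rfl fun p hp => ?_
    rcases H.ucase hp with h | h <;> simp [h]
  · have h1 := H.edgcou
    have h2 : ((WW Z t).filter fun p => ¬ inT Z p).card + ((WW Z t).filter fun p => inT Z p ∧ uu Z t p = 1).card
        ≤ ((WW Z t).filter fun p => uu Z t p = 1).card := by
      rw [card_filter, card_filter, card_filter, ← sum_add_distrib]
      refine Finset.sum_le_sum fun p hp => ?_
      by_cases hi : inT Z p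
      · simp [hi]
      · have : uu Z t p = 1 := by simp [uu, hi]
        simp [hi, this]
    have h1' : (SE Z t 0).card + (SE Z t 1).card + (SE Z t 2).card
      ≤ ((WW Z t).filter fun p => ¬ inT Z p).card + 3 := by convert h1
    omega

lemma Til.simX (H : Til Z T t) (h01 : L T 0 < L T 1) (h12 : L T 1 < L T 2) (hs : ∀ k, ang Z k = ang T k)
    (h3 : 0 < mm Z t 1 1 + mm Z t 1 2) (h4 : 0 < mm Z t 0 0 + mm Z t 0 2) (h5 : 0 < mm Z t 2 1 + mm Z t 2 2)
    (h6 : 0 < mm Z t 2 0 + mm Z t 2 2) : mm Z t 0 0 = 0 ∧ mm Z t 0 1 = 0 ∧ mm Z t 1 0 = 0 ∧ mm Z t 1 1 = 0 := by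
  have h7 := Real.sq_sqrt (show (0:ℝ) ≤ 7 by norm_num)
  have hn : (SE Z t 0).card + (SE Z t 1).card + (SE Z t 2).card ≤ 9 := by
    obtain ⟨h, f, T1, e1, e2, -⟩ := H.count
    omega
  rw [carse, carse, carse] at hn
  have e0 := H.sim hs 0
  have e1 := H.sim hs 1
  have e2 := H.sim hs 2
  rw [H.sidlen] at e0 e1 e2
  have p0 := H.lp 0
  set a := L T 0
  set b := L T 1
  set c := L T 2
  generalize mm Z t 0 0 = x0 at *
  generalize mm Z t 0 1 = x1 at *
  generalize mm Z t 0 2 = x2 at *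
  generalize mm Z t 1 0 = y0 at *
  generalize mm Z t 1 1 = y1 at *
  generalize mm Z t 1 2 = y2 at *
  generalize mm Z t 2 0 = z0 at *
  generalize mm Z t 2 1 = z1 at *
  generalize mm Z t 2 2 = z2 at *
  clear_value a b c
  set s := √7
  have s0 : 0 ≤ s := Real.sqrt_nonneg _
  have hx : x0 + x1 + x2 < 3 := by
    have hs3 : s < 3 := by nlinarith
    have : ((x0 + x1 + x2 : ℕ) : ℝ) * a < 3 * a := by
      push_cast
      have : (x1 : ℝ) * a ≤ x1 * b := by gcongr
      have : (x2 : ℝ) * a ≤ x2 * c := by gcongr; linarith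
      have : s * a < 3 * a := by gcongr
      linarith
    have := lt_of_mul_lt_mul_right this p0.le
    exact_mod_cast this
  have hdet : a * ((x0 - s) * ((y1 - s) * (z2 - s) - y2 * z1) - x1 * (y0 * (z2 - s) - y2 * z0) + x2 * (y0 * z1 - (y1 - s) * z0)) = 0 := by
    linear_combination ((y1 - s) * (z2 - s) - y2 * z1) * e0 - (x1 * (z2 - s) - x2 * z1) * e1 + (x1 * y2 - x2 * (y1 - s)) * e2
  have hdet' := (mul_eq_zero.1 hdet).resolve_left p0.ne'
  have := irr7 (x0 * y1 * z2 + x1 * y2 * z0 + x2 * y0 * z1 + 7 * (x0 + y1 + z2) - (x0 * y2 * z1 + x1 * y0 * z2 + x2 * y1 * z0))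
    (x0 * y1 + x0 * z2 + y1 * z2 + 7 - (x1 * y0 + x2 * z0 + y2 * z1)) (by
      push_cast
      linear_combination hdet' + (s - x0 - y1 - z2) * h7)
  refine simdec x0 x1 x2 y0 y1 y2 z0 z1 z2 hx hn ?_ ?_ h3 h4 h5 h6
  · zify; linarith [this.2]
  · zify; linarith [this.1]

lemma Til.has (H : Til Z T t) (M j : Fin 3) (h : Single Z t M j) :
    0 < mm Z t (M+1) (j+1) + mm Z t (M+1) (j+2) ∧ 0 < mm Z t (M+2) (j+1) + mm Z t (M+2) (j+2) := by
  obtain ⟨f, g, hfg, -, hS⟩ := H.ends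
  obtain ⟨h1, h2, -⟩ := hS M j h
  have key : ∀ i : Fin 3, i ≠ j → i = j + 1 ∨ i = j + 2 := by clear * -; decide +revert
  have a := (hfg (M+1)).2
  have b := (hfg (M+2)).1
  constructor
  · rcases key _ h1 with h | h <;> rw [h] at a <;> omega
  · rcases key _ h2 with h | h <;> rw [h] at b <;> omega

lemma sinang (H : Til Z T t) {M j : Fin 3} (h : Single Z t M j) : ang Z M = ang T j := by
  rw [← (H.corner M).1]
  unfold NA
  have h1 := h.1
  have h2 := h.2
  fin_cases j
  · have a : NN t (Z M) 0 = 1 := h1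
    have b : NN t (Z M) 1 = 0 := h2 1 (by decide)
    have c : NN t (Z M) 2 = 0 := h2 2 (by decide)
    rw [a, b, c]; simp
  · have a : NN t (Z M) 1 = 1 := h1
    have b : NN t (Z M) 0 = 0 := h2 0 (by decide)
    have c : NN t (Z M) 2 = 0 := h2 2 (by decide)
    rw [a, b, c]; simp
  · have a : NN t (Z M) 2 = 1 := h1
    have b : NN t (Z M) 0 = 0 := h2 0 (by decide)
    have c : NN t (Z M) 1 = 0 := h2 1 (by decide)
    rw [a, b, c]; simp

lemma Til.S0 (H : Til Z T t) (h01 : L T 0 < L T 1) (h12 : L T 1 < L T 2) (hs : ∀ k, Single Z t k k) : False := by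
  have a := H.has 0 0 (hs 0)
  have b := H.has 1 1 (hs 1)
  have c := H.has 2 2 (hs 2)
  simp only [zero_add, e1, e2, e3, e4] at a b c
  have := H.simX h01 h12 (fun k => sinang H (hs k)) (by omega) (by omega) (by omega) (by omega)
  omega

lemma exiper (K : Fin 3 → Fin 3) (hK : Function.Injective K) : ∃ σ : Equiv.Perm (Fin 3), ∀ k, σ k = K k :=
  ⟨Equiv.ofBijective K (Finite.injective_iff_bijective.1 hK), fun _ => rfl⟩

lemma Til.S (H : Til Z T t) (h01 : L T 0 < L T 1) (h12 : L T 1 < L T 2) (h0 : PP Z t 0 = 1)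
    (h1 : PP Z t 1 = 1) (h2 : PP Z t 2 = 1) : False := by
  have c0 := H.cpos 0
  have c1 := H.cpos 1
  have c2 := H.cpos 2
  have hex : ∀ j, ∃ K, Single Z t K j := by
    intro j
    have hj : PP Z t j = 1 := by fin_cases j <;> assumption
    unfold PP at hj h0 h1 h2
    obtain ⟨K, hK⟩ : ∃ K, NN t (Z K) j = 1 := by
      by_contra hc; push Not at hc
      have := hc 0; have := hc 1; have := hc 2; omega
    refine ⟨K, hK, fun j' hj' => ?_⟩
    fin_cases K <;> fin_cases j <;> fin_cases j' <;> simp at hK hj' hj ⊢ <;> omega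
  choose K hK using hex
  have hinj : Function.Injective K := by
    intro i j hij
    by_contra hne
    have a := (hK i).1
    have b := (hK j).2 i hne
    rw [← hij] at b; omega
  obtain ⟨σ, hσ⟩ := exiper K hinj
  refine (H.permZ σ).S0 h01 h12 fun k => ?_
  have := hK k
  rw [← hσ] at this
  exact this

lemma irr (d : ℕ) (hd : ¬ IsSquare d) (x y : ℤ) (h : (x : ℝ) + y * √d = 0) : x = 0 ∧ y = 0 := by
  have hy : y = 0 := by
    by_contra hy
    have : Irrational (√d) := irrational_sqrt_natCast_iff.2 hd
    apply this
    refine ⟨-(x : ℚ) / y, ?_⟩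
    have : (y : ℝ) ≠ 0 := by exact_mod_cast hy
    push_cast
    field_simp; linarith
  refine ⟨?_, hy⟩
  rw [hy] at h; simpa using h

lemma righdec0 : (allN 8 fun l0 => allN (8 - l0) fun l1 => allN (8 - l0 - l1) fun l2 => allN (8 - l0 - l1 - l2) fun w0 =>
    allN (8 - l0 - l1 - l2 - w0) fun w1 => allN (8 - l0 - l1 - l2 - w0 - w1) fun w2 =>
    decide ((2 * l1 * w2 - 2 * l2 * w1 - 14 : ℤ) * (2 * l2 + w1) - (2 * l2 * w0 - 2 * l0 * w2) * w0 + (2 * l0 * w1 - 2 * l1 * w0) * (2 * l0) = 0 →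
      (2 * l1 * w2 - 2 * l2 * w1 - 14 : ℤ) ^ 2 + 14 * (2 * l2 + w1) ^ 2 + (2 * l2 * w0 - 2 * l0 * w2) ^ 2 + 14 * w0 ^ 2
        - (2 * l0 * w1 - 2 * l1 * w0) ^ 2 - 14 * (2 * l0) ^ 2 = 0 → False)) = true := by
  decide +kernel

lemma rigdec (l0 l1 l2 w0 w1 w2 : ℕ) (hn : l0 + l1 + l2 + (w0 + w1 + w2) ≤ 7)
    (h1 : (2 * l1 * w2 - 2 * l2 * w1 - 14 : ℤ) * (2 * l2 + w1) - (2 * l2 * w0 - 2 * l0 * w2) * w0 + (2 * l0 * w1 - 2 * l1 * w0) * (2 * l0) = 0)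
    (h2 : (2 * l1 * w2 - 2 * l2 * w1 - 14 : ℤ) ^ 2 + 14 * (2 * l2 + w1) ^ 2 + (2 * l2 * w0 - 2 * l0 * w2) ^ 2 + 14 * w0 ^ 2
        - (2 * l0 * w1 - 2 * l1 * w0) ^ 2 - 14 * (2 * l0) ^ 2 = 0) : False := by
  have := righdec0
  simp only [alliff, decide_eq_true_iff] at this
  exact this l0 (by omega) l1 (by omega) l2 (by omega) w0 (by omega) w1 (by omega) w2 (by omega) h1 h2

lemma cropar (u0 u1 u2 v0 v1 v2 a b c : ℝ) (hc : 0 < c) (h1 : u0 * a + u1 * b + u2 * c = 0) (h2 : v0 * a + v1 * b + v2 * c = 0)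
    (h : a ^ 2 + b ^ 2 = c ^ 2) :
    (u1 * v2 - u2 * v1) ^ 2 + (u2 * v0 - u0 * v2) ^ 2 = (u0 * v1 - u1 * v0) ^ 2 := by
  have e1 : (u1 * v2 - u2 * v1) * c = (u0 * v1 - u1 * v0) * a := by linear_combination u1 * h2 - v1 * h1
  have e2 : (u2 * v0 - u0 * v2) * c = (u0 * v1 - u1 * v0) * b := by linear_combination v0 * h1 - u0 * h2
  have : c ^ 2 * ((u1 * v2 - u2 * v1) ^ 2 + (u2 * v0 - u0 * v2) ^ 2) = c ^ 2 * (u0 * v1 - u1 * v0) ^ 2 := by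
    calc _ = ((u1 * v2 - u2 * v1) * c) ^ 2 + ((u2 * v0 - u0 * v2) * c) ^ 2 := by ring
      _ = (u0 * v1 - u1 * v0) ^ 2 * (a ^ 2 + b ^ 2) := by rw [e1, e2]; ring
      _ = _ := by rw [h]; ring
  exact mlc (by positivity) this

lemma rigfac (T : CTri) (hT : DD T ≠ 0) (hr : ang T 2 = π / 2) :
    L T 0 ^ 2 + L T 1 ^ 2 = L T 2 ^ 2 ∧ L T 0 = L T 2 * sin (ang T 0) ∧ L T 1 = L T 2 * sin (ang T 1) ∧
    cos (ang T 1) = sin (ang T 0) := by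
  have h := lawcos T 2
  rw [hr, cos_pi_div_two, e3, e4] at h
  have a := lawsin T hT 0 2
  have b := lawsin T hT 1 2
  rw [hr, sin_pi_div_two] at a b
  have := angsum T hT
  refine ⟨by linarith, by linarith, by linarith, ?_⟩
  rw [← sin_pi_div_two_sub]; congr 1; linarith

lemma rigalg (l0 l1 l2 w0 w1 w2 : ℕ) (hn : l0 + l1 + l2 + (w0 + w1 + w2) ≤ 7) (a b c : ℝ) (hc : 0 < c)
    (h : a ^ 2 + b ^ 2 = c ^ 2)
    (e1 : 2 * (l0 * a + l1 * b + l2 * c) = √((14 : ℕ) : ℝ) * c) (e2 : w0 * a + w1 * b + w2 * c = √((14 : ℕ) : ℝ) * b) : False := by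
  have h14 : √((14 : ℕ) : ℝ) ^ 2 = 14 := by rw [Real.sq_sqrt (by positivity)]; norm_num
  have hi := irr 14 (by decide +kernel) ((2 * l1 * w2 - 2 * l2 * w1 - 14 : ℤ) ^ 2 + 14 * (2 * l2 + w1) ^ 2 + (2 * l2 * w0 - 2 * l0 * w2) ^ 2 + 14 * w0 ^ 2
        - (2 * l0 * w1 - 2 * l1 * w0) ^ 2 - 14 * (2 * l0) ^ 2)
    (2 * ((2 * l1 * w2 - 2 * l2 * w1 - 14 : ℤ) * (2 * l2 + w1) - (2 * l2 * w0 - 2 * l0 * w2) * w0 + (2 * l0 * w1 - 2 * l1 * w0) * (2 * l0)))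
  generalize √((14 : ℕ) : ℝ) = s at *
  have cp := cropar (2 * l0) (2 * l1) (2 * l2 - s) w0 (w1 - s) w2 a b c hc (by linear_combination e1) (by linear_combination e2) h
  have := hi (by
      push_cast
      have cp' : ((2 * l1 * w2 - 2 * l2 * w1 - 14) + (2 * l2 + w1) * s) ^ 2 + ((2 * l2 * w0 - 2 * l0 * w2) - w0 * s) ^ 2
        = ((2 * l0 * w1 - 2 * l1 * w0) - 2 * l0 * s) ^ 2 := by
        have : (2 * l1 * w2 - 2 * l2 * w1 - 14 : ℝ) + (2 * l2 + w1) * s = 2 * l1 * w2 - (2 * l2 - s) * (w1 - s) := by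
          linear_combination h14
        rw [this]
        linear_combination cp
      linear_combination cp' - ((2 * l2 + w1) ^ 2 + w0 ^ 2 - 4 * l0 ^ 2) * h14)
  exact rigdec l0 l1 l2 w0 w1 w2 hn (by linarith [this.2]) this.1

set_option maxHeartbeats 1000000 in
lemma Til.right2 (H : Til Z T t) (hr : ang T 2 = π / 2) (s0 : Single Z t 0 0) (s1 : Single Z t 1 0)
    (h0 : NN t (Z 2) 0 = 0) (h1 : NN t (Z 2) 1 = 2) (h2 : NN t (Z 2) 2 = 0) : False := by
  obtain ⟨hpy, ha, hb, hcs⟩ := rigfac T H.hT hr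
  have A0 := sinang H s0
  have A1 := sinang H s1
  have A2 : ang Z 2 = 2 * ang T 1 := by
    rw [← (H.corner 2).1]; unfold NA; rw [h0, h1, h2]; push_cast; ring
  have p0 := H.lp 0
  have p1 := H.lp 1
  have p2 := H.lp 2
  have q0 := lpos Z H.hZ 0
  have hL := lawsin Z H.hZ 0 1
  rw [A0, A1] at hL
  have hsp := H.spos 0
  have hL' : L Z 0 = L Z 1 := mrc hsp.ne' hL
  have hW := lawsin Z H.hZ 2 0
  rw [A2, A0, sin_two_mul, hcs] at hW
  have hW' : L Z 2 = 2 * L Z 0 * sin (ang T 1) := by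
    apply mrc hsp.ne'; linarith
  have hWc : L Z 2 * L T 2 = 2 * L Z 0 * L T 1 := by rw [hW', hb]; ring
  have har := H.area
  rw [laware Z 1, laware T 2, hr, sin_pi_div_two] at har
  rw [e1, e2, e3, e4, A1] at har
  have hsq : 4 * L Z 0 ^ 2 = 14 * L T 2 ^ 2 := by
    have : (L T 0 * L T 1) * (4 * L Z 0 ^ 2) = (L T 0 * L T 1) * (14 * L T 2 ^ 2) := by
      calc _ = 2 * L Z 0 * L T 0 * (2 * L Z 0 * L T 1) := by ring
        _ = 2 * (L Z 2 * L Z 0 * sin (ang T 0)) * L T 2 * L T 2 := by rw [← hWc]; nth_rewrite 1 [ha]; ring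
        _ = _ := by rw [har]; ring
    exact mlc (by positivity) this
  have h14 : √((14 : ℕ) : ℝ) ^ 2 = 14 := by rw [Real.sq_sqrt (by positivity)]; norm_num
  set s := √((14 : ℕ) : ℝ) with hs
  have sp : 0 ≤ s := Real.sqrt_nonneg _
  have hLs : 2 * L Z 0 = s * L T 2 := by
    have : (2 * L Z 0 - s * L T 2) * (2 * L Z 0 + s * L T 2) = 0 := by linear_combination hsq - L T 2 ^ 2 * h14
    rcases mul_eq_zero.1 this with h | h
    · linarith
    · have : 0 < 2 * L Z 0 + s * L T 2 := by positivity
      linarith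
  have hWs : L Z 2 = s * L T 1 := by
    apply mrc p2.ne'; rw [hWc, hLs]; ring
  have hc1 : 2 ≤ mm Z t 1 0 + mm Z t 1 1 + mm Z t 1 2 := by
    by_contra hcon
    have hl := H.sidlen 1
    rw [← hL'] at hl
    have h3 : 3 < s := by nlinarith
    have m0 : ((mm Z t 1 0 + mm Z t 1 1 + mm Z t 1 2 : ℕ) : ℝ) ≤ 1 := by exact_mod_cast (by omega)
    push_cast at m0
    have la : L T 0 ≤ L T 2 := by nlinarith
    have lb : L T 1 ≤ L T 2 := by nlinarith
    have := mlel la (Nat.cast_nonneg (α := ℝ) (mm Z t 1 0))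
    have := mlel lb (Nat.cast_nonneg (α := ℝ) (mm Z t 1 1))
    have := mler m0 p2.le
    have := mul_lt_mul_of_pos_right h3 p2
    linarith
  have hn : (SE Z t 0).card + (SE Z t 1).card + (SE Z t 2).card ≤ 9 := by
    obtain ⟨h, f, T1, e1, e2, -⟩ := H.count
    omega
  rw [carse, carse, carse] at hn
  have l0 := H.sidlen 0
  have l2 := H.sidlen 2
  exact rigalg (mm Z t 0 0) (mm Z t 0 1) (mm Z t 0 2) (mm Z t 2 0) (mm Z t 2 1) (mm Z t 2 2) (by omega) (L T 0) (L T 1) (L T 2) p2 hpy (by rw [← l0]; exact hLs) (by rw [← l2]; exact hWs)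

lemma rigspl : ∀ f g : Fin 3 → Fin 3, (f 0).val + (f 1).val + (f 2).val = 2 → (g 0).val + (g 1).val + (g 2).val = 2 →
    (∀ k, 1 ≤ (f k).val + (g k).val) → ∃ σ : Equiv.Perm (Fin 3),
      ((f (σ 0)).val = 1 ∧ (g (σ 0)).val = 0 ∧ (f (σ 1)).val = 0 ∧ (g (σ 1)).val = 1) ∨
      ((f (σ 0)).val = 1 ∧ (g (σ 0)).val = 0 ∧ (f (σ 1)).val = 1 ∧ (g (σ 1)).val = 0 ∧ (f (σ 2)).val = 0 ∧ (g (σ 2)).val = 2) ∨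
      ((f (σ 0)).val = 0 ∧ (g (σ 0)).val = 1 ∧ (f (σ 1)).val = 0 ∧ (g (σ 1)).val = 1 ∧ (f (σ 2)).val = 2 ∧ (g (σ 2)).val = 0) := by
  decide +kernel

lemma sinmk {M j : Fin 3} (h : NN t (Z M) j = 1) (h1 : NN t (Z M) (j+1) = 0) (h2 : NN t (Z M) (j+2) = 0) : Single Z t M j := by
  refine ⟨h, fun j' hj' => ?_⟩
  have : j' = j + 1 ∨ j' = j + 2 := by clear * - hj'; decide +revert
  rcases this with rfl | rfl <;> assumption

lemma Til.rigsim (H : Til Z T t) (h01 : L T 0 < L T 1) (h12 : L T 1 < L T 2) (hr : ang T 2 = π / 2)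
    (s0 : Single Z t 0 0) (s1 : Single Z t 1 1) : False := by
  have A0 := sinang H s0
  have A1 := sinang H s1
  have hz := angsum Z H.hZ
  have ht := H.asum
  have hs : ∀ k, ang Z k = ang T k := by
    intro k; fin_cases k
    · exact A0
    · exact A1
    · show ang Z 2 = ang T 2
      linarith
  have a := H.has 0 0 s0
  have b := H.has 1 1 s1
  simp only [zero_add, e1, e2] at a b
  obtain ⟨m0, m1, m2, m3⟩ := H.simX h01 h12 hs (by omega) (by omega) (by omega) (by omega)
  have l0 := H.sidlen 0
  have l1 := H.sidlen 1
  rw [H.sim hs] at l0 l1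
  rw [m0, m1] at l0
  rw [m2, m3] at l1
  have h7 := Real.sq_sqrt (show (0:ℝ) ≤ 7 by norm_num)
  have hp := (rigfac T H.hT hr).1
  have p2 := H.lp 2
  have key : ((mm Z t 0 2 : ℝ) ^ 2 + (mm Z t 1 2 : ℝ) ^ 2) * L T 2 ^ 2 = 7 * L T 2 ^ 2 := by
    have q0 : √7 * L T 0 = mm Z t 0 2 * L T 2 := by push_cast at l0; linarith
    have q1 : √7 * L T 1 = mm Z t 1 2 * L T 2 := by push_cast at l1; linarith
    calc _ = (√7 * L T 0) ^ 2 + (√7 * L T 1) ^ 2 := by rw [q0, q1]; ring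
      _ = 7 * (L T 0 ^ 2 + L T 1 ^ 2) := by rw [mul_pow, mul_pow, h7]; ring
      _ = _ := by rw [hp]
  have := mrc (by positivity : L T 2 ^ 2 ≠ 0) key
  have : (mm Z t 0 2) ^ 2 + (mm Z t 1 2) ^ 2 = 7 := by exact_mod_cast this
  have g0 : mm Z t 0 2 ≤ 2 := by nlinarith
  have g1 : mm Z t 1 2 ≤ 2 := by nlinarith
  interval_cases mm Z t 0 2 <;> interval_cases mm Z t 1 2 <;> omega

lemma Til.right (H : Til Z T t) (h01 : L T 0 < L T 1) (h12 : L T 1 < L T 2) (hr : ang T 2 = π / 2)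
    (h2 : PP Z t 2 = 0) : False := by
  have hsum := H.asum
  have a0 := H.apos 0
  have a01 : ang T 0 < ang T 1 := (angltiff T H.hT 0).2 h01
  have hP := H.Peq
  rw [h2] at hP
  have b0 : PP Z t 0 ≤ 7 := by have := H.tot 0; omega
  have b1 : PP Z t 1 ≤ 7 := by have := H.tot 1; omega
  have hpi := Real.pi_pos
  have hd : (7 : ℤ) ∣ PP Z t 0 * 2 - 2 * PP Z t 1 := by
    by_contra hc
    exact H.frob2 (PP Z t 0) (PP Z t 1) 1 2 2 1 (by push_cast at hP ⊢; linarith) (by push_cast; linarith) hc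
  have hcase : (PP Z t 0 = 0 ∧ PP Z t 1 = 7) ∨ (PP Z t 0 = 7 ∧ PP Z t 1 = 0) ∨ PP Z t 0 = PP Z t 1 := by omega
  rcases hcase with ⟨e0, e1⟩ | ⟨e0, e1⟩ | e
  · rw [e0, e1] at hP; push_cast at hP; linarith
  · rw [e0, e1] at hP; push_cast at hP
    obtain ⟨p, hp, hpu⟩ := H.pig 1 e1
    have hv := H.vrel hp
    have l0 := H.le1 0 hp
    have : NN t p 0 = 0 := by omega
    rw [this] at hv
    have f0 : ang T 0 = π / 7 := by linarith
    have f1 : ang T 1 = 5 * π / 14 := by linarith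
    rw [f0, f1, hr] at hv
    have hq : (5 * NN t p 1 + 7 * NN t p 2 : ℝ) * π = (14 * uu Z t p) * π := by push_cast at hv; linarith
    have := mrc hpi.ne' hq
    have : 5 * NN t p 1 + 7 * NN t p 2 = 14 * uu Z t p := by exact_mod_cast this
    have := H.ucase hp
    omega
  · have e2 : PP Z t 0 = 2 := by
      rw [← e] at hP
      have : (PP Z t 0 : ℝ) * π = 2 * π := by
        have : ang T 0 + ang T 1 = π / 2 := by linarith
        have : (PP Z t 0 : ℝ) * (ang T 0 + ang T 1) = π := by push_cast at hP; linarith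
        rw [‹ang T 0 + ang T 1 = π / 2›] at this; linarith
      exact_mod_cast mrc hpi.ne' this
    rw [e2] at e
    unfold PP at e e2 h2
    have z : ∀ k, NN t (Z k) 2 = 0 := by intro k; fin_cases k <;> simp <;> omega
    have y : ∀ k, NN t (Z k) 1 < 3 := by intro k; fin_cases k <;> simp <;> omega
    have x : ∀ k, NN t (Z k) 0 < 3 := by intro k; fin_cases k <;> simp <;> omega
    obtain ⟨σ, hσ⟩ := rigspl (fun k => ⟨NN t (Z k) 0, x k⟩) (fun k => ⟨NN t (Z k) 1, y k⟩) e2 e.symm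
      (fun k => by have := H.cpos k; have := z k; simp; omega)
    simp only at hσ
    rcases hσ with ⟨u1, u2, u3, u4⟩ | ⟨u1, u2, u3, u4, u5, u6⟩ | ⟨u1, u2, u3, u4, u5, u6⟩
    · exact (H.permZ σ).rigsim h01 h12 hr (sinmk u1 u2 (z _)) (sinmk u4 (z _) u3)
    · exact (H.permZ σ).right2 hr (sinmk u1 u2 (z _)) (sinmk u3 u4 (z _)) u5 u6 (z _)
    · refine ((H.permZ σ).permT (Equiv.swap 0 1)).right2 (Z := Z ∘ σ) ?_ (sinmk u2 u1 (z _)) (sinmk u4 u3 (z _)) u6 u5 (z _)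
      rw [← hr]; unfold ang
      exact InnerProductGeometry.angle_comm _ _

def ns (Z : CTri) (t : Fin 7 → CTri) (K : Fin 3) : ℕ := mm Z t K 0 + mm Z t K 1 + mm Z t K 2

lemma Til.lenle (H : Til Z T t) (h01 : L T 0 < L T 1) (h12 : L T 1 < L T 2) (K : Fin 3) : L Z K ≤ ns Z t K * L T 2 := by
  have h := H.sidlen K
  have a := mlel (h01.trans h12).le (Nat.cast_nonneg (α := ℝ) (mm Z t K 0))
  have b := mlel h12.le (Nat.cast_nonneg (α := ℝ) (mm Z t K 1))
  unfold ns; push_cast; linarith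

lemma Til.nspos (H : Til Z T t) (K : Fin 3) : 1 ≤ ns Z t K := by
  obtain ⟨f, g, hfg, -⟩ := H.ends
  have := (hfg K).1
  unfold ns
  generalize f K = i at this
  fin_cases i <;> simp at this <;> omega

lemma Til.nslt (H : Til Z T t) (h01 : L T 0 < L T 1) (h12 : L T 1 < L T 2) (K : Fin 3) (n : ℕ) (h : n * L T 2 < L Z K) :
    n < ns Z t K := by
  have := H.lenle h01 h12 K
  have p := H.lp 2
  by_contra hc
  have : (ns Z t K : ℝ) ≤ n := by exact_mod_cast not_lt.1 hc
  have := mler this p.le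
  linarith

lemma Til.n3 (H : Til Z T t) (h : ∀ p ∈ WW Z t, uu Z t p = 2) (K : Fin 3) : ns Z t K = 1 := by
  classical
  obtain ⟨h, f, T1, e1, e2, e3, -⟩ := H.count
  have : h = 0 := by
    rw [e3, card_eq_zero, filter_eq_empty_iff]
    intro p hp; rw [‹∀ p ∈ WW Z t, uu Z t p = 2› p hp]; decide
  have a0 := H.nspos 0
  have a1 := H.nspos 1
  have a2 := H.nspos 2
  rw [carse, carse, carse] at e2
  change ns Z t 0 + ns Z t 1 + ns Z t 2 + T1 ≤ _ at e2
  fin_cases K <;> simp <;> omega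

lemma Til.full (H : Til Z T t) {p : ℂ} (hp : p ∈ WW Z t) (hu : uu Z t p = 2) : inT Z p := by
  rcases (H.nonc p hp).2.2.2 with h | h
  · exact h.1
  · have := h.2.2; omega

lemma Til.six (H : Til Z T t) (h01 : L T 0 < L T 1) (h12 : L T 1 < L T 2) {w : ℂ} (hw : w ∈ WW Z t) (hu : uu Z t w = 2)
    (hp : ¬ (Even (NN t w 0 + NN t w 1) ∧ Even (NN t w 1 + NN t w 2))) :
    ns Z t 0 + ns Z t 1 + ns Z t 2 ≤ 5 ∨
    (ns Z t 0 + ns Z t 1 + ns Z t 2 = 6 ∧ (L T 1 = 2 * L T 0 ∨ L T 2 = 2 * L T 0)) := by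
  classical
  obtain ⟨h, f, T1, e1, e2, e3, e4, e5⟩ := H.count
  have hf : 1 ≤ f := by
    rw [e4]; exact Finset.card_pos.2 ⟨w, by simp [hw, hu]⟩
  rw [carse, carse, carse] at e2
  change ns Z t 0 + ns Z t 1 + ns Z t 2 + T1 ≤ _ at e2
  have hE : ∀ p ∈ WW Z t, inT Z p → uu Z t p ≠ 1 → EE t p = 0 := by
    intro p hp hi hn
    rcases (H.nonc p hp).2.2.2 with h | h
    · have := H.ucase hp; have := h.2; omega
    · exact h.2.1
  have hT1 : T1 ≠ 0 := by
    intro h0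
    rw [h0] at e5
    have e5 := filter_eq_empty_iff.1 (card_eq_zero.1 e5.symm)
    have hs : ∀ k l, L T k = L T l → k = l := by
      intro k l; fin_cases k <;> fin_cases l <;> simp <;> intro h <;> linarith
    have ev := H.eveat (fun p hp hi => hE p hp hi (fun hu => e5 hp ⟨hi, hu⟩)) hs w (H.full hw hu)
    exact hp ⟨ev 2, ev 0⟩
  by_cases h5 : ns Z t 0 + ns Z t 1 + ns Z t 2 ≤ 5
  · exact Or.inl h5
  right
  refine ⟨by omega, ?_⟩
  obtain ⟨q, hq⟩ := card_eq_one.1 (e5.symm.trans (by omega))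
  have hqm : q ∈ (WW Z t).filter fun p => inT Z p ∧ uu Z t p = 1 := by rw [hq]; simp
  rw [mem_filter] at hqm
  obtain ⟨q1, q2, q3⟩ := hqm
  obtain ⟨k, l, m, hk⟩ := H.oneT q q1 q2 (by
    rcases (H.nonc q q1).2.2.2 with h | h
    · have := h.2; omega
    · have h1 := h.1; exfalso
      obtain ⟨K, hK⟩ := h1
      have := q2 K; rw [hK.1] at this; exact lt_irrefl _ this) (by
    intro p hp hi hne
    refine hE p hp hi fun h1 => hne ?_
    have : p ∈ (WW Z t).filter fun p => inT Z p ∧ uu Z t p = 1 := by simp [hp, hi, h1]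
    rw [hq] at this; simpa using this)
  have p0 := H.lp 0
  have ti : L T 2 < L T 0 + L T 1 := triine T H.hT 2
  fin_cases k <;> fin_cases l <;> fin_cases m <;> simp at hk <;> first | linarith | (left; linarith) | (right; linarith)

lemma Til.p2 (H : Til Z T t) (h : π / 21 ≤ ang T 0) (h12 : L T 1 < L T 2) (h01 : L T 0 < L T 1) (ho : π / 2 ≤ ang T 2) (M : Fin 3)
    (hM : ang T 2 ≤ ang Z M) (hn : ns Z t M = 1) : False := by
  have hpi := pi_pos
  have p0 := H.lp 0
  have p1 := H.lp 1
  have hab : 2 / 21 * L T 1 ≤ L T 0 := by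
    have h1 := lawsin T H.hT 0 1
    have s1 := H.spos 1
    have := sin_le_one (ang T 1)
    have hs := H.asum
    have a1 := H.apos 1
    have a0 := H.apos 0
    have j := mul_le_sin (x := ang T 0) (by linarith) (by linarith)
    have : 2 / 21 ≤ sin (ang T 0) := by
      refine le_trans ?_ j
      calc (2:ℝ) / 21 = 2 / π * (π / 21) := by field_simp
        _ ≤ _ := by gcongr
    have := mlel this p1.le
    have := mlel (sin_le_one (ang T 1)) p0.le
    linarith
  have har := H.area
  rw [laware Z M, laware T 2] at har
  have hsin : sin (ang Z M) ≤ sin (ang T 2) := by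
    rw [← cos_sub_pi_div_two, ← cos_sub_pi_div_two]
    exact cos_le_cos_of_nonneg_of_le_pi (by linarith) (by linarith [anglt Z H.hZ M]) (by linarith)
  have sp := H.spos 2
  have q1 := lpos Z H.hZ (M+1)
  have q2 := lpos Z H.hZ (M+2)
  have hXY : 7 * (L T 0 * L T 1) ≤ L Z (M+1) * L Z (M+2) := by
    have := mlel hsin (mul_pos q1 q2).le
    have : (7 * (L T 0 * L T 1)) * sin (ang T 2) ≤ (L Z (M+1) * L Z (M+2)) * sin (ang T 2) := by
      rw [e3, e4] at har; linarith
    exact le_of_mul_le_mul_right this sp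
  have hcos : cos (ang Z M) ≤ 0 := cos_nonpos_of_pi_div_two_le_of_le (by linarith) (by linarith [anglt Z H.hZ M])
  have hl := lawcos Z M
  have hW := H.lenle h01 h12 M
  rw [hn] at hW
  have ti : L T 2 < L T 0 + L T 1 := triine T H.hT 2
  have qM := lpos Z H.hZ M
  have := mul_nonneg (mul_pos q1 q2).le (neg_nonneg.2 hcos)
  have h1 : L Z M ^ 2 ≤ (L T 0 + L T 1) ^ 2 := by
    apply pow_le_pow_left₀ qM.le; push_cast at hW; linarith
  have h2 : 2 * (L Z (M+1) * L Z (M+2)) ≤ L Z M ^ 2 := by nlinarith [sq_nonneg (L Z (M+1) - L Z (M+2))]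
  nlinarith [mler hab p1.le, mul_pos p0 p1]

lemma lamper (s : CTri) (h : DD s ≠ 0) (σ : Equiv.Perm (Fin 3)) (K : Fin 3) (p : ℂ) : lam (s ∘ σ) K p = lam s (σ K) p := by
  unfold lam
  rw [div_eq_div_iff (ddper s h σ) h]
  have e5 : (0 : Fin 3) + 1 = 1 := rfl
  have e6 : (0 : Fin 3) + 2 = 2 := rfl
  have hK : K = 0 ∨ K = 1 ∨ K = 2 := by clear * -; decide +revert
  unfold DD cr
  rcases percas σ with ⟨h0, h1, h2⟩ | ⟨h0, h1, h2⟩ | ⟨h0, h1, h2⟩ | ⟨h0, h1, h2⟩ | ⟨h0, h1, h2⟩ | ⟨h0, h1, h2⟩ <;>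
    rcases hK with rfl | rfl | rfl <;>
    simp only [Function.comp, h0, h1, h2, e1, e2, e3, e4, e5, e6, Complex.sub_re, Complex.sub_im] <;> ring

lemma mmper (H : Til Z T t) (σ : Equiv.Perm (Fin 3)) (K k : Fin 3) : mm (Z ∘ σ) t K k = mm Z t (σ K) k := by
  unfold mm SE
  simp only [lamper Z H.hZ]

lemma nsper (H : Til Z T t) (σ : Equiv.Perm (Fin 3)) :
    ns (Z ∘ σ) t 0 + ns (Z ∘ σ) t 1 + ns (Z ∘ σ) t 2 = ns Z t 0 + ns Z t 1 + ns Z t 2 := by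
  unfold ns
  simp only [mmper H]
  rcases percas σ with ⟨h0, h1, h2⟩ | ⟨h0, h1, h2⟩ | ⟨h0, h1, h2⟩ | ⟨h0, h1, h2⟩ | ⟨h0, h1, h2⟩ | ⟨h0, h1, h2⟩ <;>
    rw [h0, h1, h2] <;> ring

lemma dbl (T : CTri) (hT : DD T ≠ 0) (h02 : L T 0 < L T 2) (h : ang T 1 = 2 * ang T 0) :
    L T 1 = 2 * L T 0 * cos (ang T 0) ∧ L T 1 ^ 2 = L T 0 ^ 2 + L T 0 * L T 2 := by
  have h1 := lawsin T hT 1 0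
  rw [h, sin_two_mul] at h1
  have hb : L T 1 = 2 * L T 0 * cos (ang T 0) := mrc (sinangpos T hT 0).ne' (by linarith)
  refine ⟨hb, ?_⟩
  have h2 := lawcos T 0
  simp only [zero_add] at h2
  have : (L T 2 - L T 0) * (L T 1 ^ 2 - L T 0 ^ 2 - L T 0 * L T 2) = 0 := by
    linear_combination L T 0 * h2 + L T 1 * L T 2 * hb
  rcases mul_eq_zero.1 this with h | h <;> linarith

lemma dspl : ∀ (f : Fin 3 → Fin 4) (g : Fin 3 → Fin 2), (f 0).val + (f 1).val + (f 2).val = 3 → (g 0).val + (g 1).val + (g 2).val = 1 →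
    (∀ k, 1 ≤ (f k).val + (g k).val) → ∃ σ : Equiv.Perm (Fin 3),
      ((f (σ 0)).val = 1 ∧ (g (σ 0)).val = 0 ∧ (f (σ 1)).val = 2 ∧ (g (σ 1)).val = 0) ∨
      ((f (σ 0)).val = 1 ∧ (g (σ 0)).val = 0 ∧ (f (σ 1)).val = 1 ∧ (g (σ 1)).val = 0) := by
  decide +kernel

lemma Til.D5 (H : Til Z T t) (h01 : L T 0 < L T 1) (h12 : L T 1 < L T 2) (h : ang T 1 = 2 * ang T 0)
    (hn : ns Z t 0 + ns Z t 1 + ns Z t 2 ≤ 5) (h0 : ang Z 0 = ang T 0) (h1 : ang Z 1 = ang T 1 ∨ ang Z 1 = ang T 0) : False := by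
  have ti : L T 2 < L T 0 + L T 1 := triine T H.hT 2
  obtain ⟨hb, hbb⟩ := dbl T H.hT (h01.trans h12) h
  have p0 := H.lp 0
  have p1 := H.lp 1
  have p2 := H.lp 2
  have sp := H.spos 0
  have hb2 : L T 1 < 2 * L T 0 := by nlinarith
  have n0 := H.nspos 0
  have n1 := H.nspos 1
  have n2 := H.nspos 2
  rcases h1 with h1 | h1
  · have hz := angsum Z H.hZ
    have ht := H.asum
    have hs : ∀ k, ang Z k = ang T k := by
      intro k; fin_cases k
      · exact h0
      · exact h1
      · show ang Z 2 = ang T 2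
        linarith
    have h7 := Real.sq_sqrt (show (0:ℝ) ≤ 7 by norm_num)
    have h72 : 2 < √7 := by rw [Real.lt_sqrt] <;> norm_num
    have m2 := H.nslt h01 h12 2 2 (by rw [H.sim hs]; push_cast; exact mul_lt_mul_of_pos_right h72 p2)
    have c1 : ns Z t 1 = 1 := by omega
    have c0 : ns Z t 0 = 1 := by omega
    have l0 := H.sidlen 0
    have l1 := H.sidlen 1
    have l1' := H.lenle h01 h12 1
    rw [H.sim hs] at l0 l1 l1'
    rw [c1] at l1'; push_cast at l1'
    have k1 := mul_lt_mul_of_pos_right h72 p0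
    have k2 := mul_lt_mul_of_pos_left h01 (show 0 < √7 by linarith)
    unfold ns at c0
    have : (mm Z t 0 0 = 1 ∧ mm Z t 0 1 = 0 ∧ mm Z t 0 2 = 0) ∨ (mm Z t 0 0 = 0 ∧ mm Z t 0 1 = 1 ∧ mm Z t 0 2 = 0) ∨
      (mm Z t 0 0 = 0 ∧ mm Z t 0 1 = 0 ∧ mm Z t 0 2 = 1) := by omega
    rcases this with ⟨e0, e1, e2⟩ | ⟨e0, e1, e2⟩ | ⟨e0, e1, e2⟩ <;> rw [e0, e1, e2] at l0 <;> push_cast at l0 <;> linarith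
  · have e : L Z 0 = L Z 1 := by
      have := lawsin Z H.hZ 0 1
      rw [h0, h1] at this
      exact mrc sp.ne' this
    have hz := angsum Z H.hZ
    have hW := lawsin Z H.hZ 2 0
    have : ang Z 2 = π - 2 * ang T 0 := by linarith
    rw [this, sin_pi_sub, sin_two_mul, h0] at hW
    have hW : L Z 2 = 2 * L Z 0 * cos (ang T 0) := mrc sp.ne' (by linarith)
    have hWb : L Z 2 * L T 0 = L Z 0 * L T 1 := by rw [hW, hb]; ring
    have har := H.area
    rw [laware Z 0, laware T 0, h0] at har
    simp only [zero_add] at har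
    have har : L Z 1 * L Z 2 = 7 * (L T 1 * L T 2) := mrc sp.ne' (by linarith)
    have hl : L Z 0 ^ 2 = 7 * L T 0 * L T 2 := by
      apply mrc p1.ne'
      calc L Z 0 ^ 2 * L T 1 = L Z 0 * (L Z 0 * L T 1) := by ring
        _ = (L Z 1 * L Z 2) * L T 0 := by rw [← hWb, e]; ring
        _ = _ := by rw [har]; ring
    have q0 := lpos Z H.hZ 0
    have k0 : L T 2 < L Z 0 := by
      by_contra hc
      have := pow_le_pow_left₀ q0.le (not_lt.1 hc) 2
      nlinarith
    have k2 : L Z 0 < L Z 2 := by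
      have := mul_lt_mul_of_pos_left h01 q0
      rw [← hWb] at this
      exact lt_of_mul_lt_mul_right this p0.le
    have m0 := H.nslt h01 h12 0 1 (by push_cast; linarith)
    have m1 := H.nslt h01 h12 1 1 (by push_cast; linarith)
    have m2 := H.nslt h01 h12 2 1 (by push_cast; linarith)
    omega

lemma Til.famD (H : Til Z T t) (h01 : L T 0 < L T 1) (h12 : L T 1 < L T 2) (h : ang T 1 = 2 * ang T 0)
    (v0 : PP Z t 0 = 3) (v1 : PP Z t 1 = 0) (v2 : PP Z t 2 = 1) {w : ℂ} (hw : w ∈ WW Z t) (hu : uu Z t w = 2)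
    (y0 : NN t w 0 = 0) (y1 : NN t w 1 = 3) (y2 : NN t w 2 = 2) : False := by
  have ti : L T 2 < L T 0 + L T 1 := triine T H.hT 2
  have p0 := H.lp 0
  have hs := H.asum
  rcases H.six h01 h12 hw hu (by rw [y0, y1, y2]; decide) with h5 | ⟨-, h6⟩
  · unfold PP at v0 v1 v2
    have y : ∀ k, NN t (Z k) 1 = 0 := by intro k; fin_cases k <;> simp <;> omega
    have z : ∀ k, NN t (Z k) 2 < 2 := by intro k; fin_cases k <;> simp <;> omega
    have x : ∀ k, NN t (Z k) 0 < 4 := by intro k; fin_cases k <;> simp <;> omega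
    obtain ⟨σ, hσ⟩ := dspl (fun k => ⟨NN t (Z k) 0, x k⟩) (fun k => ⟨NN t (Z k) 2, z k⟩) v0 v2
      (fun k => by have := H.cpos k; have := y k; simp; omega)
    simp only at hσ
    have hc' : ∀ k, ang (Z ∘ σ) k = NN t (Z (σ k)) 0 * ang T 0 + NN t (Z (σ k)) 2 * ang T 2 := by
      intro k; rw [← ((H.permZ σ).corner k).1]; unfold NA; simp only [Function.comp]; rw [y]; push_cast; ring
    refine (H.permZ σ).D5 h01 h12 h ?_ ?_ ?_
    · rw [nsper H]; exact h5
    · rw [hc']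
      rcases hσ with ⟨u1, u2, -⟩ | ⟨u1, u2, -⟩ <;> rw [u1, u2] <;> simp
    · rw [hc', h]
      rcases hσ with ⟨-, -, u1, u2⟩ | ⟨-, -, u1, u2⟩ <;> rw [u1, u2] <;> simp
  · obtain ⟨-, hbb⟩ := dbl T H.hT (h01.trans h12) h
    rcases h6 with h6 | h6
    · rw [h6] at hbb ti
      have : L T 0 * (3 * L T 0) = L T 0 * L T 2 := by linarith
      have := mlc p0.ne' this
      linarith
    · have h2 := lawcos T 2
      rw [e3, e4] at h2
      have : cos (ang T 2) = 0 := by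
        have : L T 0 * L T 1 * cos (ang T 2) = 0 := by rw [h6] at hbb h2; linarith
        have p1 := H.lp 1
        simpa [p0.ne', p1.ne'] using this
      have hr : ang T 2 = π / 2 := by
        apply injOn_cos ⟨(H.apos 2).le, (anglt T H.hT 2).le⟩ ⟨by positivity, by linarith [pi_pos]⟩
        rw [this, cos_pi_div_two]
      refine H.frobN 6 (by norm_num) fun j => ?_
      fin_cases j
      · exact ⟨1, by push_cast; show 6 * ang T 0 = _; linarith⟩
      · exact ⟨2, by push_cast; show 6 * ang T 1 = _; linarith⟩
      · exact ⟨3, by push_cast; show 6 * ang T 2 = _; linarith⟩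

def iA (k x y z : ℕ) : ℤ := x + k * y - z * (k + 1)
def iB (u z : ℕ) : ℤ := (u : ℤ) - z

def iOK (k u x y z : ℕ) : Bool := decide (0 < iA k x y z * iB u z) && decide ((2 * k + 1) * (iA k x y z * iB u z) < iA k x y z ^ 2) &&
  decide ((7 : ℤ) ∣ iA k x y z / (Int.gcd (iA k x y z) (Int.gcd (iB u z) (k * iB u z)) : ℤ))

lemma iiidec : (allN 7 fun k => !decide (2 ≤ k) || allN 3 fun u => !decide (1 ≤ u) || allN (7 - k) fun x => allN 8 fun y => !decide (u < y) ||
    allN 7 fun z => (!iOK k u x y z || decide (z < u)) && (!decide (iA k x y z = 0 ∧ iB u z = 0) || decide (k = 2 ∧ u = 2 ∧ x = 0 ∧ y = 3 ∧ z = 2))) = true := by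
  decide +kernel

lemma iiidec1 : (allN 7 fun k => !decide (2 ≤ k) || allN 3 fun u => !decide (1 ≤ u) || allN (7 - k) fun x => allN 8 fun y => !decide (u < y) ||
    allN u fun z => !iOK k u x y z || allN 3 fun u' => !decide (1 ≤ u') || allN (7 - k - x) fun x' => allN (8 - y) fun y' => allN (7 - z) fun z' =>
      !decide (u' < z') || !decide (iA k x y z * iB u' z' = iA k x' y' z' * iB u z) ||
      decide ((k = 2 ∧ iA k x y z = 7 * iB u z) ∨ (k = 4 ∧ iA k x y z = 14 * iB u z ∧ y = 7 ∧ u = 2) ∨ (k = 6 ∧ iA k x y z = 21 * iB u z ∧ y = 7 ∧ u = 2))) = true := by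
  decide +kernel

lemma Til.caseIII (H : Til Z T t) (h01 : L T 0 < L T 1) (h12 : L T 1 < L T 2) (k : ℕ) (hk2 : 2 ≤ k) (hk6 : k ≤ 6)
    (hβ : ang T 1 = k * ang T 0) (v0 : PP Z t 0 = k + 1) (v1 : PP Z t 1 = 0) (v2 : PP Z t 2 = 1) : False := by
  have hpi := pi_pos
  have hs := H.asum
  have a0 := H.apos 0
  have b12 : ang T 1 < ang T 2 := (angltiff T H.hT 1).2 h12
  have hlt : (2 * k + 1) * ang T 0 < π := by linarith
  have hγ : ang T 2 = π - (k + 1) * ang T 0 := by linarith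
  have rel : ∀ p ∈ WW Z t, (iA k (NN t p 0) (NN t p 1) (NN t p 2) : ℝ) * ang T 0 = iB (uu Z t p) (NN t p 2) * π := by
    intro p hp
    have := H.vrel hp
    rw [hβ, hγ] at this
    unfold iA iB; push_cast; linarith
  obtain ⟨w, hw, hwu⟩ := H.pig 1 v1
  have r1 := rel w hw
  have l0 := H.le1 0 hw
  have l1 := H.le1 1 hw
  have l2 := H.le1 2 hw
  have cu := H.ucase hw
  have D0 := iiidec
  have D1 := iiidec1
  simp only [alliff, Bool.or_eq_true, Bool.and_eq_true, Bool.not_eq_true', decide_eq_true_iff, decide_eq_false_iff_not] at D0 D1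
  have d0 := (((D0 k (by omega)).resolve_left (by omega) (uu Z t w) (by omega)).resolve_left (by omega) (NN t w 0) (by omega)
    (NN t w 1) (by omega)).resolve_left (by omega) (NN t w 2) (by omega)
  by_cases hA : iA k (NN t w 0) (NN t w 1) (NN t w 2) = 0
  · have hB : iB (uu Z t w) (NN t w 2) = 0 := by
      rw [hA] at r1
      have : (iB (uu Z t w) (NN t w 2) : ℝ) * π = 0 := by rw [← r1]; simp
      exact_mod_cast (mul_eq_zero.1 this).resolve_right hpi.ne'
    obtain ⟨e1, e2, e3, e4, e5⟩ := d0.2.resolve_left (by simp [hA, hB])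
    subst e1
    exact H.famD h01 h12 (by rw [hβ]; norm_num) v0 v1 v2 hw e2 e3 e4 e5
  set A := iA k (NN t w 0) (NN t w 1) (NN t w 2) with hAd
  set B := iB (uu Z t w) (NN t w 2) with hBd
  have hAr : (A : ℝ) ≠ 0 := by exact_mod_cast hA
  have hA2 : 0 < (A : ℝ) ^ 2 := by positivity
  have hOK : iOK k (uu Z t w) (NN t w 0) (NN t w 1) (NN t w 2) = true := by
    unfold iOK
    rw [← hAd, ← hBd]
    simp only [Bool.and_eq_true, decide_eq_true_iff]
    refine ⟨⟨?_, ?_⟩, ?_⟩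
    · have : 0 < ((A * B : ℤ) : ℝ) * π := by
        push_cast
        have : (A : ℝ) * B * π = A ^ 2 * ang T 0 := by rw [mul_assoc, ← r1]; ring
        rw [this]; positivity
      exact_mod_cast pos_of_mul_pos_left this hpi.le
    · have : (((2 * k + 1) * (A * B) : ℤ) : ℝ) * π < ((A ^ 2 : ℤ) : ℝ) * π := by
        push_cast
        have : (A : ℝ) * B * π = A ^ 2 * ang T 0 := by rw [mul_assoc, ← r1]; ring
        have := mul_lt_mul_of_pos_left hlt hA2
        calc ((2 * k + 1) * (A * B) * π : ℝ) = (2 * k + 1) * (A * B * π) := by ring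
          _ = A ^ 2 * ((2 * k + 1) * ang T 0) := by rw [‹(A : ℝ) * B * π = _›]; ring
          _ < _ := this
      exact_mod_cast lt_of_mul_lt_mul_right this hpi.le
    · by_contra h7
      refine H.frobG A B (k * B) r1 ?_ h7
      rw [hβ]; push_cast; linear_combination (k : ℝ) * r1
  have hzu : NN t w 2 < uu Z t w := d0.1.resolve_left (by rw [hOK]; decide)
  obtain ⟨w', hw', hwu'⟩ : ∃ q ∈ WW Z t, uu Z t q < NN t q 2 := by
    by_contra hc
    push Not at hc
    have h1 := H.tot 2
    have h2 := H.sumu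
    have := Finset.sum_lt_sum hc ⟨w, hw, hzu⟩
    omega
  have hne : w ≠ w' := by rintro rfl; omega
  have m0 := H.le2 0 hw hw' hne
  have m1 := H.le2 1 hw hw' hne
  have m2 := H.le2 2 hw hw' hne
  have cu' := H.ucase hw'
  have r2 := rel w' hw'
  have hcr : A * iB (uu Z t w') (NN t w' 2) = iA k (NN t w' 0) (NN t w' 1) (NN t w' 2) * B := by
    have : ((A * iB (uu Z t w') (NN t w' 2) : ℤ) : ℝ) * π = ((iA k (NN t w' 0) (NN t w' 1) (NN t w' 2) * B : ℤ) : ℝ) * π := by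
      push_cast; rw [mul_assoc, ← r2, mul_assoc, ← r1]; ring
    exact_mod_cast mrc hpi.ne' this
  have d1 := (((((((D1 k (by omega)).resolve_left (by omega) (uu Z t w) (by omega)).resolve_left (by omega) (NN t w 0) (by omega)
    (NN t w 1) (by omega)).resolve_left (by omega) (NN t w 2) (by omega)).resolve_left (by rw [hOK]; decide) (uu Z t w') (by omega)).resolve_left
    (by omega) (NN t w' 0) (by omega) (NN t w' 1) (by omega) (NN t w' 2) (by omega))).resolve_left (by
      rw [not_or]; exact ⟨by omega, fun h => h hcr⟩)
  rw [← hAd, ← hBd] at d1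
  have hBr : (B : ℝ) ≠ 0 := by
    intro h0; rw [h0] at r1
    have : (A : ℝ) * ang T 0 = 0 := by rw [r1]; simp
    rcases mul_eq_zero.1 this with h | h
    · exact hAr h
    · linarith
  have fin : ∀ N : ℤ, A = N * B → N * ang T 0 = π := by
    intro N hN
    apply mlc hBr
    rw [← r1, hN]; push_cast; ring
  obtain ⟨M, hM⟩ : ∃ M, ang T 2 ≤ ang Z M := by
    obtain ⟨M, hM⟩ : ∃ M, 1 ≤ NN t (Z M) 2 := by
      by_contra hc; push Not at hc
      have := hc 0; have := hc 1; have := hc 2; unfold PP at v2; omega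
    refine ⟨M, ?_⟩
    rw [← (H.corner M).1]; unfold NA
    have h1 : (1 : ℝ) ≤ NN t (Z M) 2 := by exact_mod_cast hM
    have := mler h1 (H.apos 2).le
    have := mul_nonneg (Nat.cast_nonneg (α := ℝ) (NN t (Z M) 0)) a0.le
    have := mul_nonneg (Nat.cast_nonneg (α := ℝ) (NN t (Z M) 1)) (H.apos 1).le
    linarith
  have hz : NN t w 1 = 7 → ∀ p ∈ WW Z t, p ≠ w → NN t p 1 = 0 := by
    intro h7 p hp hpw
    have := H.le2 1 hp hw hpw; omega
  have relN : ∀ N : ℤ, N * ang T 0 = π → ∀ p ∈ WW Z t, iA k (NN t p 0) (NN t p 1) (NN t p 2) = iB (uu Z t p) (NN t p 2) * N := by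
    intro N hN p hp
    have := rel p hp
    rw [← hN] at this
    exact_mod_cast mrc a0.ne' (by rw [this]; ring : (iA k (NN t p 0) (NN t p 1) (NN t p 2) : ℝ) * ang T 0 = (iB (uu Z t p) (NN t p 2) * N) * ang T 0)
  rcases d1 with ⟨rfl, h⟩ | ⟨rfl, h, h7, hu2⟩ | ⟨rfl, h, h7, hu2⟩
  · exact H.hept (by have := fin 7 h; push_cast at this; exact this) (by rw [hβ]; norm_num)
  · have hf := fin 14 h
    have h2 : ∀ p ∈ WW Z t, uu Z t p = 2 := by
      intro p hp
      by_cases hpw : p = w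
      · rw [hpw]; exact hu2
      · have e := relN 14 hf p hp
        have := H.ucase hp; have := H.le1 0 hp; have := H.le1 2 hp
        rw [hz h7 p hp hpw] at e; unfold iA iB at e; omega
    push_cast at hf hγ
    exact H.p2 (by linarith) h12 h01 (by linarith) M hM (H.n3 h2 M)
  · have hf := fin 21 h
    have h2 : ∀ p ∈ WW Z t, uu Z t p = 2 := by
      intro p hp
      by_cases hpw : p = w
      · rw [hpw]; exact hu2
      · have e := relN 21 hf p hp
        have := H.ucase hp; have := H.le1 0 hp; have := H.le1 2 hp
        rw [hz h7 p hp hpw] at e; unfold iA iB at e; omega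
    push_cast at hf hγ
    exact H.p2 (by linarith) h12 h01 (by linarith) M hM (H.n3 h2 M)

def jD (P Q x y z : ℤ) : ℤ := P * (z - y) - Q * (z - x)
def jA (Q y z : ℤ) : ℤ := (z - y) - Q * (z - 2)
def jB (P x z : ℤ) : ℤ := P * (z - 2) - (z - x)

lemma r0dec : (allN 8 fun P => allN 8 fun Q => allN (8 - P) fun x => allN (8 - Q) fun y => allN 6 fun z => !decide (3 ≤ z) ||
    ((!decide (0 < jD P Q x y z * jA Q y z) || !decide (0 < jD P Q x y z * (jB P x z - jA Q y z)) ||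
      !decide (0 < jD P Q x y z * (jD P Q x y z - jA Q y z - 2 * jB P x z)) ||
      !decide ((7 : ℤ) ∣ jD P Q x y z / (Int.gcd (jD P Q x y z) (Int.gcd (jA Q y z) (jB P x z)) : ℤ)) ||
      decide ((7 * jA Q y z = jD P Q x y z ∧ jB P x z = 2 * jA Q y z) ∨ (P = 6 ∧ Q = 2 ∧ x = 1 ∧ y = 0 ∧ z = 3) ∨
        (P = 6 ∧ Q = 1 ∧ x = 1 ∧ y = 0 ∧ z = 4) ∨ (P = 7 ∧ Q = 0 ∧ x = 0 ∧ y = 0 ∧ z = 3) ∨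
        (x = 0 ∧ y = 0 ∧ z = 4))) &&
     (!decide (jD P Q x y z = 0) || !decide (jA Q y z = 0) || !decide (jB P x z = 0) || !decide (3 ≤ P + Q) ||
      decide ((z = 3 ∧ x + P = 3 ∧ y + Q = 3 ∧ ((P = 0 ∧ Q = 3) ∨ (P = 1 ∧ Q = 3) ∨ (P = 2 ∧ Q = 3) ∨ (P = 3 ∧ Q = 1) ∨ (P = 3 ∧ Q = 2) ∨ (P = 3 ∧ Q = 3)))
        ∨ (P = 1 ∧ Q = 2) ∨ (P = 2 ∧ Q = 1) ∨ (P = 2 ∧ Q = 2) ∨ (P = 3 ∧ Q = 0))))) = true := by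
  decide +kernel

lemma Til.other (H : Til Z T t) {w : ℂ} (hw : w ∈ WW Z t) (hu : uu Z t w = 2) : ∃ p ∈ WW Z t, p ≠ w := by
  by_contra hc
  push Not at hc
  have h := H.sumu
  have : WW Z t = {w} := by
    ext p; simp only [mem_singleton]
    exact ⟨hc p, fun h => h ▸ hw⟩
  rw [this, Finset.sum_singleton] at h; omega

lemma Til.R0red (H : Til Z T t) (h01 : L T 0 < L T 1) (h12 : L T 1 < L T 2) (hr : ang T 2 ≠ π / 2) (v2 : PP Z t 2 = 0) :
    3 * ang T 2 ≤ 2 * π ∧ (∀ K, 1 ≤ mm Z t K 2) ∧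
    ((PP Z t 0 = 0 ∧ PP Z t 1 = 3) ∨ (PP Z t 0 = 1 ∧ PP Z t 1 = 3) ∨ (PP Z t 0 = 2 ∧ PP Z t 1 = 3) ∨
      (PP Z t 0 = 3 ∧ PP Z t 1 = 1) ∨ (PP Z t 0 = 3 ∧ PP Z t 1 = 2) ∨ (PP Z t 0 = 3 ∧ PP Z t 1 = 3)) ∧
    (ns Z t 0 + ns Z t 1 + ns Z t 2 ≤ 5 ∨
    (ns Z t 0 + ns Z t 1 + ns Z t 2 = 6 ∧ (L T 1 = 2 * L T 0 ∨ L T 2 = 2 * L T 0))) := by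
  have hpi := pi_pos
  have hs := H.asum
  have a0 := H.apos 0
  have b01 : ang T 0 < ang T 1 := (angltiff T H.hT 0).2 h01
  have b12 : ang T 1 < ang T 2 := (angltiff T H.hT 1).2 h12
  have nn : ∀ (n : ℕ) {x : ℝ}, 0 < x → 0 ≤ n * x := fun n x hx => mul_nonneg (Nat.cast_nonneg _) hx.le
  have hg : ∀ p ∈ WW Z t, uu Z t p = 1 → NN t p 2 ≤ 1 := by
    intro p hp hu
    by_contra hc
    have hv := H.vrel hp
    rw [hu] at hv; push_cast at hv
    have n0 := nn (NN t p 0) a0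
    have n1 := nn (NN t p 1) (a0.trans b01)
    have h2 : NN t p 2 = 2 := by
      by_contra h3
      have : (3 : ℝ) ≤ NN t p 2 := by exact_mod_cast (by omega : 3 ≤ NN t p 2)
      have := mler this (H.apos 2).le
      linarith
    rw [h2] at hv; push_cast at hv
    by_cases hx : NN t p 0 = 0
    · by_cases hy : NN t p 1 = 0
      · rw [hx, hy] at hv; push_cast at hv; exact hr (by linarith)
      · have : (1 : ℝ) ≤ NN t p 1 := by exact_mod_cast (by omega : 1 ≤ NN t p 1)
        have := mler this (a0.trans b01).le
        linarith
    · have : (1 : ℝ) ≤ NN t p 0 := by exact_mod_cast (by omega : 1 ≤ NN t p 0)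
      have := mler this a0.le
      linarith
  have hcs := H.cside v2 hg
  obtain ⟨w, hw, hwu⟩ := H.pig 2 v2
  have hu2 : uu Z t w = 2 := by
    rcases H.ucase hw with h | h
    · have := hg w hw h; omega
    · exact h
  have hv := H.vrel hw
  rw [hu2] at hv; push_cast at hv
  have n0 := nn (NN t w 0) a0
  have n1 := nn (NN t w 1) (a0.trans b01)
  have hz3 : (3 : ℝ) ≤ NN t w 2 := by exact_mod_cast (by omega : 3 ≤ NN t w 2)
  have hγ : 3 * ang T 2 ≤ 2 * π := by
    have := mler hz3 (H.apos 2).le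
    linarith
  have hz5 : NN t w 2 < 6 := by
    by_contra hc
    have : (6 : ℝ) ≤ NN t w 2 := by exact_mod_cast not_lt.1 hc
    have := mler this (H.apos 2).le
    linarith
  refine ⟨hγ, hcs, ?_⟩
  have hP := H.Peq
  rw [v2] at hP
  have hP : PP Z t 0 * ang T 0 + PP Z t 1 * ang T 1 = π := by push_cast at hP; linarith
  have l0 := H.le1 0 hw
  have l1 := H.le1 1 hw
  have h3 : 3 ≤ PP Z t 0 + PP Z t 1 := by
    have c0 := H.cpos 0
    have c1 := H.cpos 1
    have c2 := H.cpos 2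
    unfold PP at v2 ⊢; omega
  have D0 := r0dec
  simp only [alliff, Bool.or_eq_true, Bool.and_eq_true, Bool.not_eq_true', decide_eq_true_iff, decide_eq_false_iff_not] at D0
  obtain ⟨d1, d2⟩ := (D0 (PP Z t 0) (by omega) (PP Z t 1) (by omega) (NN t w 0) (by omega) (NN t w 1) (by omega) (NN t w 2) (by omega)).resolve_left (by omega)
  clear D0
  have rA : (jD (PP Z t 0) (PP Z t 1) (NN t w 0) (NN t w 1) (NN t w 2) : ℝ) * ang T 0 = jA (PP Z t 1) (NN t w 1) (NN t w 2) * π := by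
    have e : ang T 2 = π - ang T 0 - ang T 1 := by linarith
    rw [e] at hv
    unfold jD jA; push_cast
    linear_combination ((NN t w 2 : ℝ) - NN t w 1) * hP + (PP Z t 1 : ℝ) * hv
  have rB : (jD (PP Z t 0) (PP Z t 1) (NN t w 0) (NN t w 1) (NN t w 2) : ℝ) * ang T 1 = jB (PP Z t 0) (NN t w 0) (NN t w 2) * π := by
    have e : ang T 2 = π - ang T 0 - ang T 1 := by linarith
    rw [e] at hv
    unfold jD jB; push_cast
    linear_combination -((NN t w 2 : ℝ) - NN t w 0) * hP - (PP Z t 0 : ℝ) * hv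
  set D := jD (PP Z t 0) (PP Z t 1) (NN t w 0) (NN t w 1) (NN t w 2) with hD
  set A := jA (PP Z t 1) (NN t w 1) (NN t w 2) with hA
  set B := jB (PP Z t 0) (NN t w 0) (NN t w 2) with hB
  by_cases hD0 : D = 0
  · have hA0 : A = 0 := by
      rw [hD0] at rA
      have : (A : ℝ) * π = 0 := by rw [← rA]; simp
      exact_mod_cast (mul_eq_zero.1 this).resolve_right hpi.ne'
    have hB0 : B = 0 := by
      rw [hD0] at rB
      have : (B : ℝ) * π = 0 := by rw [← rB]; simp
      exact_mod_cast (mul_eq_zero.1 this).resolve_right hpi.ne'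
    rcases d2.resolve_left (by rw [not_or, not_or, not_or]; refine ⟨⟨⟨?_, ?_⟩, ?_⟩, ?_⟩ <;> rw [not_not] <;> assumption) with
      ⟨z3, xp, yq, hl⟩ | ⟨e0, e1⟩ | ⟨e0, e1⟩ | ⟨e0, e1⟩ | ⟨e0, e1⟩
    · refine ⟨hl, H.six h01 h12 hw hu2 ?_⟩
      rw [z3, Nat.even_iff, Nat.even_iff]; omega
    all_goals
      rw [e0, e1] at hP; push_cast at hP
      first | linarith | exact absurd (by linarith) hr
  · exfalso
    have hDr : (D : ℝ) ≠ 0 := by exact_mod_cast hD0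
    have hD2 : 0 < (D : ℝ) ^ 2 := by positivity
    have pos : ∀ (X : ℤ) (θ : ℝ), 0 < θ → D * θ = X * π → 0 < D * X := by
      intro X θ hθ h
      have : 0 < ((D * X : ℤ) : ℝ) * π := by
        push_cast
        have : (D : ℝ) * X * π = D ^ 2 * θ := by rw [mul_assoc, ← h]; ring
        rw [this]; positivity
      exact_mod_cast pos_of_mul_pos_left this hpi.le
    have hdd := d1.resolve_left (by
      rw [not_or, not_or, not_or]
      refine ⟨⟨⟨?_, ?_⟩, ?_⟩, ?_⟩ <;> rw [not_not]
      · exact pos A (ang T 0) a0 rA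
      · exact pos (B - A) (ang T 1 - ang T 0) (by linarith) (by push_cast; linarith)
      · refine pos (D - A - 2 * B) (ang T 2 - ang T 1) (by linarith) ?_
        have e : ang T 2 = π - ang T 0 - ang T 1 := by linarith
        rw [e]; push_cast; linarith
      · by_contra h7
        exact H.frobG D A B rA rB h7)
    have relN : ∀ (N i j : ℕ), N * ang T 0 = i * π → N * ang T 1 = j * π → ∀ p ∈ WW Z t,
        (NN t p 0 * i + NN t p 1 * j + NN t p 2 * (N - i - j) : ℤ) = uu Z t p * N := by
      intro N i j h0 h1 p hp
      have hv := H.vrel hp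
      have e : ang T 2 = π - ang T 0 - ang T 1 := by linarith
      rw [e] at hv
      have : ((NN t p 0 * i + NN t p 1 * j + NN t p 2 * (N - i - j) : ℤ) : ℝ) * π = ((uu Z t p * N : ℤ) : ℝ) * π := by
        push_cast
        linear_combination (N : ℝ) * hv - (NN t p 0 - NN t p 2 : ℝ) * h0 - (NN t p 1 - NN t p 2 : ℝ) * h1
      exact_mod_cast mrc hpi.ne' this
    rcases hdd with ⟨h7, hBA⟩ | ⟨e0, e1, e2, e3, e4⟩ | ⟨e0, e1, e2, e3, e4⟩ | ⟨e0, e1, e2, e3, e4⟩ | ⟨e2, e3, e4⟩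
    · refine H.hept ?_ ?_
      · have : (A : ℝ) ≠ 0 := by
          intro h; have h : A = 0 := by exact_mod_cast h
          omega
        apply mlc this
        rw [← rA, ← h7]; push_cast; ring
      · apply mlc hDr
        rw [rB, hBA]; push_cast; linear_combination -2 * rA
    · obtain ⟨p, hp, hpw⟩ := H.other hw hu2
      rw [hD, hA, e0, e1, e2, e3, e4] at rA
      rw [hD, hB, e0, e1, e2, e3, e4] at rB
      have := relN 14 1 4 (by norm_num [jD, jA] at rA; push_cast; linarith) (by norm_num [jD, jB] at rB; push_cast; linarith) p hp
      have := H.ucase hp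
      have := H.le2 0 hp hw hpw; have := H.le2 1 hp hw hpw; have := H.le2 2 hp hw hpw
      omega
    · obtain ⟨p, hp, hpw⟩ := H.other hw hu2
      rw [hD, hA, e0, e1, e2, e3, e4] at rA
      rw [hD, hB, e0, e1, e2, e3, e4] at rB
      have := relN 21 2 9 (by norm_num [jD, jA] at rA; push_cast; linarith) (by norm_num [jD, jB] at rB; push_cast; linarith) p hp
      have := H.ucase hp
      have := H.le2 0 hp hw hpw; have := H.le2 1 hp hw hpw; have := H.le2 2 hp hw hpw
      omega
    · rw [hD, hA, e0, e1, e2, e3, e4] at rA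
      rw [hD, hB, e0, e1, e2, e3, e4] at rB
      have hrel := relN 21 3 4 (by norm_num [jD, jA] at rA; push_cast; linarith) (by norm_num [jD, jB] at rB; push_cast; linarith)
      have hall : ∀ p ∈ WW Z t, uu Z t p = 2 := by
        intro p hp
        have := hrel p hp
        have := H.ucase hp
        have := H.le1 0 hp
        omega
      have hn := H.n3 hall
      have hl : ∀ K, L Z K = L T 2 := by
        intro K
        have h := H.sidlen K
        have h1 := hn K
        have h2 := hcs K
        unfold ns at h1
        rw [(by omega : mm Z t K 0 = 0), (by omega : mm Z t K 1 = 0), (by omega : mm Z t K 2 = 1)] at h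
        rw [h]; push_cast; ring
      have q0 := angeqof Z H.hZ 0 (by rw [hl, hl])
      have q1 := angeqof Z H.hZ 1 (by rw [hl, hl])
      have e5 : (0 : Fin 3) + 1 = 1 := rfl
      have e6 : (1 : Fin 3) + 1 = 2 := rfl
      rw [e5] at q0
      rw [e6] at q1
      have hz := angsum Z H.hZ
      have hc := (H.corner 0).1
      unfold NA at hc
      unfold PP at e1 v2
      rw [(by omega : NN t (Z 0) 1 = 0), (by omega : NN t (Z 0) 2 = 0)] at hc
      have f0 : 7 * ang T 0 = π := by norm_num [jD, jA] at rA; linarith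
      have : ((3 * NN t (Z 0) 0 : ℕ) : ℝ) * π = ((7 : ℕ) : ℝ) * π := by
        push_cast; push_cast at hc; rw [← f0]; linarith
      have : 3 * NN t (Z 0) 0 = 7 := by exact_mod_cast mrc hpi.ne' this
      omega
    · rw [e2, e3, e4] at hv; push_cast at hv
      exact hr (by linarith)

def Hr {R : Type*} [CommRing R] (x y z : R) : R := (y * z + y * z) * (y * z + y * z) - (y * y + z * z - x * x) * (y * y + z * z - x * x)

lemma heron (s : CTri) : 4 * |DD s| ^ 2 = Hr (L s 0) (L s 1) (L s 2) := by
  have h1 := lawcos s 0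
  have h2 := laware s 0
  have h3 := sin_sq_add_cos_sq (ang s 0)
  simp only [zero_add] at h1 h2
  have e : L s 1 * L s 1 + L s 2 * L s 2 - L s 0 * L s 0 = 2 * (L s 1 * L s 2 * cos (ang s 0)) := by linarith
  unfold Hr
  rw [h2, e]
  linear_combination 4 * (L s 1 * L s 2) ^ 2 * h3

lemma Til.heron (H : Til Z T t) : Hr (L Z 0) (L Z 1) (L Z 2) = 49 * Hr (L T 0) (L T 1) (L T 2) := by
  rw [← Seven.heron, ← Seven.heron, H.area]; ring

def zs (d : ℤ) (n : ℕ) : ℤ√d := ⟨n, 0⟩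
def zl {d : ℤ} (a b c : ℤ√d) (x y z : ℕ) : ℤ√d := zs d x * a + zs d y * b + zs d z * c

def hchk {d : ℤ} (a b c : ℤ√d) (f : ℕ → ℕ → ℕ → ℕ → ℕ → ℕ → ℕ → ℕ → ℕ → Bool) : Bool :=
  allN 4 fun x0 => allN (4 - x0) fun x1 => allN (4 - x0 - x1) fun x2 => allN (4 - x0 - x1 - x2) fun y0 =>
  allN (4 - x0 - x1 - x2 - y0) fun y1 => allN (4 - x0 - x1 - x2 - y0 - y1) fun y2 =>
  allN (4 - x0 - x1 - x2 - y0 - y1 - y2) fun z0 => allN (4 - x0 - x1 - x2 - y0 - y1 - y2 - z0) fun z1 =>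
  !decide (Hr (zl a b c x0 x1 (x2 + 1)) (zl a b c y0 y1 (y2 + 1)) (zl a b c z0 z1 (4 - x0 - x1 - x2 - y0 - y1 - y2 - z0 - z1)) = zs d 49 * Hr a b c)
    || f x0 x1 (x2 + 1) y0 y1 (y2 + 1) z0 z1 (4 - x0 - x1 - x2 - y0 - y1 - y2 - z0 - z1)

lemma Til.hchk (H : Til Z T t) (hc : ∀ K, 1 ≤ mm Z t K 2) (hn : ns Z t 0 + ns Z t 1 + ns Z t 2 = 6) {d : ℤ} (hd : 0 ≤ d)
    (hd' : ∀ n : ℤ, d ≠ n * n) (a b c : ℤ√d) (r : ℝ) (hr : 0 < r) (h0 : L T 0 = r * Zsqrtd.toReal hd a)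
    (h1 : L T 1 = r * Zsqrtd.toReal hd b) (h2 : L T 2 = r * Zsqrtd.toReal hd c) (f) (hf : Seven.hchk a b c f = true) :
    f (mm Z t 0 0) (mm Z t 0 1) (mm Z t 0 2) (mm Z t 1 0) (mm Z t 1 1) (mm Z t 1 2) (mm Z t 2 0) (mm Z t 2 1) (mm Z t 2 2) = true := by
  have c0 := hc 0
  have c1 := hc 1
  have c2 := hc 2
  have hh := H.heron
  rw [H.sidlen 0, H.sidlen 1, H.sidlen 2, h0, h1, h2] at hh
  unfold ns at hn
  unfold Seven.hchk at hf
  simp only [alliff, Bool.or_eq_true, Bool.not_eq_true', decide_eq_false_iff_not] at hf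
  have h := hf (mm Z t 0 0) (by omega) (mm Z t 0 1) (by omega) (mm Z t 0 2 - 1) (by omega) (mm Z t 1 0) (by omega) (mm Z t 1 1) (by omega)
    (mm Z t 1 2 - 1) (by omega) (mm Z t 2 0) (by omega) (mm Z t 2 1) (by omega)
  rw [(by omega : mm Z t 0 2 - 1 + 1 = mm Z t 0 2), (by omega : mm Z t 1 2 - 1 + 1 = mm Z t 1 2),
    (by omega : 4 - mm Z t 0 0 - mm Z t 0 1 - (mm Z t 0 2 - 1) - mm Z t 1 0 - mm Z t 1 1 - (mm Z t 1 2 - 1) - mm Z t 2 0 - mm Z t 2 1 = mm Z t 2 2)] at h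
  refine h.resolve_left ?_
  rw [not_not]
  apply Zsqrtd.toReal_injective hd hd'
  have z : ∀ n, Zsqrtd.toReal hd (zs d n) = n := by intro n; simp [zs, Zsqrtd.toReal]
  generalize mm Z t 0 0 = x0 at hh ⊢
  generalize mm Z t 0 1 = x1 at hh ⊢
  generalize mm Z t 0 2 = x2 at hh ⊢
  generalize mm Z t 1 0 = y0 at hh ⊢
  generalize mm Z t 1 1 = y1 at hh ⊢
  generalize mm Z t 1 2 = y2 at hh ⊢
  generalize mm Z t 2 0 = z0 at hh ⊢
  generalize mm Z t 2 1 = z1 at hh ⊢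
  generalize mm Z t 2 2 = z2 at hh ⊢
  have hom : ∀ x y z : ℝ, Hr (r * x) (r * y) (r * z) = r ^ 4 * Hr x y z := by intro x y z; unfold Hr; ring
  have hm : ∀ x y z : ℤ√d, Zsqrtd.toReal hd (Hr x y z) = Hr (Zsqrtd.toReal hd x) (Zsqrtd.toReal hd y) (Zsqrtd.toReal hd z) := by
    intro x y z; unfold Hr; simp only [map_sub, map_mul, map_add]
  rw [map_mul, z, hm, hm]
  unfold zl
  simp only [map_add, map_mul, z]
  apply mlc (by positivity : r ^ 4 ≠ 0)
  rw [← hom]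
  have e : ∀ (x y z : ℕ) (a b c : ℝ), r * (x * a + y * b + z * c) = x * (r * a) + y * (r * b) + z * (r * c) := by intros; ring
  rw [e, e, e, hh, hom]; push_cast; ring

def Rel (P Q : ℕ) (a b c : ℝ) : Prop :=
  (P = 0 ∧ Q = 3 ∧ b ^ 2 = a ^ 2 + c ^ 2 - a * c) ∨ (P = 1 ∧ Q = 3 ∧ c ^ 2 = b ^ 2 + a * b) ∨
  (P = 2 ∧ Q = 3 ∧ c * (c ^ 2 - a ^ 2 - b ^ 2) = a * b ^ 2) ∨ (P = 3 ∧ Q = 1 ∧ c ^ 2 = a ^ 2 + a * b) ∨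
  (P = 3 ∧ Q = 2 ∧ c * (c ^ 2 - a ^ 2 - b ^ 2) = a ^ 2 * b) ∨ (P = 3 ∧ Q = 3 ∧ c ^ 2 = a ^ 2 + b ^ 2 + a * b)

lemma Til.rel (H : Til Z T t) (h01 : L T 0 < L T 1) (v2 : PP Z t 2 = 0)
    (hl : (PP Z t 0 = 0 ∧ PP Z t 1 = 3) ∨ (PP Z t 0 = 1 ∧ PP Z t 1 = 3) ∨ (PP Z t 0 = 2 ∧ PP Z t 1 = 3) ∨
      (PP Z t 0 = 3 ∧ PP Z t 1 = 1) ∨ (PP Z t 0 = 3 ∧ PP Z t 1 = 2) ∨ (PP Z t 0 = 3 ∧ PP Z t 1 = 3)) :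
    Rel (PP Z t 0) (PP Z t 1) (L T 0) (L T 1) (L T 2) := by
  have hs := H.asum
  have hP := H.Peq
  rw [v2] at hP
  have c0 := lawcos T 0
  have c1 := lawcos T 1
  have c2 := lawcos T 2
  simp only [zero_add, e1, e2, e3, e4] at c0 c1 c2
  have s20 := lawsin T H.hT 2 0
  have s21 := lawsin T H.hT 2 1
  have sp := fun k => (H.spos k).ne'
  have p2 := H.lp 2
  unfold Rel
  rcases hl with ⟨P0, P1⟩ | ⟨P0, P1⟩ | ⟨P0, P1⟩ | ⟨P0, P1⟩ | ⟨P0, P1⟩ | ⟨P0, P1⟩ <;> rw [P0, P1] at hP ⊢ <;> push_cast at hP <;> simp only [true_and, and_true, OfNat.ofNat_ne_zero,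
      OfNat.ofNat_ne_one, OfNat.zero_ne_ofNat, OfNat.one_ne_ofNat, zero_ne_one, one_ne_zero, false_and, or_false, false_or, Nat.reduceEqDiff]
  · have : ang T 1 = π / 3 := by linarith
    rw [this, cos_pi_div_three] at c1; linarith
  · have : ang T 2 = 2 * ang T 1 := by linarith
    rw [this, sin_two_mul] at s21
    have : L T 2 = 2 * L T 1 * cos (ang T 1) := mrc (sp 1) (by linarith)
    have : (L T 1 - L T 0) * (L T 2 ^ 2 - L T 1 ^ 2 - L T 0 * L T 1) = 0 := by
      linear_combination (-L T 1) * c1 - L T 2 * L T 0 * this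
    rcases mul_eq_zero.1 this with h | h <;> linarith
  · have hh : 2 * ang T 2 = ang T 1 + π := by linarith
    have h2 := sin_two_mul (ang T 2)
    rw [hh, sin_add_pi] at h2
    have : - (2 * L T 2 * cos (ang T 2)) = L T 1 := mrc (sp 2) (by linear_combination L T 2 * h2 + s21)
    linear_combination L T 2 * c2 + L T 0 * L T 1 * this
  · have : ang T 2 = 2 * ang T 0 := by linarith
    rw [this, sin_two_mul] at s20
    have : L T 2 = 2 * L T 0 * cos (ang T 0) := mrc (sp 0) (by linarith)
    have : (L T 0 - L T 1) * (L T 2 ^ 2 - L T 0 ^ 2 - L T 0 * L T 1) = 0 := by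
      linear_combination (-L T 0) * c0 - L T 2 * L T 1 * this
    rcases mul_eq_zero.1 this with h | h <;> linarith
  · have hh : 2 * ang T 2 = ang T 0 + π := by linarith
    have h2 := sin_two_mul (ang T 2)
    rw [hh, sin_add_pi] at h2
    have : - (2 * L T 2 * cos (ang T 2)) = L T 0 := mrc (sp 2) (by linear_combination L T 2 * h2 + s20)
    linear_combination L T 2 * c2 + L T 0 * L T 1 * this
  · have : ang T 2 = π - π / 3 := by linarith
    rw [this, cos_pi_sub, cos_pi_div_three] at c2; linarith

lemma Til.sinpro (H : Til Z T t) {M j : Fin 3} (h : Single Z t M j) : L Z (M+1) * L Z (M+2) = 7 * (L T (j+1) * L T (j+2)) := by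
  have har := H.area
  rw [laware Z M, laware T j, sinang H h] at har
  exact mrc (H.spos j).ne' (by linarith)

lemma Til.sinlab (H : Til Z T t) {M j k : Fin 3} (h : Single Z t M j) (hk : k ≠ j) :
    1 ≤ mm Z t (M+1) k ∨ 1 ≤ mm Z t (M+2) k := by
  obtain ⟨f, g, hfg, -, hS⟩ := H.ends
  obtain ⟨h1, h2, h3⟩ := hS M j h
  have key : k = g (M+1) ∨ k = f (M+2) := by
    generalize g (M+1) = x at *; generalize f (M+2) = y at *; clear * - h1 h2 h3 hk; decide +revert
  rcases key with h | h
  · left; rw [h]; exact (hfg _).2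
  · right; rw [h]; exact (hfg _).1

lemma Til.exsin (H : Til Z T t) (v2 : PP Z t 2 = 0) (h : PP Z t 0 + PP Z t 1 ≤ 5) : ∃ M, Single Z t M 0 ∨ Single Z t M 1 := by
  have z : ∀ k, NN t (Z k) 2 = 0 := by unfold PP at v2; intro k; fin_cases k <;> simp <;> omega
  obtain ⟨M, hM⟩ : ∃ M, NN t (Z M) 0 + NN t (Z M) 1 ≤ 1 := by
    by_contra hc; push Not at hc
    have := hc 0; have := hc 1; have := hc 2; unfold PP at h; omega
  refine ⟨M, ?_⟩
  have := H.cpos M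
  have := z M
  rcases (by omega : (NN t (Z M) 0 = 1 ∧ NN t (Z M) 1 = 0) ∨ (NN t (Z M) 0 = 0 ∧ NN t (Z M) 1 = 1)) with h | h
  · exact Or.inl (sinmk h.1 h.2 this)
  · exact Or.inr (sinmk h.2 this h.1)

lemma Til.n6g (H : Til Z T t) (hc : ∀ K, 1 ≤ mm Z t K 2) (hn : ns Z t 0 + ns Z t 1 + ns Z t 2 = 6) (p : ℤ) (d : ℕ) (hd : Nat.sqrt d * Nat.sqrt d ≠ d)
    (x : ℝ) (h : (2 * x - p * L T 0) ^ 2 = d * L T 0 ^ 2) (hp : p * L T 0 ≤ 2 * x)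
    (hs : (L T 1 = 2 * L T 0 ∧ L T 2 = x ∧ Seven.hchk (d := d) ⟨2, 0⟩ ⟨4, 0⟩ ⟨p, 1⟩ (fun _ _ _ _ _ _ _ _ _ => false) = true) ∨
      (L T 2 = 2 * L T 0 ∧ L T 1 = x ∧ Seven.hchk (d := d) ⟨2, 0⟩ ⟨p, 1⟩ ⟨4, 0⟩ (fun _ _ _ _ _ _ _ _ _ => false) = true)) : False := by
  have h0 := H.lp 0
  have hd0 : (0:ℤ) ≤ d := by positivity
  have hd' : ∀ n : ℤ, (d:ℤ) ≠ n * n := by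
    intro n hn
    apply hd
    have : d = n.natAbs * n.natAbs := by zify; rw [hn, abs_mul_abs_self]
    rw [this, Nat.sqrt_eq]
  have e : x = L T 0 / 2 * (p + √d) := by
    have h1 : 2 * x - p * L T 0 = √d * L T 0 := by
      rw [← pow_left_inj₀ (by linarith) (by positivity) (two_ne_zero), h, mul_pow, sq_sqrt (by positivity)]
    linarith
  have z : ∀ u v : ℤ, Zsqrtd.toReal hd0 ⟨u, v⟩ = u + v * √d := by intro u v; simp [Zsqrtd.toReal]
  rcases hs with ⟨h1, h2, hf⟩ | ⟨h1, h2, hf⟩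
  · exact absurd (H.hchk hc hn hd0 hd' _ _ _ (L T 0 / 2) (by linarith) (by rw [z]; push_cast; ring) (by rw [z, h1]; push_cast; ring)
      (by rw [z, h2, e]; push_cast; ring) _ hf) (by simp)
  · exact absurd (H.hchk hc hn hd0 hd' _ _ _ (L T 0 / 2) (by linarith) (by rw [z]; push_cast; ring) (by rw [z, h2, e]; push_cast; ring)
      (by rw [z, h1]; push_cast; ring) _ hf) (by simp)

def f234 (a b c d e f g h i : ℕ) : Bool :=
  let u : ℕ → ℕ → ℕ → Bool := fun x y z => decide (z = 1 + (1 - x - y) ∧ x + y ≤ 1)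
  u a b c && u d e f && u g h i && decide (a + d + g = 1) && decide (b + e + h = 1)

lemma Til.n234 (H : Til Z T t) (hc : ∀ K, 1 ≤ mm Z t K 2) (hn : ns Z t 0 + ns Z t 1 + ns Z t 2 = 6)
    (h1 : L T 1 = L T 0 / 2 * 3) (h2 : L T 2 = L T 0 / 2 * 4) (hs : ∃ M, Single Z t M 0 ∨ Single Z t M 1) : False := by
  have h0 := H.lp 0
  have hf : Seven.hchk (d := 2) ⟨2, 0⟩ ⟨3, 0⟩ ⟨4, 0⟩ f234 = true := by decide +kernel
  have hd' : ∀ n : ℤ, (2:ℤ) ≠ n * n := by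
    intro n hn
    have : n ≤ 1 := by nlinarith
    have : -1 ≤ n := by nlinarith
    interval_cases n <;> omega
  have D := H.hchk hc hn (by norm_num) hd' _ _ _ (L T 0 / 2) (by linarith) (by simp [Zsqrtd.toReal]) (by rw [h1]; simp [Zsqrtd.toReal])
    (by rw [h2]; simp [Zsqrtd.toReal]) _ hf
  simp only [f234, Bool.and_eq_true, decide_eq_true_iff] at D
  have U : ∀ K, mm Z t K 2 = 1 + (1 - mm Z t K 0 - mm Z t K 1) ∧ mm Z t K 0 + mm Z t K 1 ≤ 1 := by
    intro K; fin_cases K <;> simp <;> omega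
  have S : ∀ K, ∃ n : ℕ, L Z K = L T 0 / 2 * n ∧ (n = 6 ∨ n = 7 ∨ n = 8) ∧ (1 ≤ mm Z t K 0 → n = 6) := by
    intro K
    obtain ⟨u, v⟩ := U K
    refine ⟨2 * mm Z t K 0 + 3 * mm Z t K 1 + 4 * mm Z t K 2, ?_, by omega, by omega⟩
    rw [H.sidlen K, h1, h2]; push_cast; ring
  obtain ⟨M, hM⟩ := hs
  obtain ⟨x, hx, rx, ax⟩ := S (M+1)
  obtain ⟨y, hy, ry, ay⟩ := S (M+2)
  have P : ∀ m : ℕ, L Z (M+1) * L Z (M+2) = (L T 0 / 2) ^ 2 * m → x * y = m := by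
    intro m hm
    rw [hx, hy] at hm
    have : (x:ℝ) * y = m := mlc (by positivity : (L T 0 / 2) ^ 2 ≠ 0) (by linarith)
    exact_mod_cast this
  rcases hM with h | h
  · have := P 84 (by rw [H.sinpro h, zero_add, zero_add, h1, h2]; push_cast; ring)
    rcases rx with rfl | rfl | rfl <;> omega
  · have := P 56 (by rw [H.sinpro h, e1, e2, h2]; push_cast; ring)
    rcases H.sinlab h (k := 0) (by decide) with q | q
    · obtain rfl := ax q; omega
    · obtain rfl := ay q; omega

lemma Til.n6 (H : Til Z T t) (h01 : L T 0 < L T 1) (h12 : L T 1 < L T 2) (hr : ang T 2 ≠ π / 2) (v2 : PP Z t 2 = 0)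
    (hc : ∀ K, 1 ≤ mm Z t K 2) (hR : Rel (PP Z t 0) (PP Z t 1) (L T 0) (L T 1) (L T 2))
    (hn : ns Z t 0 + ns Z t 1 + ns Z t 2 = 6) (h2 : L T 1 = 2 * L T 0 ∨ L T 2 = 2 * L T 0) : False := by
  have h0 := H.lp 0
  have p1 := H.lp 1
  have p2 := H.lp 2
  have nr : L T 2 ^ 2 ≠ L T 0 ^ 2 + L T 1 ^ 2 := by
    intro hh
    have c2 := lawcos T 2
    rw [e3, e4] at c2
    have : cos (ang T 2) = 0 := by
      have : (L T 0 * L T 1) * cos (ang T 2) = 0 := by linarith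
      exact (mul_eq_zero.1 this).resolve_left (by positivity)
    apply hr
    have h1 := H.apos 2
    have h2 := anglt T H.hT 2
    apply injOn_cos ⟨h1.le, h2.le⟩ ⟨by positivity, by linarith⟩
    rw [this, cos_pi_div_two]
  have g := H.n6g hc hn
  rcases h2 with h2 | h2
  · have hR' := hR
    rw [h2] at hR' h12
    rcases hR' with ⟨-, -, e⟩ | ⟨-, -, e⟩ | ⟨-, -, e⟩ | ⟨-, -, e⟩ | ⟨-, -, e⟩ | ⟨-, -, e⟩
    · exact g 1 13 (by norm_num) (L T 2) (by push_cast; linarith) (by push_cast; linarith) (Or.inl ⟨h2, rfl, by decide +kernel⟩)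
    · exact g 0 24 (by norm_num) (L T 2) (by push_cast; linarith) (by push_cast; linarith) (Or.inl ⟨h2, rfl, by decide +kernel⟩)
    · have : (L T 2 + L T 0) * (L T 2 ^ 2 - L T 0 * L T 2 - 4 * L T 0 ^ 2) = 0 := by linarith
      have := (mul_eq_zero.1 this).resolve_left (by positivity)
      exact g 1 17 (by norm_num) (L T 2) (by push_cast; linarith) (by push_cast; linarith) (Or.inl ⟨h2, rfl, by decide +kernel⟩)
    · nlinarith
    · have : (L T 2 + 2 * L T 0) * (L T 2 ^ 2 - 2 * L T 0 * L T 2 - L T 0 ^ 2) = 0 := by linarith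
      have := (mul_eq_zero.1 this).resolve_left (by positivity)
      exact g 2 8 (by norm_num) (L T 2) (by push_cast; linarith) (by push_cast; linarith) (Or.inl ⟨h2, rfl, by decide +kernel⟩)
    · exact g 0 28 (by norm_num) (L T 2) (by push_cast; linarith) (by push_cast; linarith) (Or.inl ⟨h2, rfl, by decide +kernel⟩)
  · have hR' := hR
    rw [h2] at hR' h12
    rcases hR' with ⟨-, -, e⟩ | ⟨-, -, e⟩ | ⟨-, -, e⟩ | ⟨-, -, e⟩ | ⟨P, Q, e⟩ | ⟨-, -, e⟩
    · apply nr; rw [h2]; linarith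
    · exact g (-1) 17 (by norm_num) (L T 1) (by push_cast; linarith) (by push_cast; linarith) (Or.inr ⟨h2, rfl, by decide +kernel⟩)
    · have : L T 0 * (2 * L T 0 ^ 2 - L T 1 ^ 2) = 0 := by linarith
      have := (mul_eq_zero.1 this).resolve_left (by positivity)
      exact g 0 8 (by norm_num) (L T 1) (by push_cast; linarith) (by push_cast; linarith) (Or.inr ⟨h2, rfl, by decide +kernel⟩)
    · nlinarith
    · have : L T 0 * ((L T 1 + 2 * L T 0) * (2 * L T 1 - 3 * L T 0)) = 0 := by linarith
      have := (mul_eq_zero.1 this).resolve_left (by positivity)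
      have := (mul_eq_zero.1 this).resolve_left (by positivity)
      exact H.n234 hc hn (by linarith) (by linarith) (H.exsin v2 (by omega))
    · exact g (-1) 13 (by norm_num) (L T 1) (by push_cast; linarith) (by push_cast; linarith) (Or.inr ⟨h2, rfl, by decide +kernel⟩)

def Ex (a b c S : ℝ) : Prop := S = c + a ∨ S = c + b ∨ S = c + c

lemma rB1 {P Q : ℕ} {a b c S : ℝ} (ha : 0 < a) (hab : a < b) (hbc : b < c) (hR : Rel P Q a b c) (hc : c = 6 * a)
    (hS : Ex a b c S) (h : S ^ 2 = 7 * b ^ 2 - 174 * a ^ 2) : False := by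
  subst hc
  rcases hS with rfl | rfl | rfl
  · have cn : ∀ x : ℝ, x ^ 2 ≠ 223 / 7 → a * b ≠ x * a ^ 2 := by
      intro x hx hh
      have : b = x * a := mlc ha.ne' (by linarith)
      subst this
      exact hx (mrc (by positivity : a ^ 2 ≠ 0) (by linarith))
    rcases hR with ⟨-, -, e⟩ | ⟨-, -, e⟩ | ⟨-, -, e⟩ | ⟨-, -, e⟩ | ⟨-, -, e⟩ | ⟨-, -, e⟩
    · nlinarith
    · exact cn (29 / 7) (by norm_num) (by linarith)
    · have : a * (210 * a ^ 2 - 7 * b ^ 2) = 0 := by linarith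
      have := (mul_eq_zero.1 this).resolve_left ha.ne'
      nlinarith
    · exact cn 35 (by norm_num) (by linarith)
    · have : a * (210 * a ^ 2 - 6 * b ^ 2 - a * b) = 0 := by linarith
      have := (mul_eq_zero.1 this).resolve_left ha.ne'
      exact cn (210 - 6 * 223 / 7) (by norm_num) (by linarith)
    · exact cn (22 / 7) (by norm_num) (by linarith)
  · nlinarith [mul_pos ha ha, mul_pos (sub_pos.2 hbc) ha]
  · nlinarith [mul_pos (sub_pos.2 hbc) ha]

lemma rB2 {a b c S : ℝ} (ha : 0 < a) (hab : a < b) (hbc : b < c) (hg : c ^ 2 ≤ a ^ 2 + b ^ 2 + a * b)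
    (hS : Ex a b c S) (h1 : (c + a) * S = 7 * (a * c)) (h2 : c ^ 2 = (c + a) ^ 2 + S ^ 2 - 7 * (a ^ 2 + c ^ 2 - b ^ 2)) : False := by
  have hc : 0 < c := by linarith
  rcases hS with rfl | rfl | rfl
  · have u : a * (9 * c - 13 * a) ≤ a * (7 * b) := by nlinarith
    have u := le_of_mul_le_mul_left u ha
    have c5 : c * c < c * (5 * a) := by nlinarith
    have c5 := lt_of_mul_lt_mul_left c5 hc.le
    have c4 : 4 * a < c := by nlinarith
    have := pow_le_pow_left₀ (by linarith) u 2
    have : a * (95 * a) ≤ a * (11 * c) := by nlinarith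
    have := le_of_mul_le_mul_left this ha
    linarith
  · have : a * ((c - 3 * a) * (48 * c ^ 2 - 2 * a * c - a ^ 2)) = 0 := by
      linear_combination (1/2) * (c + a) ^ 2 * h2 + (4 * ((c + a) * b + c * (6 * a - c)) + c * (c + a)) * h1
    have := (mul_eq_zero.1 this).resolve_left ha.ne'
    have := (mul_eq_zero.1 this).resolve_right (by nlinarith)
    have : c = 3 * a := by linarith
    subst this
    have : b = 9 / 4 * a := mlc ha.ne' (by linarith)
    subst this
    nlinarith
  · have : c = 5 / 2 * a := mlc hc.ne' (by linarith)
    subst this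
    nlinarith

lemma rB3 {a b c R S : ℝ} (ha : 0 < a) (hab : a < b) (hbc : b < c) (hg : c ^ 2 = a ^ 2 + b ^ 2 + a * b)
    (hR : Ex a b c R) (hS : Ex a b c S) (h1 : c * S = 7 * (a * b)) (h2 : R ^ 2 = c ^ 2 + S ^ 2 - c * S) : False := by
  have hc : 0 < c := by linarith
  have hRS : R < S := by
    have : c < S := by rcases hS with h | h | h <;> linarith
    have : 0 < c * (S - c) := by apply mul_pos <;> linarith
    exact lt_of_pow_lt_pow_left₀ 2 (by linarith) (by nlinarith)
  have two : S = c + c → b = 2 * a := by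
    rintro rfl
    have : (2 * a - b) * (2 * b - a) = 0 := by linarith
    have := (mul_eq_zero.1 this).resolve_right (by linarith)
    linarith
  rcases hR with rfl | rfl | rfl
  · rcases hS with rfl | rfl | rfl
    · linarith
    · have : c = 3 * b - a := mlc (by positivity : 2 * a ≠ 0) (by linarith)
      subst this
      have : 8 * b = 7 * a := mlc (ha.trans hab).ne' (by linarith)
      linarith
    · obtain rfl := two rfl
      have : c = 13 / 2 * a := mlc (by positivity : 2 * a ≠ 0) (by linarith)
      subst this
      nlinarith
  · rcases hS with rfl | rfl | rfl
    · linarith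
    · linarith
    · obtain rfl := two rfl
      have : c = 5 / 2 * a := mlc (by positivity : 4 * a ≠ 0) (by linarith)
      subst this
      nlinarith
  · rcases hS with rfl | rfl | rfl <;> linarith

structure Five (Z T : CTri) (t : Fin 7 → CTri) : Prop where
  H : Til Z T t
  h01 : L T 0 < L T 1
  h12 : L T 1 < L T 2
  v : ∀ K, NN t (Z K) 2 = 0
  hg : L T 2 ^ 2 ≤ L T 0 ^ 2 + L T 1 ^ 2 + L T 0 * L T 1
  hc : ∀ K, 1 ≤ mm Z t K 2
  hR : Rel (PP Z t 0) (PP Z t 1) (L T 0) (L T 1) (L T 2)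

lemma Five.ac (F : Five Z T t) (K : Fin 3) : ang Z K = NN t (Z K) 0 * ang T 0 + NN t (Z K) 1 * ang T 1 := by
  rw [← (F.H.corner K).1]; unfold NA; rw [F.v K]; simp

lemma Five.c1 (F : Five Z T t) {M : Fin 3} (h : Single Z t M 1) :
    L Z M ^ 2 = L Z (M+1) ^ 2 + L Z (M+2) ^ 2 - 7 * (L T 0 ^ 2 + L T 2 ^ 2 - L T 1 ^ 2) := by
  have h1 := lawcos Z M
  have h2 := F.H.sinpro h
  have h3 := lawcos T 1
  rw [e1, e2] at h2 h3
  rw [sinang F.H h] at h1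
  linear_combination h1 - 2 * cos (ang T 1) * h2 - 7 * h3

lemma Five.two (F : Five Z T t) (h0 : ∀ K, ¬ Single Z t K 0) (h1 : ∀ K, ¬ Single Z t K 1) :
    (∀ K, NN t (Z K) 0 + NN t (Z K) 1 = 2) ∧ (∀ M, NN t (Z M) 0 + NN t (Z (M+1)) 0 + NN t (Z (M+2)) 0 = 3) ∧
      L T 2 ^ 2 = L T 0 ^ 2 + L T 1 ^ 2 + L T 0 * L T 1 ∧ ang T 0 + ang T 1 = π / 3 := by
  have w : ∀ K, 2 ≤ NN t (Z K) 0 + NN t (Z K) 1 := by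
    intro K
    by_contra hh
    have u := F.H.cpos K
    have v := F.v K
    rcases (by omega : (NN t (Z K) 0 = 1 ∧ NN t (Z K) 1 = 0) ∨ (NN t (Z K) 0 = 0 ∧ NN t (Z K) 1 = 1)) with h | h
    · exact h0 K (sinmk h.1 h.2 v)
    · exact h1 K (sinmk h.2 v h.1)
  have w0 := w 0
  have w1 := w 1
  have w2 := w 2
  have hP := F.H.Peq
  have e : PP Z t 2 = 0 := by unfold PP; rw [F.v, F.v, F.v]
  obtain ⟨p, q, hh⟩ | ⟨p, q, hh⟩ | ⟨p, q, hh⟩ | ⟨p, q, hh⟩ | ⟨p, q, hh⟩ | ⟨p, q, hh⟩ := F.hR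
  on_goal 6 =>
    rw [e, p, q] at hP
    unfold PP at p q
    refine ⟨fun K => ?_, fun K => ?_, hh, ?_⟩
    · fin_cases K <;> simp <;> omega
    · fin_cases K
      · exact p
      · change NN t (Z 1) 0 + NN t (Z 2) 0 + NN t (Z 0) 0 = 3; omega
      · change NN t (Z 2) 0 + NN t (Z 0) 0 + NN t (Z 1) 0 = 3; omega
    · push_cast at hP; linarith
  all_goals exfalso; unfold PP at p q; omega

lemma anginj (s : CTri) (h : DD s ≠ 0) {k l : Fin 3} (e : ang s k = ang s l) : L s k = L s l := by
  have := lawsin s h k l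
  rw [e] at this
  exact mrc (sinangpos s h l).ne' this

lemma Five.sixty (F : Five Z T t) (M : Fin 3) (h : ang Z M = ang T 0 + ang T 1) : L Z (M+1) * L Z (M+2) = 7 * (L T 0 * L T 1) := by
  have har := F.H.area
  have e : ang T 2 = π - ang Z M := by have := angsum T F.H.hT; linarith
  rw [laware Z M, laware T 2, e, sin_pi_sub, e3, e4] at har
  exact mrc (sinangpos Z F.H.hZ M).ne' (by linarith)

lemma isq (d : ℕ) (hd : ¬ IsSquare d) (x y : ℤ) (h : x ^ 2 = d * y ^ 2) : x = 0 ∧ y = 0 := by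
  have h1 : |(x:ℝ)| = |(y:ℝ)| * √d := by
    rw [← pow_left_inj₀ (by positivity) (by positivity) (two_ne_zero), mul_pow, sq_sqrt (by positivity), sq_abs, sq_abs]
    rw [mul_comm]; exact_mod_cast h
  have := irr d hd |x| (-|y|) (by push_cast; linarith)
  simpa using this

lemma nsq {d : ℕ} (hd : Nat.sqrt d * Nat.sqrt d ≠ d) : ¬ IsSquare d := by
  rintro ⟨r, rfl⟩; rw [Nat.sqrt_eq] at hd; exact hd rfl

lemma indA {a b c : ℝ} (ha : 0 < a) (hb : 0 < b) (h1 : c ^ 2 = 7 * (a * b)) (h2 : c ^ 2 = a ^ 2 + b ^ 2 + a * b)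
    (p q r : ℤ) (h : p * a + q * b + r * c = 0) : p = 0 := by
  have e : b * ((6 * p ^ 2 + 2 * p * q - 7 * r ^ 2) * a - (p ^ 2 - q ^ 2) * b) = 0 := by
    linear_combination (p * a + q * b - r * c) * h + (r ^ 2 - (p:ℝ) ^ 2) * h1 + (p:ℝ) ^ 2 * h2
  have e := (mul_eq_zero.1 e).resolve_left hb.ne'
  have key : ∀ X Y : ℤ, (X:ℝ) * a = Y * b → X = 0 ∧ Y = 0 := by
    intro X Y hXY
    have : b ^ 2 * ((Y - 3 * X) ^ 2 - 8 * X ^ 2) = 0 := by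
      linear_combination (6 * X * b - X * a - Y * b) * hXY + X ^ 2 * (h1 - h2)
    have := (mul_eq_zero.1 this).resolve_left (by positivity)
    have := isq 8 (nsq (by norm_num)) (Y - 3 * X) X (by have : ((Y - 3 * X) ^ 2 - 8 * X ^ 2 : ℝ) = 0 := this; push_cast; exact_mod_cast sub_eq_zero.1 this)
    omega
  obtain ⟨k1, k2⟩ := key (6 * p ^ 2 + 2 * p * q - 7 * r ^ 2) (p ^ 2 - q ^ 2) (by push_cast; linarith)
  have : (p - q) * (p + q) = 0 := by linarith
  rcases mul_eq_zero.1 this with h | h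
  · obtain rfl : q = p := by omega
    have := isq 56 (nsq (by norm_num)) (8 * q) r (by push_cast; linarith)
    omega
  · obtain rfl : q = -p := by omega
    have := isq 7 (nsq (by norm_num)) (2 * p) r (by push_cast; linarith)
    omega

lemma Five.A (F : Five Z T t) (M : Fin 3) (m1 : ns Z t (M+1) = 1) (m2 : ns Z t (M+2) = 1) (m0 : ns Z t M ≤ 3) : False := by
  have H := F.H
  have h01 := F.h01
  have h12 := F.h12
  have pos : 0 < L T 0 := H.lp 0
  have M3 : M + 1 + 2 = M := by clear * -; decide +revert
  have M4 : M + 2 + 1 = M := by clear * -; decide +revert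
  have M5 : M + 1 + 1 = M + 2 := by clear * -; decide +revert
  have M6 : M + 2 + 2 = M + 1 := by clear * -; decide +revert
  have tT := triine T H.hT 2
  rw [e3, e4] at tT
  have c0 := F.hc M
  have c1 := F.hc (M+1)
  have c2 := F.hc (M+2)
  unfold ns at m0 m1 m2
  have l1 : L Z (M+1) = L T 2 := by
    rw [H.sidlen, (by omega : mm Z t (M+1) 0 = 0), (by omega : mm Z t (M+1) 1 = 0), (by omega : mm Z t (M+1) 2 = 1)]; simp
  have l2 : L Z (M+2) = L T 2 := by
    rw [H.sidlen, (by omega : mm Z t (M+2) 0 = 0), (by omega : mm Z t (M+2) 1 = 0), (by omega : mm Z t (M+2) 2 = 1)]; simp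
  have tW := triine Z H.hZ M
  rw [l1, l2] at tW
  have hbase : ang Z (M+1) = ang Z (M+2) := by
    have := angeqof Z H.hZ (M+1) (by rw [M5, l1, l2])
    rwa [M5] at this
  have s0 : ∀ j, Single Z t M j → False := by
    intro j hj
    have : ∃ k, k ≠ j ∧ (k = 0 ∨ k = 1) := by clear * -; decide +revert
    obtain ⟨k, hk, hk'⟩ := this
    rcases H.sinlab hj hk with h | h <;> rcases hk' with rfl | rfl <;> omega
  have hbW : L Z M ≠ 7 * L T 1 := by intro h; linarith
  have cp : L T 2 ≠ 0 := by linarith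
  have s1 : ¬ Single Z t (M+1) 0 := by
    intro h
    have := H.sinpro h
    rw [M5, M3, l2] at this
    exact hbW (mlc cp (by rw [this]; simp; ring))
  have s2 : ¬ Single Z t (M+2) 0 := by
    intro h
    have := H.sinpro h
    rw [M4, M6, l1] at this
    exact hbW (mlc cp (by rw [mul_comm, this]; simp; ring))
  have hb1 : Single Z t (M+1) 1 → L Z M = 7 * L T 0 := by
    intro h
    have := H.sinpro h
    rw [M5, M3, l2, e1, e2] at this
    exact mlc cp (by linarith)
  have ot : ∀ K, ang Z K = ang T 1 → ¬ Single Z t K 1 → False := by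
    intro K hK hs
    have hac := F.ac K
    rw [hK] at hac
    have pa := H.apos 0
    have hab : ang T 0 < ang T 1 := (angltiff T H.hT 0).2 h01
    have n1 : NN t (Z K) 1 = 0 := by
      by_contra hn
      have hh : (1:ℝ) ≤ NN t (Z K) 1 := by exact_mod_cast Nat.one_le_iff_ne_zero.2 hn
      have n0 : NN t (Z K) 0 = 0 := by
        by_contra h0
        have : (1:ℝ) ≤ NN t (Z K) 0 := by exact_mod_cast Nat.one_le_iff_ne_zero.2 h0
        nlinarith
      have : (NN t (Z K) 1 : ℝ) = 1 := by
        rw [n0] at hac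
        exact mrc (by linarith : ang T 1 ≠ 0) (by push_cast at hac; linarith)
      exact hs (sinmk (by exact_mod_cast this) (F.v K) n0)
    have i2 : NN t (Z K) 0 ≠ 0 ∧ NN t (Z K) 0 ≠ 1 := by
      constructor <;> intro h <;> rw [h, n1] at hac <;> push_cast at hac <;> linarith
    have iP : NN t (Z K) 0 ≤ PP Z t 0 := by unfold PP; fin_cases K <;> simp <;> omega
    have hP := H.Peq
    rw [(by unfold PP; rw [F.v, F.v, F.v] : PP Z t 2 = 0)] at hP
    rw [n1] at hac
    have hs := H.asum
    have fin : ∀ i N : ℕ, ang T 1 = i * ang T 0 → N * ang T 0 = π → ¬ 7 ∣ N → False := by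
      intro i N hi hN h7
      refine H.frobN N h7 fun j => ?_
      fin_cases j
      · exact ⟨1, by simp [hN]⟩
      · exact ⟨i, by simp only [Fin.mk_one]; rw [hi]; push_cast; linear_combination (i:ℝ) * hN⟩
      · exact ⟨N - 1 - i, by simp only [Fin.reduceFinMk]; push_cast; linear_combination N * hs - N * hi - (i + 1) * hN⟩
    push_cast at hac
    have hac : ang T 1 = NN t (Z K) 0 * ang T 0 := by linarith
    have : ∀ P Q, PP Z t 0 = P → PP Z t 1 = Q → ((P + NN t (Z K) 0 * Q : ℕ):ℝ) * ang T 0 = π := by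
      intro P Q p q; rw [p, q, hac] at hP; push_cast at hP ⊢; linarith
    have i23 : NN t (Z K) 0 = 2 ∨ NN t (Z K) 0 = 3 := by
      obtain ⟨p, q, -⟩ | ⟨p, q, -⟩ | ⟨p, q, -⟩ | ⟨p, q, -⟩ | ⟨p, q, -⟩ | ⟨p, q, -⟩ := F.hR <;> omega
    have i23' := i23
    obtain ⟨p, q, -⟩ | ⟨p, q, -⟩ | ⟨p, q, -⟩ | ⟨p, q, -⟩ | ⟨p, q, -⟩ | ⟨p, q, -⟩ := F.hR <;> have hN := this _ _ p q <;>
      rcases i23 with hi | hi <;> rw [hi] at hN hac <;>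
      first
      | (exfalso; omega)
      | (refine fin _ _ hac hN ?_; decide)
      | exact H.hept (by norm_num at hN; exact hN) (by push_cast at hac; exact hac)
  by_cases b1 : Single Z t (M+1) 1
  · by_cases b2 : Single Z t (M+2) 1
    · have W := hb1 b1
      obtain ⟨f, g, hfg, hd, hS⟩ := H.ends
      obtain ⟨-, u1, u2⟩ := hS _ _ b1
      obtain ⟨v1, -, v2⟩ := hS _ _ b2
      rw [M5, M3] at u2
      rw [M3] at u1
      rw [M4] at v1
      rw [M4, M6] at v2
      have only : ∀ K, mm Z t K 0 = 0 → mm Z t K 1 = 0 → ∀ x, 1 ≤ mm Z t K x → x = 2 := by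
        intro K k0 k1 x hx; fin_cases x <;> simp at hx ⊢ <;> omega
      have g2 : g (M+2) = 2 := only _ (by omega) (by omega) _ (hfg _).2
      have f1 : f (M+1) = 2 := only _ (by omega) (by omega) _ (hfg _).1
      have dec : ∀ x : Fin 3, x ≠ 1 → x ≠ 2 → x = 0 := by decide
      have f0 := dec _ u1 (by rw [g2] at u2; exact u2.symm)
      have g0 := dec _ v1 (by rw [f1] at v2; exact v2)
      have q0 := (hfg M).1
      rw [f0] at q0
      have q := hd M (by rw [carse]; omega) (by rw [f0, g0])
      rw [f0] at q
      have len := H.sidlen M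
      rw [(by omega : mm Z t M 0 = 2), (by omega : mm Z t M 1 = 0), (by omega : mm Z t M 2 = 1), W] at len
      push_cast at len
      have h := F.c1 b1
      rw [M5, M3, l1, l2, W] at h
      have hg := F.hg
      have c5 : L T 2 = 5 * L T 0 := by linarith
      rw [c5] at h hg
      have : L T 0 * (5 * L T 0) ≤ L T 0 * L T 1 := by linarith
      have := le_of_mul_le_mul_left this pos
      nlinarith
    · exact ot _ (by rw [← hbase, sinang H b1]) b2
  · by_cases b2 : Single Z t (M+2) 1
    · exact ot _ (by rw [hbase, sinang H b2]) b1
    · have cov : ∀ K, K = M ∨ K = M+1 ∨ K = M+2 := by clear * -; decide +revert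
      obtain ⟨w, s, hg, h60⟩ := F.two (by intro K; rcases cov K with rfl | rfl | rfl; exacts [s0 0, s1, s2])
        (by intro K; rcases cov K with rfl | rfl | rfl; exacts [s0 1, b1, b2])
      have hs := s M
      have a1 := F.ac (M+1)
      have a2 := F.ac (M+2)
      have hab : ang T 0 < ang T 1 := (angltiff T H.hT 0).2 h01
      have w0 := w M
      have w1 := w (M+1)
      have w2 := w (M+2)
      have eq : NN t (Z (M+1)) 0 = NN t (Z (M+2)) 0 := by
        rw [hbase, a2] at a1
        have k1 : (NN t (Z (M+1)) 1 : ℝ) = 2 - NN t (Z (M+1)) 0 := by rw [eq_sub_iff_add_eq, add_comm]; exact_mod_cast w1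
        have k2 : (NN t (Z (M+2)) 1 : ℝ) = 2 - NN t (Z (M+2)) 0 := by rw [eq_sub_iff_add_eq, add_comm]; exact_mod_cast w2
        rw [k1, k2] at a1
        have : ((NN t (Z (M+1)) 0 : ℝ) - NN t (Z (M+2)) 0) * (ang T 1 - ang T 0) = 0 := by linarith
        have := (mul_eq_zero.1 this).resolve_right (by linarith)
        exact_mod_cast sub_eq_zero.1 this
      have o : ∀ K, NN t (Z K) 0 = 1 ∧ NN t (Z K) 1 = 1 := by
        intro K; rcases cov K with rfl | rfl | rfl <;> omega
      have a : ∀ K, ang Z K = ang T 0 + ang T 1 := by intro K; rw [F.ac, (o K).1, (o K).2]; simp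
      have lW : L Z M = L T 2 := by rw [← l1]; exact anginj Z H.hZ (by rw [a, a])
      have area := F.sixty M (a M)
      rw [l1, l2] at area
      have p1 := H.lp 1
      refine H.balfal (indA pos p1 (by rw [sq, area]) hg) fun K => ?_
      rcases cov K with rfl | rfl | rfl
      · by_contra hK
        have l := H.sidlen K
        rw [lW] at l
        have u : (1:ℝ) ≤ mm Z t K 0 := by exact_mod_cast Nat.one_le_iff_ne_zero.2 hK
        have v : (1:ℝ) ≤ mm Z t K 2 := by exact_mod_cast c0
        have u' := mler u pos.le
        have v' := mler v (by linarith : 0 ≤ L T 2)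
        have : 0 ≤ (mm Z t K 1 : ℝ) * L T 1 := by positivity
        linarith
      · omega
      · omega

lemma Five.ex (F : Five Z T t) (K : Fin 3) (h : ns Z t K = 2) : Ex (L T 0) (L T 1) (L T 2) (L Z K) ∧
    (1 ≤ mm Z t K 0 → L Z K = L T 2 + L T 0) ∧ (1 ≤ mm Z t K 1 → L Z K = L T 2 + L T 1) := by
  have c := F.hc K
  have l := F.H.sidlen K
  unfold ns at h
  unfold Ex
  rcases (by omega : (mm Z t K 0 = 1 ∧ mm Z t K 1 = 0 ∧ mm Z t K 2 = 1) ∨ (mm Z t K 0 = 0 ∧ mm Z t K 1 = 1 ∧ mm Z t K 2 = 1) ∨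
    (mm Z t K 0 = 0 ∧ mm Z t K 1 = 0 ∧ mm Z t K 2 = 2)) with ⟨u, v, w⟩ | ⟨u, v, w⟩ | ⟨u, v, w⟩ <;> rw [u, v, w] at l <;> rw [u, v] <;> push_cast at l
  · have : L Z K = L T 2 + L T 0 := by linarith
    simp [this]
  · have : L Z K = L T 2 + L T 1 := by linarith
    simp [this]
  · have : L Z K = L T 2 + L T 2 := by linarith
    simp [this]

lemma Five.B (F : Five Z T t) (M : Fin 3) (m0 : ns Z t M = 1) (m1 : ns Z t (M+1) = 2) (m2 : ns Z t (M+2) = 2) : False := by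
  have H := F.H
  have h01 := F.h01
  have h12 := F.h12
  have pos : 0 < L T 0 := H.lp 0
  have M3 : M + 1 + 2 = M := by clear * -; decide +revert
  have M4 : M + 2 + 1 = M := by clear * -; decide +revert
  have M5 : M + 1 + 1 = M + 2 := by clear * -; decide +revert
  have M6 : M + 2 + 2 = M + 1 := by clear * -; decide +revert
  have tT := triine T H.hT 2
  rw [e3, e4] at tT
  obtain ⟨x1, y1, z1⟩ := F.ex _ m1
  obtain ⟨x2, y2, z2⟩ := F.ex _ m2
  have c0 := F.hc M
  unfold ns at m0
  have l0 : L Z M = L T 2 := by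
    rw [H.sidlen, (by omega : mm Z t M 0 = 0), (by omega : mm Z t M 1 = 0), (by omega : mm Z t M 2 = 1)]; simp
  have cp : L T 2 ≠ 0 := by linarith
  have cpos : 0 < L T 2 := by linarith
  have up : ∀ S, Ex (L T 0) (L T 1) (L T 2) S → S ≤ 2 * L T 2 ∧ L T 2 < S := by
    rintro S (rfl | rfl | rfl) <;> constructor <;> linarith
  have s1 : ¬ Single Z t (M+1) 0 := by
    intro h
    have := H.sinpro h
    rw [M5, M3, l0, zero_add, zero_add] at this
    have : L Z (M+2) = 7 * L T 1 := mlc cp (by linarith)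
    have := (up _ x2).1
    linarith
  have s2 : ¬ Single Z t (M+2) 0 := by
    intro h
    have := H.sinpro h
    rw [M4, M6, l0, zero_add, zero_add] at this
    have : L Z (M+1) = 7 * L T 1 := mlc cp (by linarith)
    have := (up _ x1).1
    linarith
  have s0 : ¬ Single Z t M 0 := by
    intro h
    have hp := H.sinpro h
    rw [zero_add, zero_add] at hp
    have no : ∀ X, X ≤ 2 * L T 2 → (L T 2 + L T 1) * X = 7 * (L T 1 * L T 2) → False := by
      intro X hX hh
      have := mlel hX (by linarith : 0 ≤ L T 2 + L T 1)
      have : 0 < L T 2 * (5 * L T 1 - 2 * L T 2) := by apply mul_pos <;> linarith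
      linarith
    rcases H.sinlab h (k := 1) (by decide) with q | q
    · rw [z1 q] at hp; exact no _ (up _ x2).1 hp
    · rw [z2 q] at hp; exact no _ (up _ x1).1 (by linarith)
  have b1 : ¬ Single Z t (M+1) 1 := by
    intro h
    have hp := H.sinpro h
    have hq := F.c1 h
    rw [M5, M3, l0] at hq
    rw [M5, M3, l0, e1, e2] at hp
    have p := H.sinlab h (k := 0) (by decide)
    rw [M5, M3] at p
    have y := y2 (by omega)
    have : L Z (M+2) = 7 * L T 0 := mlc cp (by linarith)
    have hc : L T 2 = 6 * L T 0 := by linarith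
    exact rB1 pos h01 h12 F.hR hc x1 (by rw [hq, this, hc]; ring)
  have b2 : ¬ Single Z t (M+2) 1 := by
    intro h
    have hp := H.sinpro h
    have hq := F.c1 h
    rw [M4, M6, l0] at hq
    rw [M4, M6, l0, e1, e2] at hp
    have p := H.sinlab h (k := 0) (by decide)
    rw [M4, M6] at p
    have y := y1 (by omega)
    have : L Z (M+1) = 7 * L T 0 := mlc cp (by linarith)
    have hc : L T 2 = 6 * L T 0 := by linarith
    exact rB1 pos h01 h12 F.hR hc x2 (by rw [hq, this, hc]; ring)
  have b0 : ¬ Single Z t M 1 := by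
    intro h
    have hp := H.sinpro h
    have hq := F.c1 h
    rw [l0] at hq
    rw [e1, e2] at hp
    rcases H.sinlab h (k := 0) (by decide) with q | q
    · rw [y1 q] at hp hq
      exact rB2 pos h01 h12 F.hg x2 (by linarith) (by linarith)
    · rw [y2 q] at hp hq
      exact rB2 pos h01 h12 F.hg x1 (by linarith) (by linarith)
  have cov : ∀ K, K = M ∨ K = M+1 ∨ K = M+2 := by clear * -; decide +revert
  obtain ⟨w, s, hg, h60⟩ := F.two (by intro K; rcases cov K with rfl | rfl | rfl; exacts [s0, s1, s2])
    (by intro K; rcases cov K with rfl | rfl | rfl; exacts [b0, b1, b2])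
  have hs := s M
  have hab : ang T 0 < ang T 1 := (angltiff T H.hT 0).2 h01
  have mono : ∀ K K', ang Z K ≤ ang Z K' → NN t (Z K') 0 ≤ NN t (Z K) 0 := by
    intro K K' h
    by_contra hn
    rw [F.ac, F.ac] at h
    have k1 : (NN t (Z K) 1 : ℝ) = 2 - NN t (Z K) 0 := by rw [eq_sub_iff_add_eq, add_comm]; exact_mod_cast w K
    have k2 : (NN t (Z K') 1 : ℝ) = 2 - NN t (Z K') 0 := by rw [eq_sub_iff_add_eq, add_comm]; exact_mod_cast w K'
    rw [k1, k2] at h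
    have : (NN t (Z K) 0 : ℝ) < NN t (Z K') 0 := by exact_mod_cast not_le.1 hn
    have : 0 < ((NN t (Z K') 0 : ℝ) - NN t (Z K) 0) * (ang T 1 - ang T 0) := by apply mul_pos <;> linarith
    linarith
  have o1 : ang Z M < ang Z (M+1) := (angltiff Z H.hZ M).2 (by rw [l0]; exact (up _ x1).2)
  have o2 : ang Z M ≤ ang Z (M+2) := by
    by_contra hh
    have h3 := (angltiff Z H.hZ (M+2)).1
    rw [M4, l0] at h3
    have := h3 (not_le.1 hh)
    linarith [(up _ x2).2]
  have q1 := mono _ _ o1.le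
  have q2 := mono _ _ o2
  have w0 := w M
  have w1 := w (M+1)
  have w2 := w (M+2)
  have six : ∀ K, NN t (Z K) 0 = 1 → ang Z K = ang T 0 + ang T 1 := by
    intro K hK
    have := w K
    rw [F.ac, hK, (by omega : NN t (Z K) 1 = 1)]; simp
  have ne : NN t (Z M) 0 ≠ NN t (Z (M+1)) 0 := by
    intro h
    have := F.ac M
    rw [F.ac (M+1), ← h, (by omega : NN t (Z (M+1)) 1 = NN t (Z M) 1), ← F.ac M] at o1
    exact lt_irrefl _ o1
  rcases (by omega : NN t (Z (M+1)) 0 = 1 ∨ NN t (Z (M+2)) 0 = 1) with h | h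
  · have a := six _ h
    have ar := F.sixty _ a
    have lc := lawcos Z (M+1)
    rw [a, h60, cos_pi_div_three, M5, M3, l0] at lc
    rw [M5, M3, l0] at ar
    exact rB3 pos h01 h12 hg x1 x2 (by linarith) (by linarith)
  · have a := six _ h
    have ar := F.sixty _ a
    have lc := lawcos Z (M+2)
    rw [a, h60, cos_pi_div_three, M4, M6, l0] at lc
    rw [M4, M6, l0] at ar
    exact rB3 pos h01 h12 hg x2 x1 (by linarith) (by linarith)

lemma Five.done (F : Five Z T t) (hn : ns Z t 0 + ns Z t 1 + ns Z t 2 ≤ 5) : False := by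
  have p : ∀ K, 1 ≤ ns Z t K := fun K => by have := F.hc K; unfold ns; omega
  have p0 := p 0
  have p1 := p 1
  have p2 := p 2
  rcases (by omega : (ns Z t 1 = 1 ∧ ns Z t 2 = 1 ∧ ns Z t 0 ≤ 3) ∨ (ns Z t 2 = 1 ∧ ns Z t 0 = 1 ∧ ns Z t 1 ≤ 3) ∨
    (ns Z t 0 = 1 ∧ ns Z t 1 = 1 ∧ ns Z t 2 ≤ 3) ∨ (ns Z t 0 = 1 ∧ ns Z t 1 = 2 ∧ ns Z t 2 = 2) ∨
    (ns Z t 1 = 1 ∧ ns Z t 2 = 2 ∧ ns Z t 0 = 2) ∨ (ns Z t 2 = 1 ∧ ns Z t 0 = 2 ∧ ns Z t 1 = 2)) with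
    ⟨a, b, c⟩ | ⟨a, b, c⟩ | ⟨a, b, c⟩ | ⟨a, b, c⟩ | ⟨a, b, c⟩ | ⟨a, b, c⟩
  · exact F.A 0 a b c
  · exact F.A 1 a b c
  · exact F.A 2 a b c
  · exact F.B 0 a b c
  · exact F.B 1 a b c
  · exact F.B 2 a b c

lemma Til.R0 (H : Til Z T t) (h01 : L T 0 < L T 1) (h12 : L T 1 < L T 2) (v2 : PP Z t 2 = 0) : False := by
  by_cases hr : ang T 2 = π / 2
  · exact H.right h01 h12 hr v2
  obtain ⟨h3, hc, hl, hn⟩ := H.R0red h01 h12 hr v2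
  have hR := H.rel h01 v2 hl
  rcases hn with hn | ⟨hn, h2⟩
  · refine Five.done ⟨H, h01, h12, ?_, ?_, hc, hR⟩ hn
    · unfold PP at v2; intro k; fin_cases k <;> simp <;> omega
    · have c2 := lawcos T 2
      rw [e3, e4] at c2
      have p0 := H.lp 0
      have hcos : cos (π - π / 3) ≤ cos (ang T 2) :=
        cos_le_cos_of_nonneg_of_le_pi (H.apos 2).le (by linarith [pi_pos]) (by linarith)
      rw [cos_pi_sub, cos_pi_div_three] at hcos
      have := mlel hcos (mul_pos p0 (p0.trans h01)).le
      linarith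
  · exact H.n6 h01 h12 hr v2 hc hR hn h2

lemma Til.main (H : Til Z T t) (h01 : L T 0 < L T 1) (h12 : L T 1 < L T 2) : False := by
  have hs := H.asum
  have hP := H.Peq
  have a0 := H.apos 0
  have hab : ang T 0 < ang T 1 := (angltiff T H.hT 0).2 h01
  have hbc : ang T 1 < ang T 2 := (angltiff T H.hT 1).2 h12
  have k0 := H.cpos 0
  have k1 := H.cpos 1
  have k2 := H.cpos 2
  have hk : 3 ≤ PP Z t 0 + PP Z t 1 + PP Z t 2 := by unfold PP; omega
  have t0 := H.tot 0
  have hP7 : PP Z t 0 ≤ 7 := by omega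
  have hS := H.S h01 h12
  have hIII := H.caseIII h01 h12
  have hR := H.R0 h01 h12
  generalize PP Z t 0 = P at *
  generalize PP Z t 1 = Q at *
  generalize PP Z t 2 = R at *
  have n0 : (0:ℝ) ≤ P * ang T 0 := by positivity
  have n1 : (0:ℝ) ≤ Q * ang T 1 := mul_nonneg (by positivity) (by linarith)
  have R1 : R ≤ 1 := by
    by_contra hh
    rcases (by omega : 3 ≤ R ∨ (R = 2 ∧ (1 ≤ P ∨ 1 ≤ Q))) with h | ⟨rfl, h⟩
    · have : (3:ℝ) ≤ R := by exact_mod_cast h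
      have := mler this (by linarith : 0 ≤ ang T 2)
      linarith
    · push_cast at hP
      rcases h with h | h
      · have : (1:ℝ) ≤ P := by exact_mod_cast h
        have := mler this a0.le
        linarith
      · have : (1:ℝ) ≤ Q := by exact_mod_cast h
        have := mler this (by linarith : 0 ≤ ang T 1)
        linarith
  rcases (by omega : R = 0 ∨ R = 1) with rfl | rfl
  · exact hR rfl
  push_cast at hP
  rcases Nat.eq_zero_or_pos Q with rfl | hQ
  · have e : ang T 1 = ((P - 1 : ℕ) : ℝ) * ang T 0 := by
      rw [Nat.cast_sub (by omega)]; push_cast at hP ⊢; linarith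
    have : P ≠ 2 := by rintro rfl; norm_num at e; linarith
    exact hIII (P - 1) (by omega) (by omega) e (by omega) rfl rfl
  · rcases (by omega : P = 0 ∧ 2 ≤ Q ∨ 1 ≤ P) with ⟨rfl, h⟩ | h
    · have : (2:ℝ) ≤ Q := by exact_mod_cast h
      have := mler this (by linarith : 0 ≤ ang T 1)
      push_cast at hP
      linarith
    · have u : (1:ℝ) ≤ P := by exact_mod_cast h
      have v : (1:ℝ) ≤ Q := by exact_mod_cast hQ
      have : P = 1 := by
        by_contra hc
        have w : (2:ℝ) ≤ P := by exact_mod_cast (by omega : 2 ≤ P)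
        have := mler w a0.le
        have := mler v (by linarith : 0 ≤ ang T 1)
        linarith
      subst this
      have : Q = 1 := by
        by_contra hc
        have w : (2:ℝ) ≤ Q := by exact_mod_cast (by omega : 2 ≤ Q)
        have := mler w (by linarith : 0 ≤ ang T 1)
        push_cast at hP
        linarith
      exact hS rfl this rfl

lemma Til.final (H : Til Z T t) (h01 : L T 0 ≤ L T 1) (h12 : L T 1 ≤ L T 2) : False := by
  rcases h01.eq_or_lt with e | h01
  · exact H.iso e
  rcases h12.eq_or_lt with e | h12
  · exact (H.permT (finRotate 3)).iso e
  · exact H.main h01 h12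

end Seven

/-- **There is no 7-tiling of any triangle.** For every triangle `ABC` and every
triangle `T`, there is no family of 7 triangles, each congruent to `T`, with
pairwise disjoint interiors, whose union is the closed triangle `ABC`. -/
theorem no_seven_tiling (ABC T : Tri) (hABC : IsTriangle ABC) (hT : IsTriangle T)
    (tiles : Fin 7 → Tri) : ¬ IsTiling 7 ABC T tiles := Seven.transfer (fun _ _ _ H h h' => H.final h h') ABC T hABC hT tiles
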